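/- Let K be a congruence function field over 𝔽₂ with genus g_K = 4 and class number h_K = 1. Then there exists an element T ∈ K with [K : 𝔽₂(T)] = 5, the minimal n such that there exists y ∈ K with [K : 𝔽₂(y)] = n is n = 5, and the rational subfield k = 𝔽₂(T) with [K : k] = 5 is the unique rational subfield of K of degree 5. -/

import Mathlib

set_option synthInstance.maxHeartbeats 1000000
set_option maxHeartbeats 1000000

open scoped Classical

noncomputable section

namespace CFF

variable (F : Type*) [Field F]

/-- `K` is a (congruence) function field in one variable over `F`: a finitely
generated field extension of transcendence degree one. -/
def IsFunctionField (K : Type*) [Field K] [Algebra F K] : Prop :=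
  ∃ x : K, Transcendental F x ∧
    FiniteDimensional (IntermediateField.adjoin F {x}) K

/-- The exact field of constants of `K` is `F`: every element of `K` algebraic
over `F` already lies in `F`. -/
def HasExactConstants (K : Type*) [Field K] [Algebra F K] : Prop :=
  ∀ a : K, IsAlgebraic F a → a ∈ (algebraMap F K).range

variable (K : Type*) [Field K] [Algebra F K]

/-- A place of the function field `K/F`: a proper valuation subring of `K`
containing the constants. -/
def IsPlace (O : ValuationSubring K) : Prop :=
  O ≠ ⊤ ∧ ∀ c : F, algebraMap F K c ∈ O

/-- The type of places (prime divisors) of `K/F`. -/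
def Place := {O : ValuationSubring K // IsPlace F K O}

variable {K}

/-- `𝔪`-adic order of an element of a valuation subring. -/
def ordAux (O : ValuationSubring K) (x : O) : ℕ :=
  sSup {n : ℕ | x ∈ IsLocalRing.maximalIdeal O ^ n}

/-- The order (normalized valuation) of `f ∈ K` at a valuation subring `O`. -/
def ordAt (O : ValuationSubring K) (f : K) : ℤ :=
  if h : f ∈ O then (ordAux O ⟨f, h⟩ : ℤ)
  else -(ordAux O ⟨f⁻¹, (O.mem_or_inv_mem f).resolve_left h⟩ : ℤ)

/-- The constants embed into (the valuation ring of) any place. -/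
def constHom (p : Place F K) : F →+* p.1 :=
  (algebraMap F K).codRestrict p.1.toSubring fun c => p.2.2 c

/-- The map from the constants to the residue field of a place. -/
def residueHom (p : Place F K) : F →+* IsLocalRing.ResidueField p.1 :=
  (IsLocalRing.residue (p.1 : ValuationSubring K)).comp (constHom F p)

/-- The degree of a place: the dimension of its residue field over the
constants. -/
def placeDegree (p : Place F K) : ℕ :=
  letI := (residueHom F p).toAlgebra
  Module.finrank F (IsLocalRing.ResidueField p.1)

variable (K)

/-- The group of divisors of `K/F`. -/
abbrev Divisor := Place F K →₀ ℤ

/-- The degree homomorphism on divisors. -/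
def degHom : Divisor F K →+ ℤ :=
  Finsupp.liftAddHom fun p => AddMonoidHom.mulRight (placeDegree F p : ℤ)

variable {K}

/-- The Riemann-Roch space `L(D)` of a divisor `D` (the span coincides with the
set of `f` with `div f ≥ -D`, which is an `F`-subspace). -/
def RRspace (D : Divisor F K) : Submodule F K :=
  Submodule.span F {f : K | ∀ p : Place F K, 0 ≤ D p + ordAt p.1 f}

/-- `ℓ(D)`, the dimension of the Riemann-Roch space of `D`. -/
def ell (D : Divisor F K) : ℕ := Module.finrank F (RRspace F D)

variable (K)

/-- The genus of `K/F`, via Riemann's theorem: `g = max_D (deg D + 1 - ℓ(D))`. -/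
def genus : ℕ :=
  sSup {g : ℕ | ∃ D : Divisor F K, (g : ℤ) = degHom F K D + 1 - ell F D}

/-- The subgroup of divisors of degree zero. -/
def zeroDivisors : AddSubgroup (Divisor F K) := (degHom F K).ker

/-- The subgroup of principal divisors. -/
def principalDivisors : AddSubgroup (Divisor F K) :=
  AddSubgroup.closure
    {D : Divisor F K | ∃ f : K, f ≠ 0 ∧ ∀ p : Place F K, D p = ordAt p.1 f}

/-- The group of divisor classes of degree zero of `K/F`. -/
def ClassGroup0 :=
  zeroDivisors F K ⧸ (principalDivisors F K).addSubgroupOf (zeroDivisors F K)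

instance : AddGroup (ClassGroup0 F K) := by
  unfold ClassGroup0; infer_instance

/-- The class number of `K/F`: the order of the group of divisor classes of
degree zero. -/
def classNumber : ℕ := Nat.card (ClassGroup0 F K)

section Extension

variable {k L : Type*} [Field k] [Field L] [Algebra F k] [Algebra F L] [Algebra k L]

/-- A place `P` of `L` lies over the place `p` of `k`. -/
def LiesOver (P : Place F L) (p : Place F k) : Prop :=
  P.1.comap (algebraMap k L) = p.1

variable (L)

/-- `p` is inert in `L/k`: there is a unique place of `L` above `p`, and its
degree is `[L:k] · deg p` (i.e. the residue degree is `[L:k]`, so `e = 1`). -/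
def IsInert (p : Place F k) : Prop :=
  ∃ P : Place F L, LiesOver F P p ∧
    placeDegree F P = Module.finrank k L * placeDegree F p ∧
    ∀ P' : Place F L, LiesOver F P' p → P' = P

/-- `p` splits completely in `L/k`: there are `[L:k]` places above `p`, each of
the same degree as `p`. -/
def SplitsCompletely (p : Place F k) : Prop :=
  Nat.card {P : Place F L // LiesOver F P p} = Module.finrank k L ∧
    ∀ P : Place F L, LiesOver F P p → placeDegree F P = placeDegree F p

/-- `p` is totally ramified in `L/k`: there is a unique place above `p`, of the
same degree (so `f = 1` and `e = [L:k]`). -/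
def IsTotallyRamified (p : Place F k) : Prop :=
  ∃ P : Place F L, LiesOver F P p ∧ placeDegree F P = placeDegree F p ∧
    ∀ P' : Place F L, LiesOver F P' p → P' = P

/-- `p` is unramified in `L/k`: at every place above `p` the orders of elements
of `k` are preserved (`e = 1`). -/
def IsUnramifiedAt (p : Place F k) : Prop :=
  ∀ P : Place F L, LiesOver F P p →
    ∀ x : k, ordAt P.1 (algebraMap k L x) = ordAt p.1 x

end Extension

section Rational

/-- The finite place of `𝔽₂(T)` corresponding to an irreducible polynomial `P`:
the place contains all polynomials and `P` lies in its maximal ideal. -/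
def IsFinitePlaceOf (p : Place (ZMod 2) (RatFunc (ZMod 2)))
    (P : Polynomial (ZMod 2)) : Prop :=
  (∀ g : Polynomial (ZMod 2), algebraMap (Polynomial (ZMod 2)) (RatFunc (ZMod 2)) g ∈ p.1) ∧
    (algebraMap (Polynomial (ZMod 2)) (RatFunc (ZMod 2)) P)⁻¹ ∉ p.1

/-- The infinite place `𝔭_∞` of `𝔽₂(T)`: the place where `T` has a pole. -/
def IsInfinitePlace (p : Place (ZMod 2) (RatFunc (ZMod 2))) : Prop :=
  RatFunc.X ∉ p.1

end Rational

end CFF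

set_option linter.unusedSectionVars false

namespace CFF

variable {K : Type} [Field K] [Algebra (ZMod 2) K]

/-- A function field over the field with two elements whose exact field of constants is the
prime field. -/
class IsCFF (K : Type) [Field K] [Algebra (ZMod 2) K] : Prop where
  isFunctionField : IsFunctionField (ZMod 2) K
  exactConstants : HasExactConstants (ZMod 2) K


lemma zmod_two_cases (c : ZMod 2) : c = 0 ∨ c = 1 := by
  revert c; decide

lemma transcendental_of_ne [IsCFF K] {y : K} (h0 : y ≠ 0) (h1 : y ≠ 1) :
    Transcendental (ZMod 2) y := by
  intro h
  obtain ⟨c, hc⟩ := IsCFF.exactConstants y h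
  rcases zmod_two_cases c with rfl | rfl
  · exact h0 (by simpa using hc.symm)
  · exact h1 (by simpa using hc.symm)

instance essFiniteType [h : IsCFF K] : Algebra.EssFiniteType (ZMod 2) K := by
  obtain ⟨x, hx, hfin⟩ := h.isFunctionField
  have : Algebra.EssFiniteType (ZMod 2) (IntermediateField.adjoin (ZMod 2) {x}) := by
    rw [IntermediateField.essFiniteType_iff]
    exact ⟨{x}, by simp⟩
  exact Algebra.EssFiniteType.comp (ZMod 2) (IntermediateField.adjoin (ZMod 2) {x}) K

lemma isTranscendenceBasis_of_transcendental [h : IsCFF K] {y : K}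
    (hy : Transcendental (ZMod 2) y) :
    IsTranscendenceBasis (ZMod 2) (fun _ : Unit => y) := by
  obtain ⟨x, hx, hfin⟩ := h.isFunctionField
  have h1 : AlgebraicIndependent (ZMod 2) (fun _ : Unit => y) :=
    algebraicIndependent_unique_type_iff.2 hy
  have h2 : Algebra.trdeg (ZMod 2) K ≤ 1 := by
    have : Algebra.IsAlgebraic (Algebra.adjoin (ZMod 2) {x}) K := by
      have : Algebra.IsAlgebraic (IntermediateField.adjoin (ZMod 2) {x}) K := inferInstance
      open scoped IntermediateField.algebraAdjoinAdjoin in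
      exact Algebra.IsAlgebraic.trans (Algebra.adjoin (ZMod 2) {x})
        (IntermediateField.adjoin (ZMod 2) {x}) K
    simpa using Algebra.IsAlgebraic.trdeg_le_cardinalMk (ZMod 2) ({x} : Set K)
  exact h1.isTranscendenceBasis_of_trdeg_le_of_finite (by simpa using h2)

lemma finiteDimensional_of_transcendental [h : IsCFF K] {y : K}
    (hy : Transcendental (ZMod 2) y) :
    FiniteDimensional (IntermediateField.adjoin (ZMod 2) {y}) K := by
  have h1 := (isTranscendenceBasis_of_transcendental hy).isAlgebraic_field
  rw [show Set.range (fun _ : Unit => y) = {y} by simp] at h1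
  have : Algebra.EssFiniteType (IntermediateField.adjoin (ZMod 2) {y}) K :=
    Algebra.EssFiniteType.of_comp (ZMod 2) _ K
  exact Algebra.finite_of_essFiniteType_of_isAlgebraic

/-- The degree of `K` over the rational subfield generated by `y`. -/
abbrev degOver (y : K) : ℕ := Module.finrank (IntermediateField.adjoin (ZMod 2) {y}) K

open Polynomial in
lemma linearIndependent_adjoin {ι : Type*} [Fintype ι] {z : K} (u : ι → K)
    (h : ∀ g : ι → (ZMod 2)[X], ∑ i, aeval z (g i) * u i = 0 → g = 0) :
    LinearIndependent (IntermediateField.adjoin (ZMod 2) {z}) u := by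
  open scoped IntermediateField.algebraAdjoinAdjoin in
  rw [← LinearIndependent.iff_fractionRing (Algebra.adjoin (ZMod 2) {z})]
  rw [Fintype.linearIndependent_iff]
  intro g hg
  have h1 : ∀ i, ∃ p : (ZMod 2)[X], aeval z p = (g i : K) := fun i => by
    have h2 : ∀ w ∈ Algebra.adjoin (ZMod 2) {z}, ∃ p : (ZMod 2)[X], aeval z p = w := by
      intro w hw
      rw [Algebra.adjoin_singleton_eq_range_aeval] at hw
      exact hw
    exact h2 _ (g i).2
  choose p hp using h1
  have h2 := h p (by
    rw [← hg]
    exact Finset.sum_congr rfl fun i _ => by rw [hp]; rfl)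
  intro i
  have := hp i
  rw [h2] at this
  exact Subtype.ext (by simpa using this.symm)

open Polynomial in
/-- Elements of a subspace stable under `z` which are independent modulo `z` times it are
independent over the rational function field. -/
lemma linearIndependent_of_mod {ι : Type*} [Fintype ι] {z : K} (hz : z ≠ 0) (M : AddSubgroup K)
    (hM : ∀ f ∈ M, z * f ∈ M) (u : ι → K) (hu : ∀ i, u i ∈ M)
    (h : ∀ c : ι → ZMod 2, (∃ f ∈ M, ∑ i, algebraMap (ZMod 2) K (c i) * u i = z * f) → c = 0) :
    LinearIndependent (IntermediateField.adjoin (ZMod 2) {z}) u := by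
  apply linearIndependent_adjoin
  have hc : ∀ (c : ZMod 2), ∀ f ∈ M, algebraMap (ZMod 2) K c * f ∈ M := by
    intro c f hf
    rcases zmod_two_cases c with rfl | rfl
    · simp
    · simpa using hf
  have hpol : ∀ p : (ZMod 2)[X], ∀ f ∈ M, aeval z p * f ∈ M := by
    intro p
    induction p using Polynomial.induction_on with
    | C a => intro f hf; rw [aeval_C]; exact hc a f hf
    | add p q hp hq => intro f hf; simpa [add_mul] using M.add_mem (hp f hf) (hq f hf)
    | monomial n a ih =>
      intro f hf
      have := ih (z * f) (hM f hf)
      convert this using 1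
      simp [pow_succ]; ring
  have key : ∀ n : ℕ, ∀ g : ι → (ZMod 2)[X], (∀ i, (g i).natDegree < n ∨ g i = 0) →
      ∑ i, aeval z (g i) * u i = 0 → g = 0 := by
    intro n
    induction n with
    | zero =>
      intro g hg _
      funext i
      simpa using hg i
    | succ n ih =>
      intro g hg hsum
      have hdec : ∀ i, aeval z (g i) =
          z * aeval z (g i).divX + algebraMap (ZMod 2) K ((g i).coeff 0) := by
        intro i
        conv_lhs => rw [← X_mul_divX_add (g i)]
        rw [map_add, map_mul, aeval_X, aeval_C]
      have hz0 : (fun i => (g i).coeff 0) = 0 := by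
        apply h
        refine ⟨-∑ i, aeval z (g i).divX * u i,
          M.neg_mem (M.sum_mem fun i _ => hpol _ _ (hu i)), ?_⟩
        rw [mul_neg, eq_neg_iff_add_eq_zero, Finset.mul_sum, ← Finset.sum_add_distrib, ← hsum]
        refine Finset.sum_congr rfl fun i _ => ?_
        rw [hdec i]; ring
      have hz1 : ∀ i, (g i).coeff 0 = 0 := fun i => congrFun hz0 i
      have h2 : (fun i => (g i).divX) = 0 := by
        apply ih
        · intro i
          rcases hg i with h | h
          · simp only [natDegree_divX_eq_natDegree_tsub_one]
            by_cases h3 : (g i).natDegree = 0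
            · right
              rw [eq_C_of_natDegree_eq_zero h3]; simp
            · left; omega
          · right; simp [h]
        · have : z * ∑ i, aeval z (g i).divX * u i = 0 := by
            rw [Finset.mul_sum, ← hsum]
            refine Finset.sum_congr rfl fun i _ => ?_
            rw [hdec i, hz1 i]; simp; ring
          exact (mul_eq_zero.1 this).resolve_left hz
      funext i
      rw [← X_mul_divX_add (g i), hz1 i, show (g i).divX = 0 from congrFun h2 i]
      simp
  intro g hg
  refine key ((Finset.univ.sup fun i => (g i).natDegree) + 1) g (fun i => Or.inl ?_) hg
  exact Nat.lt_succ_of_le (Finset.le_sup (f := fun i => (g i).natDegree) (Finset.mem_univ i))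

section Place

variable (p : Place (ZMod 2) K)

/-- The valuation ring of a place. -/
def Place.ring : ValuationSubring K := p.1

lemma Place.const_mem (c : ZMod 2) : algebraMap (ZMod 2) K c ∈ p.ring := p.2.2 c

/-- The embedding of the constants into the valuation ring of a place. -/
def Place.constants : ZMod 2 →+* p.ring := constHom (ZMod 2) p

lemma Place.coe_constants (c : ZMod 2) : (p.constants c : K) = algebraMap (ZMod 2) K c := rfl

lemma Place.exists_nonunit : ∃ z : p.ring, z ≠ 0 ∧ z ∈ IsLocalRing.maximalIdeal p.ring := by
  have h : ∃ w : K, w ∉ p.ring := by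
    by_contra! h
    exact p.2.1 (eq_top_iff.2 fun x _ => h x)
  obtain ⟨w, hw⟩ := h
  have hw0 : w ≠ 0 := fun h => hw (h ▸ p.ring.zero_mem)
  refine ⟨⟨w⁻¹, (p.ring.mem_or_inv_mem w).resolve_left hw⟩, ?_, ?_⟩
  · intro h
    exact inv_ne_zero hw0 (congrArg Subtype.val h)
  · rw [IsLocalRing.mem_maximalIdeal, mem_nonunits_iff]
    intro hu
    obtain ⟨b, hb⟩ := hu.exists_right_inv
    have hb' : w⁻¹ * (b : K) = 1 := congrArg Subtype.val hb
    have : (b : K) = w := by field_simp at hb'; exact hb'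
    exact hw (this ▸ b.2)

variable [IsCFF K]

lemma Place.finite_quotient (a : p.ring) (ha : a ≠ 0) : Finite (p.ring ⧸ Ideal.span {a}) := by
  by_cases hu : IsUnit a
  · rw [Ideal.span_singleton_eq_top.2 hu]
    infer_instance
  have ha0 : (a : K) ≠ 0 := fun h => ha (Subtype.ext h)
  have ha1 : (a : K) ≠ 1 := fun h => hu (by rw [show a = 1 from Subtype.ext h]; exact isUnit_one)
  have hfin := finiteDimensional_of_transcendental (transcendental_of_ne ha0 ha1)
  let : Algebra (ZMod 2) (p.ring ⧸ Ideal.span {a}) :=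
    ((Ideal.Quotient.mk (Ideal.span {a})).comp p.constants).toAlgebra
  let : Module (ZMod 2) (p.ring ⧸ Ideal.span {a}) := Algebra.toModule
  have hrank : Module.rank (ZMod 2) (p.ring ⧸ Ideal.span {a}) ≤ degOver (a : K) := by
    apply rank_le
    intro s hs
    choose u hu using fun i : s => Ideal.Quotient.mk_surjective (i : p.ring ⧸ Ideal.span {a})
    have hind := linearIndependent_of_mod ha0 p.ring.toSubring.toAddSubgroup
      (fun f hf => p.ring.mul_mem _ _ a.2 hf) (fun i => (u i : K)) (fun i => (u i).2) (by
        rintro c ⟨f, hf, hcf⟩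
        rw [Fintype.linearIndependent_iff] at hs
        funext i
        refine hs c ?_ i
        have : (∑ i, p.constants (c i) * u i) = a * ⟨f, hf⟩ := by
          apply Subtype.ext
          change _ = (a : K) * f
          rw [← hcf]
          push_cast
          simp only [Place.coe_constants]
        have h2 := congrArg (Ideal.Quotient.mk (Ideal.span {a})) this
        rw [map_mul, Ideal.Quotient.eq_zero_iff_mem.2 (Ideal.mem_span_singleton_self a), zero_mul,
          map_sum] at h2
        rw [← h2]
        refine Finset.sum_congr rfl fun i _ => ?_
        rw [map_mul, hu]
        exact Algebra.smul_def (c i) (i : p.ring ⧸ Ideal.span {a}))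
    have := hind.fintype_card_le_finrank
    simpa using this
  have : Module.Finite (ZMod 2) (p.ring ⧸ Ideal.span {a}) :=
    Module.rank_lt_aleph0_iff.1 (hrank.trans_lt ((Cardinal.natCast_lt_aleph0)))
  exact Module.finite_of_finite (ZMod 2)

instance Place.isNoetherianRing : IsNoetherianRing p.ring := by
  rw [isNoetherianRing_iff_ideal_fg]
  intro I
  by_cases hI : I = ⊥
  · rw [hI]; exact Submodule.fg_bot
  obtain ⟨a, haI, ha⟩ := Submodule.exists_mem_ne_zero_of_ne_bot hI
  have := p.finite_quotient a ha
  apply Submodule.fg_of_fg_map_of_fg_inf_ker (Submodule.mkQ (Ideal.span {a}))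
  · exact Module.Finite.iff_fg.1 inferInstance
  · rw [Submodule.ker_mkQ, inf_eq_right.2]
    · exact ⟨{a}, by simp⟩
    · rw [Ideal.span_le]; simpa using haI

instance Place.isDVR : IsDiscreteValuationRing p.ring := by
  have h1 : IsPrincipalIdealRing p.ring := by
    infer_instance
  exact { not_a_field' := by
            obtain ⟨z, hz, hm⟩ := p.exists_nonunit
            intro h
            rw [h] at hm
            exact hz hm }

instance Place.finite_residueField : Finite (IsLocalRing.ResidueField p.ring) := by
  obtain ⟨π, hπ⟩ := IsDiscreteValuationRing.exists_irreducible p.ring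
  have := p.finite_quotient π hπ.ne_zero
  rw [← hπ.maximalIdeal_eq] at this
  exact this

end Place

/-- The normalized valuation of a place. -/
def Place.ord (p : Place (ZMod 2) K) (f : K) : ℤ := ordAt p.1 f

@[simp] lemma Place.ord_zero (p : Place (ZMod 2) K) : p.ord 0 = 0 := by
  have h : (0 : K) ∈ p.1 := p.1.zero_mem
  have h2 : (⟨0, h⟩ : p.1) = 0 := rfl
  simp [Place.ord, ordAt, h, h2, ordAux]

section Place

variable (p : Place (ZMod 2) K) [IsCFF K]

/-- A chosen uniformizer of a place. -/
def Place.unif : K := ((IsDiscreteValuationRing.exists_irreducible p.ring).choose : p.ring)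

lemma Place.exists_irreducible_eq_unif : ∃ π : p.ring, Irreducible π ∧ (π : K) = p.unif :=
  ⟨_, (IsDiscreteValuationRing.exists_irreducible p.ring).choose_spec, rfl⟩

lemma Place.unif_ne_zero : p.unif ≠ 0 := by
  obtain ⟨π, hπ, h⟩ := p.exists_irreducible_eq_unif
  rw [← h]
  exact fun h => hπ.ne_zero (Subtype.ext h)

lemma Place.ordAux_eq (u : p.ringˣ) {π : p.ring} (hπ : Irreducible π) (n : ℕ) :
    ordAux p.ring (u * π ^ n) = n := by
  have : {k : ℕ | (u * π ^ n : p.ring) ∈ IsLocalRing.maximalIdeal p.ring ^ k} = Set.Iic n := by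
    ext k
    simp only [Set.mem_ofPred_eq, Set.mem_Iic]
    rw [hπ.maximalIdeal_eq, Ideal.span_singleton_pow, Ideal.mem_span_singleton,
      Units.dvd_mul_left, pow_dvd_pow_iff hπ.ne_zero hπ.not_isUnit]
  rw [ordAux, this, csSup_Iic]

lemma Place.coe_unit_inv (u : p.ringˣ) :
    (((u⁻¹ : p.ringˣ) : p.ring) : K) = ((u : p.ring) : K)⁻¹ := by
  have : ((u : p.ring) : K) * ((u⁻¹ : p.ringˣ) : p.ring) = 1 :=
    congrArg Subtype.val (u.mul_inv)
  exact eq_inv_of_mul_eq_one_right this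

lemma Place.ord_unit_mul_zpow (u : p.ringˣ) (n : ℤ) :
    p.ord (((u : p.ring) : K) * p.unif ^ n) = n := by
  obtain ⟨π, hπ, h⟩ := p.exists_irreducible_eq_unif
  rw [← h]
  have hπ0 : (π : K) ≠ 0 := h ▸ p.unif_ne_zero
  have hu0 : ((u : p.ring) : K) ≠ 0 := fun h => u.ne_zero (Subtype.ext h)
  have hpos : ∀ (u : p.ringˣ) (n : ℕ), p.ord (((u : p.ring) : K) * (π : K) ^ n) = n := by
    intro u n
    have hm : ((u : p.ring) : K) * (π : K) ^ n ∈ p.ring := (u * π ^ n : p.ring).2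
    have := p.ordAux_eq u hπ n
    change ordAt p.ring _ = _
    rw [ordAt, dif_pos hm, Nat.cast_inj]
    exact this
  obtain ⟨m, rfl | rfl⟩ := n.eq_nat_or_neg
  · simpa using hpos u m
  · rcases Nat.eq_zero_or_pos m with rfl | hm
    · simpa using hpos u 0
    have hnm : ((u : p.ring) : K) * (π : K) ^ (-(m : ℤ)) ∉ p.ring := by
      intro hmem
      have h1 : π ^ m * ⟨_, hmem⟩ = (u : p.ring) := by
        apply Subtype.ext
        change (π : K) ^ m * (((u : p.ring) : K) * (π : K) ^ (-(m : ℤ))) = u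
        rw [zpow_neg, zpow_natCast]
        field_simp
      have h2 : IsUnit (π ^ m) := isUnit_of_mul_isUnit_left (h1 ▸ u.isUnit)
      exact hπ.not_isUnit ((isUnit_pow_iff hm.ne').1 h2)
    have hm' : (((u : p.ring) : K) * (π : K) ^ (-(m : ℤ)))⁻¹ ∈ p.ring :=
      (p.ring.mem_or_inv_mem _).resolve_left hnm
    have := p.ordAux_eq u⁻¹ hπ m
    change ordAt p.ring _ = _
    rw [ordAt, dif_neg hnm, neg_inj, Nat.cast_inj]
    refine Eq.trans ?_ this
    congr 1
    apply Subtype.ext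
    change (((u : p.ring) : K) * (π : K) ^ (-(m : ℤ)))⁻¹ =
      (((u⁻¹ : p.ringˣ) : p.ring) : K) * (π : K) ^ m
    rw [p.coe_unit_inv, mul_inv, zpow_neg, inv_inv, zpow_natCast]

lemma Place.exists_eq_unit_mul_zpow {f : K} (hf : f ≠ 0) :
    ∃ u : p.ringˣ, f = ((u : p.ring) : K) * p.unif ^ (p.ord f) := by
  obtain ⟨π, hπ, h⟩ := p.exists_irreducible_eq_unif
  have key : ∃ (u : p.ringˣ) (n : ℤ), f = ((u : p.ring) : K) * p.unif ^ n := by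
    rcases p.ring.mem_or_inv_mem f with hm | hm
    · obtain ⟨n, u, hu⟩ := IsDiscreteValuationRing.eq_unit_mul_pow_irreducible
        (x := (⟨f, hm⟩ : p.ring)) (fun h => hf (congrArg Subtype.val h)) hπ
      refine ⟨u, n, ?_⟩
      have := congrArg Subtype.val hu
      rw [← h, zpow_natCast]
      exact this
    · obtain ⟨n, u, hu⟩ := IsDiscreteValuationRing.eq_unit_mul_pow_irreducible
        (x := (⟨f⁻¹, hm⟩ : p.ring)) (fun h => inv_ne_zero hf (congrArg Subtype.val h)) hπ
      refine ⟨u⁻¹, -n, ?_⟩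
      have h3 : f⁻¹ = ((u : p.ring) : K) * (π : K) ^ n := congrArg Subtype.val hu
      rw [← h, zpow_neg, zpow_natCast, p.coe_unit_inv, ← mul_inv, ← h3, inv_inv]
  obtain ⟨u, n, hu⟩ := key
  refine ⟨u, ?_⟩
  have : p.ord f = n := by rw [hu]; exact p.ord_unit_mul_zpow u n
  rw [this]; exact hu

lemma Place.ord_mul {f g : K} (hf : f ≠ 0) (hg : g ≠ 0) : p.ord (f * g) = p.ord f + p.ord g := by
  obtain ⟨u, hu⟩ := p.exists_eq_unit_mul_zpow hf
  obtain ⟨w, hw⟩ := p.exists_eq_unit_mul_zpow hg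
  have : f * g = (((u * w : p.ringˣ) : p.ring) : K) * p.unif ^ (p.ord f + p.ord g) := by
    rw [zpow_add₀ p.unif_ne_zero]
    conv_lhs => rw [hu, hw]
    rw [Units.val_mul]
    push_cast
    ring
  rw [this]; exact p.ord_unit_mul_zpow _ _

@[simp] lemma Place.ord_one : p.ord 1 = 0 := by
  have := p.ord_mul (one_ne_zero (α := K)) one_ne_zero
  rw [mul_one] at this
  omega

@[simp] lemma Place.ord_unif : p.ord p.unif = 1 := by
  simpa using p.ord_unit_mul_zpow 1 1

@[simp] lemma Place.ord_inv (f : K) : p.ord f⁻¹ = -p.ord f := by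
  by_cases hf : f = 0
  · simp [hf]
  have := p.ord_mul hf (inv_ne_zero hf)
  rw [mul_inv_cancel₀ hf, p.ord_one] at this
  omega

lemma Place.ord_div {f g : K} (hf : f ≠ 0) (hg : g ≠ 0) : p.ord (f / g) = p.ord f - p.ord g := by
  rw [div_eq_mul_inv, p.ord_mul hf (inv_ne_zero hg), p.ord_inv]; ring

@[simp] lemma Place.ord_pow (f : K) (n : ℕ) : p.ord (f ^ n) = n * p.ord f := by
  by_cases hf : f = 0
  · rcases Nat.eq_zero_or_pos n with rfl | hn
    · simp
    · simp [hf, hn.ne']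
  induction n with
  | zero => simp
  | succ n ih => rw [pow_succ, p.ord_mul (pow_ne_zero _ hf) hf, ih]; push_cast; ring

lemma Place.ord_zpow (f : K) (n : ℤ) : p.ord (f ^ n) = n * p.ord f := by
  obtain ⟨m, rfl | rfl⟩ := n.eq_nat_or_neg
  · simp
  · rw [zpow_neg, p.ord_inv, zpow_natCast, p.ord_pow]; ring

lemma Place.mem_ring_iff {f : K} (hf : f ≠ 0) : f ∈ p.ring ↔ 0 ≤ p.ord f := by
  change _ ↔ 0 ≤ ordAt p.ring f
  constructor
  · intro h
    rw [ordAt, dif_pos h]; positivity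
  · intro h
    obtain ⟨u, hu⟩ := p.exists_eq_unit_mul_zpow hf
    obtain ⟨n, hn⟩ := Int.eq_ofNat_of_zero_le h
    change p.ord f = n at hn
    rw [hu, hn, zpow_natCast]
    obtain ⟨π, hπ, h⟩ := p.exists_irreducible_eq_unif
    rw [← h]
    exact ((u : p.ring) * π ^ n).2

lemma Place.ord_nonneg {f : K} (hf : f ∈ p.ring) : 0 ≤ p.ord f := by
  by_cases h : f = 0
  · simp [h]
  · exact (p.mem_ring_iff h).1 hf

/-- The elements of order at least `n` at a place. -/
def Place.pw (n : ℤ) : AddSubgroup K where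
  carrier := {f | f = 0 ∨ n ≤ p.ord f}
  zero_mem' := Or.inl rfl
  add_mem' := by
    have aux : ∀ f : K, (f = 0 ∨ n ≤ p.ord f) ↔ f * p.unif ^ (-n) ∈ p.ring := by
      intro f
      by_cases hf : f = 0
      · simp [hf, p.ring.zero_mem]
      · have h1 : p.unif ^ (-n) ≠ 0 := zpow_ne_zero _ p.unif_ne_zero
        rw [p.mem_ring_iff (mul_ne_zero hf h1), p.ord_mul hf h1, p.ord_zpow]
        simp [hf]
    intro a b ha hb
    rw [Set.mem_ofPred_eq, aux] at *
    rw [add_mul]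
    exact p.ring.add_mem _ _ ha hb
  neg_mem' := by
    intro a ha
    rcases ha with rfl | ha
    · simp
    · right
      rw [neg_eq_neg_one_mul]
      have h2 : (-1 : K) = 1 := by
        have : ((2 : ZMod 2) : ZMod 2) = 0 := rfl
        have h3 := congrArg (algebraMap (ZMod 2) K) this
        simp only [map_ofNat, map_zero] at h3
        rw [← one_add_one_eq_two] at h3
        exact (eq_neg_of_add_eq_zero_left h3).symm
      rwa [h2, one_mul]

lemma Place.mem_pw {n : ℤ} {f : K} : f ∈ p.pw n ↔ f = 0 ∨ n ≤ p.ord f := Iff.rfl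

lemma Place.mem_pw_of_ne {n : ℤ} {f : K} (hf : f ≠ 0) : f ∈ p.pw n ↔ n ≤ p.ord f := by
  simp [Place.mem_pw, hf]

lemma Place.mem_pw_zero {f : K} : f ∈ p.pw 0 ↔ f ∈ p.ring := by
  by_cases hf : f = 0
  · simp [hf, p.ring.zero_mem]
  · rw [p.mem_pw_of_ne hf, p.mem_ring_iff hf]

lemma Place.pw_anti {m n : ℤ} (h : m ≤ n) : p.pw n ≤ p.pw m := by
  rintro f (rfl | hf)
  · exact Or.inl rfl
  · exact Or.inr (h.trans hf)

lemma Place.mul_mem_pw {m n : ℤ} {f g : K} (hf : f ∈ p.pw m) (hg : g ∈ p.pw n) :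
    f * g ∈ p.pw (m + n) := by
  by_cases hf0 : f = 0
  · simp [hf0]
  by_cases hg0 : g = 0
  · simp [hg0]
  rw [p.mem_pw_of_ne hf0] at hf
  rw [p.mem_pw_of_ne hg0] at hg
  rw [p.mem_pw_of_ne (mul_ne_zero hf0 hg0), p.ord_mul hf0 hg0]
  omega

lemma Place.pow_mem_pw {m : ℤ} {f : K} (hf : f ∈ p.pw m) (n : ℕ) : f ^ n ∈ p.pw (n * m) := by
  induction n with
  | zero => simp [Place.mem_pw]
  | succ n ih =>
    rw [pow_succ, show ((n + 1 : ℕ) : ℤ) * m = n * m + m by push_cast; ring]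
    exact p.mul_mem_pw ih hf

lemma Place.mem_pw_ord (f : K) : f ∈ p.pw (p.ord f) := Or.inr le_rfl

lemma Place.le_ord_add {f g : K} (h : f + g ≠ 0) : min (p.ord f) (p.ord g) ≤ p.ord (f + g) := by
  rw [← p.mem_pw_of_ne h]
  exact (p.pw _).add_mem (p.pw_anti (min_le_left _ _) (p.mem_pw_ord f))
    (p.pw_anti (min_le_right _ _) (p.mem_pw_ord g))

lemma Place.const_mem_pw (c : ZMod 2) : algebraMap (ZMod 2) K c ∈ p.pw 0 := by
  rw [p.mem_pw_zero]; exact p.const_mem c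

/-- The degree of a place. -/
def Place.deg (p : Place (ZMod 2) K) : ℕ := placeDegree (ZMod 2) p

lemma Place.card_residueField : Nat.card (IsLocalRing.ResidueField p.ring) = 2 ^ p.deg := by
  have hfin : Finite (IsLocalRing.ResidueField p.ring) := inferInstance
  change Nat.card (IsLocalRing.ResidueField p.1) = 2 ^ placeDegree (ZMod 2) p
  change Finite (IsLocalRing.ResidueField p.1) at hfin
  rw [placeDegree]
  let := (residueHom (ZMod 2) p).toAlgebra
  rw [Module.natCard_eq_pow_finrank (K := ZMod 2)]
  simp

lemma Place.deg_pos : 0 < p.deg := by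
  by_contra! h
  have := p.card_residueField
  rw [Nat.le_zero.1 h, pow_zero] at this
  have h2 := Finite.one_lt_card (α := IsLocalRing.ResidueField p.ring)
  omega

lemma Place.relIndex_pw (n : ℤ) : (p.pw (n + 1)).relIndex (p.pw n) = 2 ^ p.deg := by
  have h0 := p.unif_ne_zero
  have aux : ∀ f : p.pw n, (f : K) * p.unif ^ (-n) ∈ p.ring := fun f => by
    rw [← p.mem_pw_zero]
    have := p.mul_mem_pw f.2 (p.mem_pw_ord (p.unif ^ (-n)))
    rw [p.ord_zpow, p.ord_unif] at this
    convert this using 2; ring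
  let φ : p.pw n →+ IsLocalRing.ResidueField p.ring :=
    { toFun := fun f => IsLocalRing.residue p.ring ⟨(f : K) * p.unif ^ (-n), aux f⟩
      map_zero' := by
        rw [← map_zero (IsLocalRing.residue p.ring)]
        congr 1
        apply Subtype.ext
        simp
      map_add' := fun f g => by
        rw [← map_add]
        congr 1
        apply Subtype.ext
        change ((f : K) + g) * _ = (f : K) * _ + (g : K) * _
        ring }
  have hker : φ.ker = (p.pw (n + 1)).addSubgroupOf (p.pw n) := by
    ext f
    rw [AddMonoidHom.mem_ker, AddSubgroup.mem_addSubgroupOf]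
    change IsLocalRing.residue p.ring ⟨(f : K) * p.unif ^ (-n), aux f⟩ = 0 ↔ _
    rw [IsLocalRing.residue_eq_zero_iff]
    obtain ⟨π, hπ, h⟩ := p.exists_irreducible_eq_unif
    rw [hπ.maximalIdeal_eq, Ideal.mem_span_singleton]
    constructor
    · rintro ⟨g, hg⟩
      have hg' : (f : K) * p.unif ^ (-n) = p.unif * g := by
        have h3 : (f : K) * p.unif ^ (-n) = π * g := congrArg Subtype.val hg
        rw [h3, h]
      have hf : (f : K) = p.unif ^ (n + 1) * g := by
        rw [zpow_neg, mul_inv_eq_iff_eq_mul₀ (zpow_ne_zero _ h0)] at hg'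
        rw [hg', zpow_add₀ h0, zpow_one]; ring
      rw [hf]
      have := p.mul_mem_pw (p.mem_pw_ord (p.unif ^ (n + 1))) (p.mem_pw_zero.2 g.2)
      rwa [p.ord_zpow, p.ord_unif, mul_one, add_zero] at this
    · intro hf
      have : (f : K) * p.unif ^ (-(n + 1)) ∈ p.ring := by
        rw [← p.mem_pw_zero]
        have := p.mul_mem_pw hf (p.mem_pw_ord (p.unif ^ (-(n + 1))))
        rw [p.ord_zpow, p.ord_unif] at this
        convert this using 2; ring
      refine ⟨⟨_, this⟩, ?_⟩
      apply Subtype.ext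
      change (f : K) * p.unif ^ (-n) = (π : K) * ((f : K) * p.unif ^ (-(n + 1)))
      rw [h, show -n = 1 + -(n + 1) by ring, zpow_add₀ h0, zpow_one]; ring
  have hsurj : Function.Surjective φ := by
    intro y
    obtain ⟨g, rfl⟩ := IsLocalRing.residue_surjective y
    have hm : (g : K) * p.unif ^ n ∈ p.pw n := by
      have := p.mul_mem_pw (p.mem_pw_zero.2 g.2) (p.mem_pw_ord (p.unif ^ n))
      rwa [p.ord_zpow, p.ord_unif, mul_one, zero_add] at this
    refine ⟨⟨_, hm⟩, ?_⟩
    change IsLocalRing.residue p.ring _ = _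
    congr 1
    apply Subtype.ext
    change (g : K) * p.unif ^ n * p.unif ^ (-n) = g
    rw [mul_assoc, ← zpow_add₀ h0]; simp
  rw [AddSubgroup.relIndex, ← hker, AddSubgroup.index_ker, AddMonoidHom.range_eq_top.2 hsurj,
    ← p.card_residueField]
  exact Nat.card_congr AddSubgroup.topEquiv.toEquiv

lemma Place.relIndex_pw_nat (n : ℤ) (m : ℕ) :
    (p.pw (n + m)).relIndex (p.pw n) = 2 ^ (m * p.deg) := by
  induction m with
  | zero => simp
  | succ m ih =>
    rw [← AddSubgroup.relIndex_mul_relIndex (p.pw (n + (m + 1 : ℕ))) (p.pw (n + m)) (p.pw n)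
      (p.pw_anti (by push_cast; omega)) (p.pw_anti (by omega)), ih,
      show n + ((m + 1 : ℕ) : ℤ) = n + m + 1 by push_cast; ring, p.relIndex_pw, ← pow_add]
    congr 1; ring

end Place

lemma two_smul_eq_zero (f : K) : f + f = 0 := by
  have : CharP K 2 := charP_of_injective_algebraMap (algebraMap (ZMod 2) K).injective 2
  exact CharTwo.add_self_eq_zero f

section Approximation

variable [IsCFF K]

lemma Place.ord_one_add (p : Place (ZMod 2) K) {b : K} (hb : b ∈ p.pw 1) :
    1 + b ≠ 0 ∧ p.ord (1 + b) = 0 := by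
  have h1 : (1 : K) ∉ p.pw 1 := by
    rw [p.mem_pw_of_ne one_ne_zero, p.ord_one]; omega
  have h2 : 1 + b ∉ p.pw 1 := fun h => h1 (by simpa using (p.pw 1).sub_mem h hb)
  have h3 : 1 + b ≠ 0 := fun h => h2 (h ▸ (p.pw 1).zero_mem)
  have h4 : 1 + b ∈ p.pw 0 :=
    (p.pw 0).add_mem (by simp [Place.mem_pw]) (p.pw_anti (by omega) hb)
  rw [p.mem_pw_of_ne h3] at h2 h4
  exact ⟨h3, by omega⟩

/-- The absolute value attached to a place. -/
def Place.abv (p : Place (ZMod 2) K) : AbsoluteValue K ℝ where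
  toFun f := if f = 0 then 0 else (2 : ℝ) ^ (-p.ord f)
  map_mul' f g := by
    by_cases hf : f = 0
    · simp [hf]
    by_cases hg : g = 0
    · simp [hg]
    simp only [hf, hg, mul_eq_zero, or_self, if_false]
    rw [p.ord_mul hf hg, neg_add, zpow_add₀ two_ne_zero]
  nonneg' f := by split_ifs <;> positivity
  eq_zero' f := by
    by_cases hf : f = 0
    · simp [hf]
    · simp only [hf, if_false, iff_false]; positivity
  add_le' f g := by
    by_cases hf : f = 0
    · simp [hf]
    by_cases hg : g = 0
    · simp [hg]
    by_cases hfg : f + g = 0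
    · simp only [hfg, if_true, hf, hg, if_false]; positivity
    simp only [hf, hg, hfg, if_false]
    have h := p.le_ord_add hfg
    have h1 : (2 : ℝ) ^ (-p.ord (f + g)) ≤ 2 ^ (max (-p.ord f) (-p.ord g)) := by
      apply zpow_le_zpow_right₀ one_le_two
      omega
    refine h1.trans ?_
    have := zpow_pos (two_pos : (0 : ℝ) < 2) (-p.ord f)
    have := zpow_pos (two_pos : (0 : ℝ) < 2) (-p.ord g)
    rcases max_choice (-p.ord f) (-p.ord g) with h | h <;> rw [h] <;> linarith

lemma Place.abv_of_ne (p : Place (ZMod 2) K) {f : K} (hf : f ≠ 0) :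
    p.abv f = (2 : ℝ) ^ (-p.ord f) := if_neg hf

lemma Place.abv_le_one_iff (p : Place (ZMod 2) K) (f : K) : p.abv f ≤ 1 ↔ f ∈ p.ring := by
  by_cases hf : f = 0
  · simp [hf, p.ring.zero_mem]
  rw [p.abv_of_ne hf, p.mem_ring_iff hf, zpow_le_one_iff_right₀ one_lt_two]
  omega

lemma exists_separating (S : Finset (Place (ZMod 2) K)) (p : Place (ZMod 2) K) (hp : p ∈ S) :
    ∃ a : K, a ≠ 0 ∧ p.ord a < 0 ∧ ∀ q ∈ S, q ≠ p → 0 < q.ord a := by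
  obtain ⟨a, ha, hb⟩ := AbsoluteValue.exists_one_lt_lt_one_pi_of_not_isEquiv
    (v := fun q : S => q.1.abv)
    (fun q => ⟨q.1.unif, q.1.unif_ne_zero, by
      rw [q.1.abv_of_ne q.1.unif_ne_zero, q.1.ord_unif]; norm_num⟩)
    (fun q r hqr heq => hqr (Subtype.ext (Subtype.ext (by
      ext f
      change f ∈ q.1.ring ↔ f ∈ r.1.ring
      rw [← Place.abv_le_one_iff, ← Place.abv_le_one_iff]
      exact heq.le_one_iff)))) ⟨p, hp⟩
  have ha0 : a ≠ 0 := by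
    rintro rfl
    simp at ha
    linarith
  refine ⟨a, ha0, ?_, fun q hq hqp => ?_⟩
  · simp only at ha
    rw [p.abv_of_ne ha0, one_lt_zpow_iff_right₀ one_lt_two] at ha
    omega
  · have := hb ⟨q, hq⟩ (fun h => hqp (congrArg Subtype.val h))
    simp only at this
    rw [q.abv_of_ne ha0, zpow_lt_one_iff_right₀ one_lt_two] at this
    omega

lemma exists_idempotent_approx (S : Finset (Place (ZMod 2) K)) (p : Place (ZMod 2) K) (hp : p ∈ S)
    (N : ℕ) (hN : 0 < N) :
    ∃ e : K, e - 1 ∈ p.pw N ∧ ∀ q ∈ S, q ≠ p → e ∈ q.pw N := by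
  obtain ⟨a, ha0, hap, haq⟩ := exists_separating S p hp
  have hinv : (a⁻¹) ^ N ∈ p.pw N := by
    have : a⁻¹ ∈ p.pw 1 := by
      rw [p.mem_pw_of_ne (inv_ne_zero ha0), p.ord_inv]; omega
    simpa using p.pow_mem_pw this N
  obtain ⟨h1, h2⟩ := p.ord_one_add (p.pw_anti (by omega) hinv)
  refine ⟨(1 + a⁻¹ ^ N)⁻¹, ?_, fun q hq hqp => ?_⟩
  · have : (1 + a⁻¹ ^ N)⁻¹ - 1 = -(a⁻¹ ^ N * (1 + a⁻¹ ^ N)⁻¹) := by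
      have h4 := mul_inv_cancel₀ h1
      linear_combination h4
    rw [this]
    apply (p.pw _).neg_mem
    have h3 := p.mul_mem_pw hinv (p.mem_pw_ord (1 + a⁻¹ ^ N)⁻¹)
    rwa [p.ord_inv, h2, neg_zero, add_zero] at h3
  · have hpos : a ^ N ∈ q.pw N := by
      have : a ∈ q.pw 1 := by
        rw [q.mem_pw_of_ne ha0]; have := haq q hq hqp; omega
      simpa using q.pow_mem_pw this N
    obtain ⟨h3, h4⟩ := q.ord_one_add (q.pw_anti (by omega) hpos)
    have : (1 + a⁻¹ ^ N)⁻¹ = a ^ N * (1 + a ^ N)⁻¹ := by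
      have h5 : a ^ N ≠ 0 := pow_ne_zero _ ha0
      rw [inv_pow] at h1 ⊢
      rw [eq_mul_inv_iff_mul_eq₀ h3, inv_mul_eq_iff_eq_mul₀ h1]
      field_simp
      ring
    rw [this]
    have h5 := q.mul_mem_pw hpos (q.mem_pw_ord (1 + a ^ N)⁻¹)
    rwa [q.ord_inv, h4, neg_zero, add_zero] at h5

/-- Weak approximation. -/
lemma exists_approx (S : Finset (Place (ZMod 2) K)) (x : Place (ZMod 2) K → K)
    (n : Place (ZMod 2) K → ℤ) : ∃ y : K, ∀ p ∈ S, y - x p ∈ p.pw (n p) := by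
  obtain ⟨N, hN⟩ := Finite.exists_le
    (fun r : S × S => (n r.1.1 - r.1.1.ord (x r.2.1)).toNat + 1)
  by_cases hS : S = ∅
  · exact ⟨0, by simp [hS]⟩
  obtain ⟨p0, hp0⟩ := Finset.nonempty_iff_ne_empty.2 hS
  have hN0 : 0 < N := lt_of_lt_of_le (Nat.succ_pos _) (hN (⟨p0, hp0⟩, ⟨p0, hp0⟩))
  have hNb : ∀ p ∈ S, ∀ q ∈ S, n p ≤ p.ord (x q) + N := by
    intro p hp q hq
    have := hN (⟨p, hp⟩, ⟨q, hq⟩)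
    simp only at this
    omega
  have := fun p : S => exists_idempotent_approx S p.1 p.2 N hN0
  choose e he1 he2 using this
  refine ⟨∑ q : S, x q * e q, fun p hp => ?_⟩
  have : ∑ q : S, x q * e q - x p =
      ∑ q : S, x q * (e q - if q = ⟨p, hp⟩ then 1 else 0) := by
    simp_rw [mul_sub, Finset.sum_sub_distrib, mul_ite, mul_one, mul_zero]
    simp
  rw [this]
  apply (p.pw _).sum_mem
  intro q _
  refine p.pw_anti (hNb p hp q q.2) (p.mul_mem_pw (p.mem_pw_ord _) ?_)
  split_ifs with h
  · subst h; exact he1 _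
  · rw [sub_zero]; exact he2 q p hp (fun h2 => h (Subtype.ext h2.symm))

lemma relIndex_iInf_pw (S : Finset (Place (ZMod 2) K)) (n : Place (ZMod 2) K → ℕ) :
    (⨅ p ∈ S, p.pw (n p)).relIndex (⨅ p ∈ S, p.pw 0) = 2 ^ (∑ p ∈ S, n p * p.deg) := by
  set M : AddSubgroup K := ⨅ p ∈ S, p.pw 0 with hM
  have hMem : ∀ f : M, ∀ p : S, (f : K) ∈ p.1.pw 0 := by
    intro f p
    have := f.2
    simp only [hM, AddSubgroup.mem_iInf] at this
    exact this p.1 p.2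
  let φ : M →+ (∀ p : S, p.1.pw 0 ⧸ (p.1.pw (n p.1)).addSubgroupOf (p.1.pw 0)) :=
    { toFun := fun f p => QuotientAddGroup.mk ⟨(f : K), hMem f p⟩
      map_zero' := rfl
      map_add' := fun f g => rfl }
  have hker : φ.ker = (⨅ p ∈ S, p.pw (n p)).addSubgroupOf M := by
    ext f
    rw [AddMonoidHom.mem_ker, AddSubgroup.mem_addSubgroupOf, funext_iff]
    simp only [AddSubgroup.mem_iInf]
    constructor
    · intro h p hp
      exact (QuotientAddGroup.eq_zero_iff (⟨f, hMem f ⟨p, hp⟩⟩ : p.pw 0)).1 (h ⟨p, hp⟩)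
    · intro h p
      exact (QuotientAddGroup.eq_zero_iff (⟨f, hMem f p⟩ : p.1.pw 0)).2 (h p.1 p.2)
  have hsurj : Function.Surjective φ := by
    intro y
    choose r hr using fun p : S => QuotientAddGroup.mk_surjective (y p)
    obtain ⟨g, hg⟩ := exists_approx S
      (fun p => if h : p ∈ S then (r ⟨p, h⟩ : K) else 0) (fun p => n p)
    have hg' : ∀ p : S, g - r p ∈ p.1.pw (n p.1) := by
      intro p
      have := hg p.1 p.2
      rwa [dif_pos p.2] at this
    have hgM : g ∈ M := by
      simp only [hM, AddSubgroup.mem_iInf]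
      intro p hp
      have h1 := p.pw_anti (by omega : (0 : ℤ) ≤ n p) (hg' ⟨p, hp⟩)
      simpa using (p.pw 0).add_mem h1 (r ⟨p, hp⟩).2
    refine ⟨⟨g, hgM⟩, ?_⟩
    funext p
    rw [← hr p]
    change QuotientAddGroup.mk _ = _
    rw [eq_comm, QuotientAddGroup.eq]
    have : -r p + ⟨g, hMem ⟨g, hgM⟩ p⟩ = (⟨g - r p, (p.1.pw 0).sub_mem (hMem ⟨g, hgM⟩ p) (r p).2⟩
        : p.1.pw 0) := by
      apply Subtype.ext
      change -(r p : K) + g = g - r p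
      ring
    rw [this]
    exact hg' p
  rw [AddSubgroup.relIndex, ← hker, AddSubgroup.index_ker, AddMonoidHom.range_eq_top.2 hsurj,
    Nat.card_congr AddSubgroup.topEquiv.toEquiv, Nat.card_pi]
  rw [← Finset.prod_pow_eq_pow_sum,
    ← Finset.prod_coe_sort S (fun p => 2 ^ (n p * p.deg))]
  refine Finset.prod_congr rfl fun p _ => ?_
  have := p.1.relIndex_pw_nat 0 (n p.1)
  rw [zero_add] at this
  rw [← this]
  rfl

lemma le_degOver_of_relIndex {z : K} (hz : Transcendental (ZMod 2) z) (M : AddSubgroup K)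
    (hM : ∀ f ∈ M, z * f ∈ M) (N : AddSubgroup K) (hN : ∀ g ∈ M, z * g ∈ N) {m : ℕ}
    (hm : N.relIndex M = 2 ^ m) : m ≤ degOver z := by
  have hz0 : z ≠ 0 := by rintro rfl; exact hz isAlgebraic_zero
  have hfin := finiteDimensional_of_transcendental hz
  let Q := M ⧸ N.addSubgroupOf M
  let : Module (ZMod 2) Q := AddCommGroup.zmodModule (n := 2) (fun x => by
    obtain ⟨y, rfl⟩ := QuotientAddGroup.mk_surjective x
    rw [two_nsmul, ← QuotientAddGroup.mk_add]
    rw [show y + y = 0 from Subtype.ext (two_smul_eq_zero (y : K))]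
    rfl)
  have hcard : Nat.card Q = 2 ^ m := hm
  have : Finite Q := Nat.finite_of_card_ne_zero (by rw [hcard]; positivity)
  have hrank : Module.finrank (ZMod 2) Q = m := by
    rw [Module.natCard_eq_pow_finrank (K := ZMod 2)] at hcard
    simpa using hcard
  let b := Module.finBasis (ZMod 2) Q
  choose u hu using fun i => QuotientAddGroup.mk_surjective (b i)
  have hmem : ∀ (c : Fin (Module.finrank (ZMod 2) Q) → ZMod 2) (j),
      algebraMap (ZMod 2) K (c j) * u j ∈ M := by
    intro c j
    rcases zmod_two_cases (c j) with h | h <;> simp [h]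
  have hind := linearIndependent_of_mod hz0 M hM (fun i => (u i : K)) (fun i => (u i).2) (by
    rintro c ⟨f, hf, hcf⟩
    have hb := Fintype.linearIndependent_iff.1 b.linearIndependent
    funext i
    refine hb c ?_ i
    have hsm' : ∀ (e : ZMod 2) (j) (he : algebraMap (ZMod 2) K e * u j ∈ M),
        e • b j = (QuotientAddGroup.mk ⟨algebraMap (ZMod 2) K e * u j, he⟩ : Q) := by
      intro e j he
      rcases zmod_two_cases e with rfl | rfl
      · refine (zero_smul (ZMod 2) (b j)).trans (Eq.symm ?_)
        refine (QuotientAddGroup.eq_zero_iff _).2 ?_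
        rw [AddSubgroup.mem_addSubgroupOf]
        simp
      · refine (one_smul (ZMod 2) (b j)).trans ((hu j).symm.trans ?_)
        congr 1
        apply Subtype.ext
        simp
    have hsm := fun j => hsm' (c j) j (hmem c j)
    simp_rw [hsm]
    rw [← QuotientAddGroup.mk_sum]
    refine (QuotientAddGroup.eq_zero_iff _).2 ?_
    rw [AddSubgroup.mem_addSubgroupOf, AddSubmonoidClass.coe_finsetSum]
    rw [hcf]
    exact hN f hf)
  have := hind.fintype_card_le_finrank
  simpa [hrank] using this

end Approximation

section Divisors

variable [IsCFF K]

lemma exists_ord_pos {z : K} (hz : Transcendental (ZMod 2) z) :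
    ∃ p : Place (ZMod 2) K, 0 < p.ord z := by
  have hz0 : z ≠ 0 := by rintro rfl; exact hz isAlgebraic_zero
  let A := (Algebra.adjoin (ZMod 2) {z}).toSubring
  let zA : A := ⟨z, Algebra.subset_adjoin (Set.mem_singleton z)⟩
  have hI : Ideal.span {zA} ≠ ⊤ := by
    rw [Ne, Ideal.span_singleton_eq_top]
    intro h
    obtain ⟨w, hw⟩ := h.exists_right_inv
    have hw' : (w : K) ∈ Algebra.adjoin (ZMod 2) {z} := w.2
    rw [Algebra.adjoin_singleton_eq_range_aeval] at hw'
    obtain ⟨g, hg⟩ := hw'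
    have hg : Polynomial.aeval z g = (w : K) := hg
    refine hz ⟨Polynomial.X * g - 1, ?_, ?_⟩
    · intro h0
      have := congrArg (Polynomial.eval 0) h0
      simp at this
    · have := congrArg Subtype.val hw
      change z * (w : K) = 1 at this
      simp [hg, this]
  obtain ⟨V, hAV, hV⟩ := Ideal.image_subset_nonunits_valuationSubring _ hI
  have hzV : z ∈ V.nonunits := hV ⟨zA, Ideal.mem_span_singleton_self _, rfl⟩
  have hzinv : z⁻¹ ∉ V := by
    rw [ValuationSubring.mem_nonunits_iff] at hzV
    rw [← V.valuation_le_one_iff, map_inv₀, not_le]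
    exact (one_lt_inv₀ (by simpa [zero_lt_iff] using hz0)).2 hzV
  let p : Place (ZMod 2) K := ⟨V, fun h => hzinv (h ▸ ValuationSubring.mem_top _),
    fun c => hAV (Subalgebra.algebraMap_mem _ c)⟩
  refine ⟨p, ?_⟩
  have : ¬ (0 ≤ p.ord z⁻¹) := by
    rw [← p.mem_ring_iff (inv_ne_zero hz0)]; exact hzinv
  rw [p.ord_inv] at this
  omega

lemma sum_ord_le {z : K} (hz : Transcendental (ZMod 2) z) (S : Finset (Place (ZMod 2) K))
    (hS : ∀ p ∈ S, 0 ≤ p.ord z) : ∑ p ∈ S, p.ord z * p.deg ≤ degOver z := by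
  have hz0 : z ≠ 0 := by rintro rfl; exact hz isAlgebraic_zero
  have := le_degOver_of_relIndex hz (⨅ p ∈ S, p.pw 0) (by
      intro f hf
      simp only [AddSubgroup.mem_iInf] at hf ⊢
      intro p hp
      simpa using p.mul_mem_pw (p.pw_anti (hS p hp) (p.mem_pw_ord z)) (hf p hp))
    (⨅ p ∈ S, p.pw ((p.ord z).toNat : ℕ)) (by
      intro f hf
      simp only [AddSubgroup.mem_iInf] at hf ⊢
      intro p hp
      have := p.mul_mem_pw (p.mem_pw_ord z) (hf p hp)
      rwa [add_zero, ← Int.toNat_of_nonneg (hS p hp)] at this)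
    (relIndex_iInf_pw S (fun p => (p.ord z).toNat))
  zify at this
  refine le_trans (le_of_eq ?_) this
  refine Finset.sum_congr rfl fun p hp => ?_
  rw [Int.toNat_of_nonneg (hS p hp)]

lemma finite_ord_pos {z : K} (hz : Transcendental (ZMod 2) z) :
    {p : Place (ZMod 2) K | 0 < p.ord z}.Finite := by
  by_contra h
  obtain ⟨S, hS, hcard⟩ := Set.Infinite.exists_subset_card_eq h (degOver z + 1)
  have h1 := sum_ord_le hz S (fun p hp => le_of_lt (hS hp))
  have h2 : ∑ p ∈ S, (1 : ℤ) ≤ ∑ p ∈ S, p.ord z * p.deg := by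
    refine Finset.sum_le_sum fun p hp => ?_
    have h3 : 0 < p.ord z := hS hp
    have h4 : (0 : ℤ) < p.deg := by exact_mod_cast p.deg_pos
    exact Int.add_one_le_iff.2 (mul_pos h3 h4)
  simp [hcard] at h2
  omega

lemma finite_ord_ne_zero (f : K) : {p : Place (ZMod 2) K | p.ord f ≠ 0}.Finite := by
  by_cases h0 : f = 0
  · simp [h0]
  by_cases h1 : f = 1
  · simp [h1]
  have ht := transcendental_of_ne h0 h1
  have ht' : Transcendental (ZMod 2) f⁻¹ := transcendental_of_ne (inv_ne_zero h0)
    (by simpa using h1)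
  refine ((finite_ord_pos ht).union (finite_ord_pos ht')).subset fun p hp => ?_
  have hp : p.ord f ≠ 0 := hp
  rcases lt_or_gt_of_ne hp with h | h
  · right
    change 0 < p.ord f⁻¹
    rw [p.ord_inv]; omega
  · exact Or.inl h

/-- The principal divisor of `f` (with `divf 0 = 0`). -/
def divf (f : K) : Divisor (ZMod 2) K :=
  Finsupp.ofSupportFinite (fun p => p.ord f) (finite_ord_ne_zero f)

@[simp] lemma divf_apply (f : K) (p : Place (ZMod 2) K) : divf f p = p.ord f := rfl

lemma divf_mul {f g : K} (hf : f ≠ 0) (hg : g ≠ 0) : divf (f * g) = divf f + divf g := by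
  ext p; exact p.ord_mul hf hg

@[simp] lemma divf_inv (f : K) : divf f⁻¹ = -divf f := by
  ext p; exact p.ord_inv f

/-- The degree of a divisor. -/
def ddeg (D : Divisor (ZMod 2) K) : ℤ := degHom (ZMod 2) K D

@[simp] lemma ddeg_zero : ddeg (0 : Divisor (ZMod 2) K) = 0 := map_zero _

lemma ddeg_add (D E : Divisor (ZMod 2) K) : ddeg (D + E) = ddeg D + ddeg E := map_add _ _ _

lemma ddeg_sub (D E : Divisor (ZMod 2) K) : ddeg (D - E) = ddeg D - ddeg E := map_sub _ _ _

lemma ddeg_neg (D : Divisor (ZMod 2) K) : ddeg (-D) = -ddeg D := map_neg _ _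

lemma ddeg_nsmul (n : ℕ) (D : Divisor (ZMod 2) K) : ddeg (n • D) = n * ddeg D := by
  simp [ddeg]

lemma ddeg_sum {ι : Type*} (s : Finset ι) (f : ι → Divisor (ZMod 2) K) :
    ddeg (∑ i ∈ s, f i) = ∑ i ∈ s, ddeg (f i) := map_sum _ _ _

lemma ddeg_single (p : Place (ZMod 2) K) (n : ℤ) : ddeg (Finsupp.single p n) = n * p.deg := by
  simp [ddeg, degHom, Place.deg]

lemma ddeg_eq_sum (D : Divisor (ZMod 2) K) : ddeg D = ∑ p ∈ D.support, D p * p.deg := by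
  simp [ddeg, degHom, Place.deg, Finsupp.sum]

lemma ddeg_eq_sum_of_subset (D : Divisor (ZMod 2) K) {S : Finset (Place (ZMod 2) K)}
    (hS : D.support ⊆ S) : ddeg D = ∑ p ∈ S, D p * p.deg := by
  rw [ddeg_eq_sum]
  refine Finset.sum_subset hS fun p _ hp => ?_
  simp [Finsupp.notMem_support_iff.1 hp]

lemma ddeg_mono {D E : Divisor (ZMod 2) K} (h : D ≤ E) : ddeg D ≤ ddeg E := by
  rw [ddeg_eq_sum_of_subset D (Finset.subset_union_left (s₂ := E.support)),
    ddeg_eq_sum_of_subset E (Finset.subset_union_right (s₁ := D.support))]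
  exact Finset.sum_le_sum fun p _ => mul_le_mul_of_nonneg_right (h p) (by positivity)

lemma ddeg_nonneg {D : Divisor (ZMod 2) K} (h : 0 ≤ D) : 0 ≤ ddeg D := by
  simpa using ddeg_mono h

/-- The Riemann-Roch space as an additive subgroup. -/
def L (D : Divisor (ZMod 2) K) : AddSubgroup K := ⨅ p : Place (ZMod 2) K, p.pw (-D p)

lemma mem_L {D : Divisor (ZMod 2) K} {f : K} :
    f ∈ L D ↔ ∀ p : Place (ZMod 2) K, f ∈ p.pw (-D p) := by
  simp [L, AddSubgroup.mem_iInf]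

lemma mem_L_of_ne {D : Divisor (ZMod 2) K} {f : K} (hf : f ≠ 0) : f ∈ L D ↔ 0 ≤ D + divf f := by
  rw [mem_L, Finsupp.le_def]
  refine forall_congr' fun p => ?_
  rw [p.mem_pw_of_ne hf]
  simp only [Finsupp.coe_zero, Pi.zero_apply, Finsupp.coe_add, Pi.add_apply, divf_apply]
  omega

lemma L_mono {D E : Divisor (ZMod 2) K} (h : D ≤ E) : L D ≤ L E := by
  intro f hf
  rw [mem_L] at hf ⊢
  exact fun p => p.pw_anti (by have := h p; omega) (hf p)

lemma mul_mem_L {D E : Divisor (ZMod 2) K} {f g : K} (hf : f ∈ L D) (hg : g ∈ L E) :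
    f * g ∈ L (D + E) := by
  rw [mem_L] at hf hg ⊢
  intro p
  have := p.mul_mem_pw (hf p) (hg p)
  rwa [← neg_add] at this

lemma pow_mem_L {D : Divisor (ZMod 2) K} {f : K} (hf : f ∈ L D) (n : ℕ) : f ^ n ∈ L (n • D) := by
  rw [mem_L] at hf ⊢
  intro p
  have := p.pow_mem_pw (hf p) n
  simpa using this

lemma const_mem_L {D : Divisor (ZMod 2) K} (hD : 0 ≤ D) (c : ZMod 2) :
    algebraMap (ZMod 2) K c ∈ L D := by
  rw [mem_L]
  exact fun p => p.pw_anti (by have := hD p; simpa using this) (p.const_mem_pw c)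

lemma one_mem_L {D : Divisor (ZMod 2) K} (hD : 0 ≤ D) : (1 : K) ∈ L D := by
  simpa using const_mem_L hD 1

lemma self_mem_L (f : K) : f ∈ L (-divf f) := by
  rw [mem_L]
  intro p
  simpa using p.mem_pw_ord f

lemma mem_L_sup_zero (f : K) : f ∈ L (-divf f ⊔ 0) := L_mono le_sup_left (self_mem_L f)

lemma RRspace_eq (D : Divisor (ZMod 2) K) : (RRspace (ZMod 2) D).toAddSubgroup = L D := by
  apply le_antisymm
  · intro f hf
    have hf : f ∈ RRspace (ZMod 2) D := hf
    refine Submodule.span_induction (p := fun f _ => f ∈ L D) ?_ ?_ ?_ ?_ hf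
    · intro g hg
      rw [mem_L]
      intro p
      have : 0 ≤ D p + p.ord g := hg p
      exact Or.inr (by omega)
    · exact (L D).zero_mem
    · intro x y _ _ hx hy; exact (L D).add_mem hx hy
    · intro c x _ hx
      rcases zmod_two_cases c with rfl | rfl
      · rw [zero_smul]; exact (L D).zero_mem
      · rwa [one_smul]
  · intro f hf
    by_cases hf0 : f = 0
    · rw [hf0]; exact AddSubgroup.zero_mem _
    refine Submodule.subset_span fun p => ?_
    have := mem_L.1 hf p
    rw [p.mem_pw_of_ne hf0] at this
    change 0 ≤ D p + p.ord f
    omega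

lemma mem_L_zero {f : K} : f ∈ L (0 : Divisor (ZMod 2) K) ↔ f = 0 ∨ f = 1 := by
  constructor
  · intro hf
    by_contra! h
    have ht : Transcendental (ZMod 2) f⁻¹ := transcendental_of_ne (inv_ne_zero h.1)
      (by simpa using h.2)
    obtain ⟨p, hp⟩ := exists_ord_pos ht
    have := (p.mem_pw_of_ne h.1).1 (mem_L.1 hf p)
    rw [p.ord_inv] at hp
    simp at this
    omega
  · rintro (rfl | rfl)
    · exact (L _).zero_mem
    · exact one_mem_L le_rfl

lemma card_L_zero : Nat.card (L (0 : Divisor (ZMod 2) K)) = 2 := by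
  have : ((L (0 : Divisor (ZMod 2) K)) : Set K) = {0, 1} := by
    ext f; simp [mem_L_zero]
  change Nat.card ((L (0 : Divisor (ZMod 2) K)) : Set K) = 2
  rw [this, Nat.card_coe_set_eq, Set.ncard_pair zero_ne_one]

/-- The adeles bounded by a divisor. -/
def adeles (D : Divisor (ZMod 2) K) : AddSubgroup (Place (ZMod 2) K → K) where
  carrier := {α | ∀ p, α p ∈ p.pw (-D p)}
  zero_mem' := fun p => (p.pw _).zero_mem
  add_mem' := fun ha hb p => (p.pw _).add_mem (ha p) (hb p)
  neg_mem' := fun ha p => (p.pw _).neg_mem (ha p)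

lemma adeles_mono {D E : Divisor (ZMod 2) K} (h : D ≤ E) : adeles D ≤ adeles E :=
  fun _ hα p => p.pw_anti (by have := h p; omega) (hα p)

lemma relIndex_adeles_single (D : Divisor (ZMod 2) K) (p : Place (ZMod 2) K) (n : ℕ) :
    (adeles D).relIndex (adeles (D + Finsupp.single p (n : ℤ))) = 2 ^ (n * p.deg) := by
  set D' := D + Finsupp.single p (n : ℤ) with hD'
  have hle : D ≤ D' := by
    rw [hD']; exact le_add_of_nonneg_right (Finsupp.single_nonneg.2 (by positivity))
  let ev : (Place (ZMod 2) K → K) →+ K := Pi.evalAddMonoidHom _ p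
  have h1 : adeles D = adeles D' ⊓ (p.pw (-D p)).comap ev := by
    ext α
    constructor
    · intro h; exact ⟨adeles_mono hle h, h p⟩
    · rintro ⟨h, h'⟩ q
      by_cases hq : q = p
      · subst hq; exact h'
      · have := h q
        rwa [hD', Finsupp.add_apply, Finsupp.single_apply, if_neg (Ne.symm hq), add_zero] at this
  have h2 : (adeles D').map ev = p.pw (-D' p) := by
    ext f
    constructor
    · rintro ⟨α, hα, rfl⟩; exact hα p
    · intro hf
      refine ⟨Pi.single p f, fun q => ?_, by simp [ev]⟩
      by_cases hq : q = p
      · subst hq; simpa using hf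
      · rw [Pi.single_eq_of_ne hq]; exact (q.pw _).zero_mem
  rw [h1, AddSubgroup.inf_relIndex_left, AddSubgroup.relIndex_comap, h2, ← p.relIndex_pw_nat (-D' p)]
  congr 2
  simp [hD']

lemma relIndex_adeles {D E : Divisor (ZMod 2) K} (h : D ≤ E) :
    (adeles D).relIndex (adeles E) = 2 ^ (ddeg E - ddeg D).toNat := by
  obtain ⟨F, hF⟩ : ∃ F : Place (ZMod 2) K →₀ ℕ, E = D + F.mapRange (fun n : ℕ => (n : ℤ)) rfl := by
    refine ⟨(E - D).mapRange Int.toNat rfl, ?_⟩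
    ext p
    have := h p
    simp only [Finsupp.coe_add, Pi.add_apply, Finsupp.mapRange_apply, Finsupp.coe_sub,
      Pi.sub_apply]
    omega
  subst hF
  clear h
  have hpos : ∀ F : Place (ZMod 2) K →₀ ℕ, 0 ≤ F.mapRange (fun n : ℕ => (n : ℤ)) rfl := by
    intro F p; simp
  induction F using Finsupp.induction with
  | zero => simp
  | single_add p n F _ _ ih =>
    rw [Finsupp.mapRange_add (fun _ _ => Nat.cast_add _ _), Finsupp.mapRange_single,
      add_comm (Finsupp.single p _), ← add_assoc, ddeg_add, ddeg_single]
    set E := D + F.mapRange (fun n : ℕ => (n : ℤ)) rfl with hE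
    have hDE : D ≤ E := le_add_of_nonneg_right (hpos F)
    have h1 := ddeg_mono hDE
    rw [← AddSubgroup.relIndex_mul_relIndex _ _ _ (adeles_mono hDE)
      (adeles_mono (le_add_of_nonneg_right (Finsupp.single_nonneg.2 (by positivity)))), ih,
      relIndex_adeles_single, ← pow_add]
    congr 1
    have : (0 : ℤ) ≤ n * p.deg := by positivity
    zify
    rw [Int.toNat_of_nonneg (by omega), Int.toNat_of_nonneg (by omega)]
    ring

end Divisors

lemma relIndex_split {G : Type*} [AddCommGroup G] {A A' : AddSubgroup G} (B : AddSubgroup G)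
    (h : A ≤ A') :
    A.relIndex A' = (A ⊔ B).relIndex (A' ⊔ B) * (A ⊓ B).relIndex (A' ⊓ B) := by
  have h1 : A' ⊓ (A ⊔ B) = A ⊔ (A' ⊓ B) := by
    rw [inf_comm, inf_comm A' B, sup_inf_assoc_of_le _ h]
  rw [← AddSubgroup.relIndex_mul_relIndex A (A' ⊓ (A ⊔ B)) A' (le_inf h le_sup_left) inf_le_left,
    AddSubgroup.inf_relIndex_left, mul_comm]
  congr 1
  · have : A' ⊔ B = (A ⊔ B) ⊔ A' := by
      rw [sup_right_comm, sup_eq_right.2 h]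
    rw [this, AddSubgroup.relIndex_sup_left]
  · rw [h1, AddSubgroup.relIndex_sup_left, ← AddSubgroup.inf_relIndex_right, ← inf_assoc,
      inf_eq_left.2 h]

section RR

variable [IsCFF K]

/-- The diagonal embedding of `K` in the adeles. -/
def diagHom : K →+ (Place (ZMod 2) K → K) where
  toFun f _ := f
  map_zero' := rfl
  map_add' _ _ := rfl

lemma exists_transcendental : ∃ x : K, Transcendental (ZMod 2) x := by
  obtain ⟨x, hx, -⟩ := IsCFF.isFunctionField (K := K)
  exact ⟨x, hx⟩

instance : Nonempty (Place (ZMod 2) K) := by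
  obtain ⟨x, hx⟩ := exists_transcendental (K := K)
  exact ⟨(exists_ord_pos hx).choose⟩

lemma diagHom_injective : Function.Injective (diagHom (K := K)) := fun _ _ h =>
  congrFun h (Classical.arbitrary _)

lemma adeles_inf_range (D : Divisor (ZMod 2) K) :
    adeles D ⊓ diagHom.range = (L D).map diagHom := by
  ext α
  constructor
  · rintro ⟨h, f, rfl⟩
    exact ⟨f, mem_L.2 h, rfl⟩
  · rintro ⟨f, hf, rfl⟩
    exact ⟨mem_L.1 hf, f, rfl⟩

/-- Adeles bounded by `D`, up to the diagonal. -/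
def U (D : Divisor (ZMod 2) K) : AddSubgroup (Place (ZMod 2) K → K) := adeles D ⊔ diagHom.range

lemma U_mono {D E : Divisor (ZMod 2) K} (h : D ≤ E) : U D ≤ U E :=
  sup_le_sup_right (adeles_mono h) _

lemma relIndex_U_mul {D E : Divisor (ZMod 2) K} (h : D ≤ E) :
    (U D).relIndex (U E) * (L D).relIndex (L E) = 2 ^ (ddeg E - ddeg D).toNat := by
  rw [← relIndex_adeles h, relIndex_split diagHom.range (adeles_mono h), adeles_inf_range,
    adeles_inf_range, AddSubgroup.relIndex_map_map_of_injective _ _ diagHom_injective]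
  rfl

lemma card_L_mul {D E : Divisor (ZMod 2) K} (h : D ≤ E) :
    Nat.card (L D) * (L D).relIndex (L E) = Nat.card (L E) := by
  rw [← AddSubgroup.relIndex_bot_left, ← AddSubgroup.relIndex_bot_left,
    AddSubgroup.relIndex_mul_relIndex _ _ _ bot_le (L_mono h)]

instance finite_L (D : Divisor (ZMod 2) K) : Finite (L D) := by
  have h1 : Finite (L (D ⊔ 0)) := by
    apply Nat.finite_of_card_ne_zero
    rw [← card_L_mul (le_sup_right : 0 ≤ D ⊔ 0), card_L_zero]
    have := relIndex_U_mul (le_sup_right : 0 ≤ D ⊔ 0)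
    intro h
    rw [mul_eq_zero] at h
    rw [h.resolve_left (by norm_num), mul_zero] at this
    exact absurd this.symm (by positivity)
  exact Finite.of_injective _ (AddSubgroup.inclusion_injective (L_mono (le_sup_left : D ≤ D ⊔ 0)))

/-- The dimension of the Riemann-Roch space. -/
def l (D : Divisor (ZMod 2) K) : ℕ := ell (ZMod 2) D

lemma card_L (D : Divisor (ZMod 2) K) : Nat.card (L D) = 2 ^ l D := by
  have : Finite (RRspace (ZMod 2) D) := by
    change Finite (RRspace (ZMod 2) D).toAddSubgroup
    rw [RRspace_eq]; infer_instance
  rw [← RRspace_eq]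
  change Nat.card (RRspace (ZMod 2) D) = _
  rw [Module.natCard_eq_pow_finrank (K := ZMod 2)]
  simp [l, ell]

@[simp] lemma l_zero : l (0 : Divisor (ZMod 2) K) = 1 := by
  have := card_L (0 : Divisor (ZMod 2) K)
  rw [card_L_zero] at this
  exact (Nat.pow_right_injective le_rfl (this.symm.trans (pow_one 2).symm))

lemma l_mono {D E : Divisor (ZMod 2) K} (h : D ≤ E) : l D ≤ l E := by
  have := Nat.card_le_card_of_injective _ (AddSubgroup.inclusion_injective (L_mono h))
  rw [card_L, card_L] at this
  exact (Nat.pow_le_pow_iff_right (by norm_num)).1 this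

lemma relIndex_L {D E : Divisor (ZMod 2) K} (h : D ≤ E) :
    (L D).relIndex (L E) = 2 ^ (l E - l D) := by
  have h1 := card_L_mul h
  rw [card_L, card_L, ← Nat.add_sub_cancel' (l_mono h), pow_add] at h1
  simpa using Nat.eq_of_mul_eq_mul_left (by positivity) h1

lemma relIndex_U {D E : Divisor (ZMod 2) K} (h : D ≤ E) :
    ((l E : ℤ) - l D) ≤ ddeg E - ddeg D ∧
    (U D).relIndex (U E) = 2 ^ ((ddeg E - ddeg D) - ((l E : ℤ) - l D)).toNat := by
  have h1 := relIndex_U_mul h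
  rw [relIndex_L h] at h1
  have h2 : l E - l D ≤ (ddeg E - ddeg D).toNat := by
    apply (Nat.pow_dvd_pow_iff_le_right (x := 2) (by norm_num)).1
    exact Dvd.intro_left _ h1
  have h3 := l_mono h
  have h4 := ddeg_mono h
  refine ⟨by omega, ?_⟩
  have h5 : (ddeg E - ddeg D).toNat =
    ((ddeg E - ddeg D) - ((l E : ℤ) - l D)).toNat + (l E - l D) := by omega
  rw [h5, pow_add] at h1
  exact Nat.eq_of_mul_eq_mul_right (by positivity) h1

lemma l_le {D : Divisor (ZMod 2) K} (h : 0 ≤ D) : (l D : ℤ) ≤ ddeg D + 1 := by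
  have := (relIndex_U h).1
  simp at this
  omega

/-- The pole divisor. -/
def poleDiv (f : K) : Divisor (ZMod 2) K := -divf f ⊔ 0

lemma poleDiv_nonneg (f : K) : 0 ≤ poleDiv f := le_sup_right

lemma mem_L_poleDiv (f : K) : f ∈ L (poleDiv f) := mem_L_sup_zero f

lemma poleDiv_apply (f : K) (p : Place (ZMod 2) K) : poleDiv f p = max (-p.ord f) 0 := rfl

lemma poleDiv_le {f : K} (hf : f ≠ 0) {D : Divisor (ZMod 2) K} (hD : 0 ≤ D) (h : f ∈ L D) :
    poleDiv f ≤ D := by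
  refine sup_le ?_ hD
  rw [mem_L_of_ne hf] at h
  exact neg_le_iff_add_nonneg.2 h

lemma divf_eq (f : K) : divf f = poleDiv f⁻¹ - poleDiv f := by
  ext p
  simp only [divf_apply, Finsupp.coe_sub, Pi.sub_apply, poleDiv_apply, p.ord_inv]
  omega

lemma ddeg_poleDiv_le {x : K} (hx : Transcendental (ZMod 2) x) :
    ddeg (poleDiv x⁻¹) ≤ degOver x := by
  rw [ddeg_eq_sum]
  have h0 : ∀ p ∈ (poleDiv x⁻¹).support, 0 < p.ord x := by
    intro p hp
    rw [Finsupp.mem_support_iff, poleDiv_apply, p.ord_inv] at hp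
    omega
  refine le_trans (le_of_eq ?_) (sum_ord_le hx (poleDiv x⁻¹).support fun p hp => (h0 p hp).le)
  refine Finset.sum_congr rfl fun p hp => ?_
  have := h0 p hp
  rw [poleDiv_apply, p.ord_inv, neg_neg, max_eq_left this.le]

lemma degOver_inv (x : K) : degOver x⁻¹ = degOver x := by
  have : IntermediateField.adjoin (ZMod 2) {x⁻¹} = IntermediateField.adjoin (ZMod 2) {x} := by
    apply le_antisymm
    · rw [IntermediateField.adjoin_simple_le_iff]
      exact inv_mem (IntermediateField.mem_adjoin_simple_self _ x)
    · rw [IntermediateField.adjoin_simple_le_iff]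
      simpa using inv_mem (IntermediateField.mem_adjoin_simple_self (ZMod 2) x⁻¹)
  unfold degOver
  rw [this]

lemma transcendental_inv {x : K} (hx : Transcendental (ZMod 2) x) :
    Transcendental (ZMod 2) x⁻¹ := fun h => hx (by simpa using h.inv)

lemma nat_le_of_forall_mul_le {a b c : ℤ} (h : ∀ n : ℕ, a * (n + 1) ≤ n * b + c) : a ≤ b := by
  by_contra! hab
  have h1 := h (c - a).toNat.succ
  push_cast at h1
  have h2 : c - a ≤ (c - a).toNat := Int.self_le_toNat _
  nlinarith

lemma degOver_le {x : K} (hx : Transcendental (ZMod 2) x) :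
    (degOver x : ℤ) ≤ ddeg (poleDiv x) := by
  have hfin := finiteDimensional_of_transcendental hx
  let b := Module.finBasis (IntermediateField.adjoin (ZMod 2) {x}) K
  set n := Module.finrank (IntermediateField.adjoin (ZMod 2) {x}) K with hn
  let C : Divisor (ZMod 2) K := ∑ i, poleDiv (b i)
  have hC : ∀ i, b i ∈ L C := fun i =>
    L_mono (Finset.single_le_sum (f := fun i => poleDiv (b i)) (fun i _ => poleDiv_nonneg _)
      (Finset.mem_univ i)) (mem_L_poleDiv (b i))
  have hC0 : 0 ≤ C := Finset.sum_nonneg fun i _ => poleDiv_nonneg _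
  refine nat_le_of_forall_mul_le (c := ddeg C + 1) fun m => ?_
  have hmem : ∀ c : Fin n → Fin (m + 1) → ZMod 2,
      ∑ i, (∑ j, algebraMap (ZMod 2) K (c i j) * x ^ (j : ℕ)) * b i ∈ L (m • poleDiv x + C) := by
    intro c
    refine AddSubgroup.sum_mem _ fun i _ => mul_mem_L (AddSubgroup.sum_mem _ fun j _ => ?_) (hC i)
    have h1 := mul_mem_L (const_mem_L le_rfl (c i j)) (pow_mem_L (mem_L_poleDiv x) j)
    rw [zero_add] at h1
    exact L_mono (nsmul_le_nsmul_left (poleDiv_nonneg x) (by omega)) h1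
  have hinj : Function.Injective (fun c : Fin n → Fin (m + 1) → ZMod 2 =>
      (⟨_, hmem c⟩ : L (m • poleDiv x + C))) := by
    intro c c' h
    have h := congrArg Subtype.val h
    simp only at h
    let P : (Fin (m + 1) → ZMod 2) → Polynomial (ZMod 2) := fun a =>
      ∑ j, Polynomial.C (a j) * Polynomial.X ^ (j : ℕ)
    have hP : ∀ a, Polynomial.aeval x (P a) = ∑ j, algebraMap (ZMod 2) K (a j) * x ^ (j : ℕ) := by
      intro a; simp [P]
    have hadj : ∀ g : Polynomial (ZMod 2),
        Polynomial.aeval x g ∈ IntermediateField.adjoin (ZMod 2) {x} := fun g =>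
      IntermediateField.algebra_adjoin_le_adjoin _ _ (by
        rw [Algebra.adjoin_singleton_eq_range_aeval]; exact ⟨g, rfl⟩)
    simp_rw [← hP] at h
    have h2 : ∑ i, (⟨_, hadj (P (c i))⟩ : IntermediateField.adjoin (ZMod 2) {x}) • b i =
        ∑ i, (⟨_, hadj (P (c' i))⟩ : IntermediateField.adjoin (ZMod 2) {x}) • b i := h
    have h3 := Fintype.linearIndependent_iff.1 b.linearIndependent
      (fun i => ⟨_, hadj (P (c i))⟩ - ⟨_, hadj (P (c' i))⟩) (by
        simp_rw [sub_smul, Finset.sum_sub_distrib]; rw [h2, sub_self])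
    funext i j
    have h4 := congrArg Subtype.val (sub_eq_zero.1 (h3 i))
    have h5 : P (c i) = P (c' i) := (transcendental_iff_injective.1 hx) h4
    have h6 : ∀ a, (P a).coeff j = a j := by
      intro a
      simp [P, Polynomial.coeff_C_mul, Polynomial.coeff_X_pow,
        Fin.val_inj]
    rw [← h6 (c i), h5, h6 (c' i)]
  have hcard := Nat.card_le_card_of_injective _ hinj
  rw [card_L] at hcard
  simp only [Nat.card_eq_fintype_card, Fintype.card_fun, Fintype.card_fin, ZMod.card] at hcard
  rw [← pow_mul] at hcard
  have h1 := (Nat.pow_le_pow_iff_right (by norm_num)).1 hcard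
  have h2 := l_le (add_nonneg (nsmul_nonneg (poleDiv_nonneg x) m) hC0)
  rw [ddeg_add, ddeg_nsmul] at h2
  have h3 : (((m + 1) * n : ℕ) : ℤ) ≤ l (m • poleDiv x + C) := by exact_mod_cast h1
  push_cast at h3
  linarith

lemma ddeg_poleDiv {x : K} (hx : Transcendental (ZMod 2) x) : ddeg (poleDiv x) = degOver x := by
  refine le_antisymm ?_ (degOver_le hx)
  have := ddeg_poleDiv_le (transcendental_inv hx)
  rwa [inv_inv, degOver_inv] at this

@[simp] lemma divf_zero : divf (0 : K) = 0 := by ext p; simp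

@[simp] lemma divf_one : divf (1 : K) = 0 := by ext p; simp

@[simp] lemma ddeg_divf (f : K) : ddeg (divf f) = 0 := by
  by_cases h0 : f = 0
  · simp [h0]
  by_cases h1 : f = 1
  · simp [h1]
  have := transcendental_of_ne h0 h1
  rw [divf_eq, ddeg_sub, ddeg_poleDiv this, ddeg_poleDiv (transcendental_inv this), degOver_inv,
    sub_self]

lemma ddeg_nonneg_of_mem_L {D : Divisor (ZMod 2) K} {f : K} (hf : f ≠ 0) (h : f ∈ L D) :
    0 ≤ ddeg D := by
  have := ddeg_nonneg ((mem_L_of_ne hf).1 h)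
  rwa [ddeg_add, ddeg_divf, add_zero] at this

lemma exists_ne_zero_of_l_pos {D : Divisor (ZMod 2) K} (h : 0 < l D) : ∃ f ∈ L D, f ≠ 0 := by
  have h1 : 1 < Nat.card (L D) := by
    rw [card_L]; exact Nat.one_lt_two_pow (by omega)
  have := Finite.one_lt_card_iff_nontrivial.1 h1
  obtain ⟨f, hf⟩ := exists_ne (0 : L D)
  exact ⟨f, f.2, fun h => hf (Subtype.ext h)⟩

lemma ddeg_nonneg_of_l_pos {D : Divisor (ZMod 2) K} (h : 0 < l D) : 0 ≤ ddeg D := by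
  obtain ⟨f, hf, h0⟩ := exists_ne_zero_of_l_pos h
  exact ddeg_nonneg_of_mem_L h0 hf

lemma mul_mem_L_iff {D : Divisor (ZMod 2) K} {f g : K} (hf : f ≠ 0) :
    f * g ∈ L D ↔ g ∈ L (D + divf f) := by
  constructor
  · intro h
    have := mul_mem_L h (self_mem_L f⁻¹)
    rwa [divf_inv, neg_neg, mul_right_comm, mul_inv_cancel₀ hf, one_mul] at this
  · intro h
    have := mul_mem_L h (self_mem_L f)
    rwa [add_neg_cancel_right, mul_comm] at this

lemma l_add_divf (D : Divisor (ZMod 2) K) (f : K) : l (D + divf f) = l D := by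
  by_cases hf : f = 0
  · simp [hf]
  apply Nat.pow_right_injective le_rfl
  change 2 ^ _ = 2 ^ _
  rw [← card_L, ← card_L]
  refine Nat.card_congr
    { toFun := fun g => ⟨f * g, (mul_mem_L_iff hf).2 g.2⟩
      invFun := fun g => ⟨f⁻¹ * g, (mul_mem_L_iff hf).1 (by
        rw [← mul_assoc, mul_inv_cancel₀ hf, one_mul]; exact g.2)⟩
      left_inv := fun g => Subtype.ext (by simp [hf])
      right_inv := fun g => Subtype.ext (by simp [hf]) }

end RR

section Duality

variable [IsCFF K]

/-- The ring of adeles, as a `K`-vector space. -/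
def Adele (K : Type) [Field K] [Algebra (ZMod 2) K] [IsCFF K] :
    Submodule K (Place (ZMod 2) K → K) where
  carrier := {α | ∃ D : Divisor (ZMod 2) K, α ∈ adeles D}
  zero_mem' := ⟨0, (adeles 0).zero_mem⟩
  add_mem' := by
    rintro α β ⟨D, hD⟩ ⟨E, hE⟩
    exact ⟨D ⊔ E, (adeles _).add_mem (adeles_mono le_sup_left hD) (adeles_mono le_sup_right hE)⟩
  smul_mem' := by
    rintro f α ⟨D, hD⟩
    refine ⟨D - divf f, fun p => ?_⟩
    have := p.mul_mem_pw (p.mem_pw_ord f) (hD p)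
    simpa [sub_eq_add_neg, add_comm] using this

lemma smul_mem_adeles {D : Divisor (ZMod 2) K} {E : Divisor (ZMod 2) K} {f : K}
    {α : Place (ZMod 2) K → K} (hf : f ∈ L E) (hα : α ∈ adeles D) : f • α ∈ adeles (D + E) := by
  intro p
  have := p.mul_mem_pw (mem_L.1 hf p) (hα p)
  simpa [add_comm] using this

/-- Multiplication of a functional on the adeles by an element of `K`. -/
def act (f : K) (ω : Adele K →+ ZMod 2) : Adele K →+ ZMod 2 :=
  ω.comp (DistribSMul.toAddMonoidHom (Adele K) f)

lemma act_apply (f : K) (ω : Adele K →+ ZMod 2) (α : Adele K) : act f ω α = ω (f • α) := rfl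

lemma act_add (f g : K) (ω : Adele K →+ ZMod 2) : act (f + g) ω = act f ω + act g ω := by
  ext α; simp [act_apply, add_smul]

lemma act_sub (f g : K) (ω : Adele K →+ ZMod 2) : act (f - g) ω = act f ω - act g ω := by
  ext α
  change ω ((f - g) • α) = ω (f • α) - ω (g • α)
  rw [show (f - g) • α = f • α - g • α from sub_smul f g α, map_sub]

lemma act_act (f g : K) (ω : Adele K →+ ZMod 2) : act f (act g ω) = act (g * f) ω := by
  ext α; simp [act_apply, mul_smul]

@[simp] lemma act_one (ω : Adele K →+ ZMod 2) : act 1 ω = ω := by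
  ext α; simp [act_apply]

@[simp] lemma act_zero (ω : Adele K →+ ZMod 2) : act 0 ω = 0 := by
  ext α; simp [act_apply]

lemma act_eq_zero {f : K} {ω : Adele K →+ ZMod 2} (hω : ω ≠ 0) (h : act f ω = 0) : f = 0 := by
  by_contra hf
  apply hω
  have := congrArg (act f⁻¹) h
  rw [act_act, mul_inv_cancel₀ hf, act_one] at this
  rw [this]
  ext α; simp [act_apply]

/-- The differentials (as functionals on the adeles) bounded by `D`. -/
def Omega (D : Divisor (ZMod 2) K) : AddSubgroup (Adele K →+ ZMod 2) where
  carrier := {ω | ∀ α : Adele K, (α : Place (ZMod 2) K → K) ∈ U D → ω α = 0}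
  zero_mem' := fun _ _ => rfl
  add_mem' := fun ha hb α hα => by rw [AddMonoidHom.add_apply, ha α hα, hb α hα, add_zero]
  neg_mem' := fun ha α hα => by rw [AddMonoidHom.neg_apply, ha α hα, neg_zero]

lemma adeles_le (D : Divisor (ZMod 2) K) : adeles D ≤ (Adele K).toAddSubgroup :=
  fun _ h => ⟨D, h⟩

lemma diag_mem (f : K) : diagHom f ∈ Adele K := ⟨-divf f, mem_L.1 (self_mem_L f)⟩

lemma U_le (D : Divisor (ZMod 2) K) : U D ≤ (Adele K).toAddSubgroup := by
  refine sup_le (adeles_le D) ?_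
  rintro _ ⟨f, rfl⟩
  exact diag_mem f

lemma act_mem_Omega {D E : Divisor (ZMod 2) K} {ω : Adele K →+ ZMod 2} {f : K} (hω : ω ∈ Omega E)
    (hf : f ∈ L (E - D)) : act f ω ∈ Omega D := by
  rintro ⟨α, hα'⟩ hα
  refine hω _ ?_
  change f • α ∈ U E
  obtain ⟨β, hβ, _, ⟨g, rfl⟩, rfl⟩ := AddSubgroup.mem_sup.1 hα
  rw [smul_add]
  refine (U E).add_mem ((le_sup_left : adeles E ≤ U E) ?_) ((le_sup_right : _ ≤ U E) ⟨f * g, rfl⟩)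
  have := smul_mem_adeles hf hβ
  rwa [add_sub_cancel] at this

lemma Omega_sup {D E : Divisor (ZMod 2) K} {ω : Adele K →+ ZMod 2} (hD : ω ∈ Omega D)
    (hE : ω ∈ Omega E) : ω ∈ Omega (D ⊔ E) := by
  rintro ⟨α, hα'⟩ hα
  obtain ⟨β, hβ, γ, hγ, rfl⟩ := AddSubgroup.mem_sup.1 hα
  let β1 : Place (ZMod 2) K → K := fun p => if E p ≤ D p then β p else 0
  let β2 : Place (ZMod 2) K → K := fun p => if E p ≤ D p then 0 else β p
  have h1 : β1 ∈ adeles D := by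
    intro p
    have := hβ p
    by_cases h : E p ≤ D p
    · rw [Finsupp.sup_apply, sup_eq_left.2 h] at this
      simpa [β1, h] using this
    · simp [β1, h]
  have h2 : β2 ∈ adeles E := by
    intro p
    have := hβ p
    by_cases h : E p ≤ D p
    · simp [β2, h]
    · rw [Finsupp.sup_apply, sup_eq_right.2 (le_of_not_ge h)] at this
      simpa [β2, h] using this
  have h3 : β = β1 + β2 := by
    ext p
    by_cases h : E p ≤ D p <;> simp [β1, β2, h]
  have hγ' : γ ∈ Adele K := U_le D ((le_sup_right : _ ≤ U D) hγ)
  have : (⟨β + γ, hα'⟩ : Adele K) =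
      ⟨β1, adeles_le D h1⟩ + ⟨β2, adeles_le E h2⟩ + ⟨γ, hγ'⟩ := Subtype.ext (by
    change β + γ = β1 + β2 + γ
    rw [h3])
  rw [this, map_add, map_add, hD _ ((le_sup_left : adeles D ≤ U D) h1),
    hE _ ((le_sup_left : adeles E ≤ U E) h2), hD _ ((le_sup_right : _ ≤ U D) hγ)]
  rfl

lemma card_Omega {D : Divisor (ZMod 2) K} {n : ℕ}
    (h : (U D).relIndex (Adele K).toAddSubgroup = 2 ^ n) : Nat.card (Omega D) = 2 ^ n := by
  let N : AddSubgroup (Adele K) := (U D).addSubgroupOf (Adele K).toAddSubgroup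
  let Q := Adele K ⧸ N
  let : Module (ZMod 2) Q := AddCommGroup.zmodModule (n := 2) (fun x => by
    obtain ⟨y, rfl⟩ := QuotientAddGroup.mk_surjective x
    rw [two_nsmul, ← QuotientAddGroup.mk_add]
    rw [show y + y = 0 from Subtype.ext (funext fun p => two_smul_eq_zero _)]
    rfl)
  have hcard : Nat.card Q = 2 ^ n := h
  have : Finite Q := Nat.finite_of_card_ne_zero (by rw [hcard]; positivity)
  have hrank : Module.finrank (ZMod 2) Q = n := by
    rw [Module.natCard_eq_pow_finrank (K := ZMod 2)] at hcard
    simpa using hcard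
  have e : Omega D ≃ (Q →+ ZMod 2) :=
    { toFun := fun ω => QuotientAddGroup.lift N ω.1 (fun α hα => ω.2 α hα)
      invFun := fun φ => ⟨φ.comp (QuotientAddGroup.mk' N), fun α hα => by
        have : (QuotientAddGroup.mk' N) α = 0 := (QuotientAddGroup.eq_zero_iff α).2 hα
        rw [AddMonoidHom.comp_apply, this, map_zero]⟩
      left_inv := fun ω => rfl
      right_inv := fun φ => by
        ext x
        rfl }
  have e2 : (Q →+ ZMod 2) ≃ Module.Dual (ZMod 2) Q :=
    { toFun := fun φ => φ.toZModLinearMap 2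
      invFun := fun φ => φ.toAddMonoidHom
      left_inv := fun φ => rfl
      right_inv := fun φ => rfl }
  rw [Nat.card_congr (e.trans e2), Module.natCard_eq_pow_finrank (K := ZMod 2),
    Subspace.dual_finrank_eq, hrank]
  simp

/-- Riemann-Roch duality: a canonical divisor exists, given Riemann's theorem. -/
theorem exists_canonical {g : ℤ} (hg0 : 0 < g)
    (hge : ∀ D : Divisor (ZMod 2) K, 0 ≤ (l D : ℤ) - ddeg D - 1 + g)
    {D₁ : Divisor (ZMod 2) K} (hD₁ : (l D₁ : ℤ) - ddeg D₁ - 1 + g = 0) :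
    ∃ W : Divisor (ZMod 2) K, ∀ D, (l D : ℤ) - ddeg D - 1 + g = l (W - D) := by
  have hanti : ∀ {D E : Divisor (ZMod 2) K}, D ≤ E →
      (l E : ℤ) - ddeg E - 1 + g ≤ (l D : ℤ) - ddeg D - 1 + g := by
    intro D E h
    have := (relIndex_U h).1
    omega
  have hUle : ∀ D, U D ≤ U D₁ := by
    intro D
    have h1 := (relIndex_U (le_sup_right : D₁ ≤ D ⊔ D₁)).2
    have h2 := hanti (le_sup_right : D₁ ≤ D ⊔ D₁)
    have h3 := hge (D ⊔ D₁)
    rw [show (ddeg (D ⊔ D₁) - ddeg D₁ - ((l (D ⊔ D₁) : ℤ) - l D₁)).toNat = 0 by omega,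
      pow_zero, AddSubgroup.relIndex_eq_one] at h1
    exact (U_mono le_sup_left).trans h1
  have hAd : (Adele K).toAddSubgroup = U D₁ := by
    apply le_antisymm _ (U_le D₁)
    rintro α ⟨D, hD⟩
    exact hUle D ((le_sup_left : adeles D ≤ U D) hD)
  have hcard : ∀ D : Divisor (ZMod 2) K,
      Nat.card (Omega D) = 2 ^ ((l D : ℤ) - ddeg D - 1 + g).toNat := by
    intro D
    apply card_Omega
    rw [hAd]
    have h0 : U D₁ = U (D ⊔ D₁) := le_antisymm (U_mono le_sup_right) (hUle _)
    rw [h0, (relIndex_U (le_sup_left : D ≤ D ⊔ D₁)).2]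
    have h2 := hanti (le_sup_right : D₁ ≤ D ⊔ D₁)
    have h3 := hge (D ⊔ D₁)
    congr 2
    omega
  have hfin : ∀ D : Divisor (ZMod 2) K, Finite (Omega D) := fun D =>
    Nat.finite_of_card_ne_zero (by rw [hcard]; positivity)
  obtain ⟨⟨ω, hω0⟩, hne⟩ : ∃ ω : Omega (0 : Divisor (ZMod 2) K), ω ≠ 0 := by
    have : 1 < Nat.card (Omega (0 : Divisor (ZMod 2) K)) := by
      rw [hcard]
      refine Nat.one_lt_two_pow ?_
      simp
      omega
    have := Finite.one_lt_card_iff_nontrivial.1 this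
    exact exists_ne 0
  have hω : ω ≠ 0 := fun h => hne (Subtype.ext h)
  have hbdd : ∀ D : Divisor (ZMod 2) K, ω ∈ Omega D → ddeg D < ddeg D₁ + g := by
    intro D hD
    by_contra! h
    have h1 := hge (D - D₁)
    rw [ddeg_sub] at h1
    obtain ⟨f, hf, hf0⟩ := exists_ne_zero_of_l_pos (D := D - D₁) (by omega)
    have h2 : D₁ ≤ D + divf f := by
      rw [mem_L_of_ne hf0] at hf
      rw [← sub_nonneg]
      convert hf using 1
      abel
    have h3 := hanti h2
    have h4 := hge (D + divf f)
    rw [l_add_divf, ddeg_add, ddeg_divf] at h3 h4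
    have h5 := hcard D
    rw [show ((l D : ℤ) - ddeg D - 1 + g).toNat = 0 by omega, pow_zero] at h5
    have := (Nat.card_eq_one_iff_unique.1 h5).1
    exact hω (congrArg Subtype.val (Subsingleton.elim (⟨ω, hD⟩ : Omega D) 0))
  obtain ⟨W, hW, hWmax⟩ : ∃ W, ω ∈ Omega W ∧ ∀ D, ω ∈ Omega D → ddeg D ≤ ddeg W := by
    obtain ⟨d, ⟨W, hW, rfl⟩, hd⟩ := Int.exists_greatest_of_bdd
      (P := fun d => ∃ D : Divisor (ZMod 2) K, ω ∈ Omega D ∧ ddeg D = d)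
      ⟨ddeg D₁ + g, by rintro _ ⟨D, hD, rfl⟩; exact (hbdd D hD).le⟩ ⟨0, 0, hω0, by simp⟩
    exact ⟨W, hW, fun D hD => hd _ ⟨D, hD, rfl⟩⟩
  have hWle : ∀ D, ω ∈ Omega D → D ≤ W := by
    intro D hD
    have h1 := hWmax _ (Omega_sup hD hW)
    intro p
    by_contra! h
    have h2 : W + Finsupp.single p 1 ≤ D ⊔ W := by
      intro q
      rw [Finsupp.add_apply, Finsupp.single_apply, Finsupp.sup_apply]
      by_cases hq : p = q
      · subst hq
        rw [if_pos rfl]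
        exact le_sup_of_le_left h
      · rw [if_neg hq, add_zero]; exact le_sup_right
    have h3 := ddeg_mono h2
    rw [ddeg_add, ddeg_single] at h3
    have := p.deg_pos
    omega
  have hmem : ∀ (D : Divisor (ZMod 2) K) (f : K), act f ω ∈ Omega D → f ∈ L (W - D) := by
    intro D f hf
    by_cases hf0 : f = 0
    · rw [hf0]; exact (L _).zero_mem
    have h1 := act_mem_Omega (D := D - divf f) (f := f⁻¹) hf (by
      have := self_mem_L f⁻¹
      rw [divf_inv, neg_neg] at this
      rw [sub_sub_cancel]
      exact this)
    rw [act_act, mul_inv_cancel₀ hf0, act_one] at h1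
    have h2 := hWle _ h1
    rw [mem_L_of_ne hf0]
    rw [← sub_nonneg] at h2
    convert h2 using 1
    abel
  have hone : ∀ (D : Divisor (ZMod 2) K) (η : Adele K →+ ZMod 2), η ∈ Omega D →
      ∃ f, η = act f ω := by
    intro D η hη
    by_cases hη0 : η = 0
    · exact ⟨0, by rw [hη0, act_zero]⟩
    let p := Classical.arbitrary (Place (ZMod 2) K)
    let N := (g + g + g - ddeg W - ddeg D).toNat
    let E : Divisor (ZMod 2) K := Finsupp.single p (N : ℤ)
    have hE0 : 0 ≤ E := Finsupp.single_nonneg.2 (by positivity)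
    have hEdeg : (N : ℤ) ≤ ddeg E := by
      rw [ddeg_single]
      have : (1 : ℤ) ≤ p.deg := by exact_mod_cast p.deg_pos
      nlinarith
    let Φ : L (W + E) × L (D + E) →+ Omega (-E) :=
      { toFun := fun x => ⟨act (x.1 : K) ω + act (x.2 : K) η, (Omega _).add_mem
          (act_mem_Omega hW (by rw [sub_neg_eq_add]; exact x.1.2))
          (act_mem_Omega hη (by rw [sub_neg_eq_add]; exact x.2.2))⟩
        map_zero' := Subtype.ext (by simp)
        map_add' := fun x y => Subtype.ext (by
          simp only [Prod.fst_add, Prod.snd_add, AddSubgroup.coe_add, act_add]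
          abel) }
    have hninj : ¬ Function.Injective Φ := by
      intro hinj
      have h1 := Nat.card_le_card_of_injective _ hinj
      rw [Nat.card_prod, card_L, card_L, hcard, ← pow_add,
        Nat.pow_le_pow_iff_right (by norm_num)] at h1
      have h2 := hge (W + E)
      have h3 := hge (D + E)
      have h4 : l (-E) ≤ 1 := by
        rw [← l_zero (K := K)]; exact l_mono (by simpa using hE0)
      have h5 := hge (-E)
      rw [ddeg_add] at h2 h3
      rw [ddeg_neg] at h1 h5
      have h6 : g + g + g - ddeg W - ddeg D ≤ N := Int.self_le_toNat _
      have h7 : l (-E) = 0 ∨ l (-E) = 1 := by omega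
      rcases h7 with h7 | h7
      · rw [h7] at h1 h5
        omega
      · exfalso
        have := ddeg_nonneg_of_l_pos (D := -E) (by omega)
        rw [ddeg_neg] at this
        omega
    rw [injective_iff_map_eq_zero] at hninj
    push Not at hninj
    obtain ⟨⟨⟨f, hf⟩, ⟨h, hh⟩⟩, hΦ, hne⟩ := hninj
    have hΦ : act f ω + act h η = 0 := congrArg Subtype.val hΦ
    have hh0 : h ≠ 0 := by
      rintro rfl
      rw [act_zero, add_zero] at hΦ
      have := act_eq_zero hω hΦ
      subst this
      exact hne rfl
    refine ⟨-f * h⁻¹, ?_⟩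
    rw [← act_act, ← zero_sub f, act_sub, act_zero, zero_sub, ← eq_neg_of_add_eq_zero_right hΦ,
      act_act, mul_inv_cancel₀ hh0, act_one]
  refine ⟨W, fun D => ?_⟩
  have h1 : Nat.card (Omega D) = Nat.card (L (W - D)) := by
    symm
    refine Nat.card_eq_of_bijective
      (fun f : L (W - D) => (⟨act f ω, act_mem_Omega hW f.2⟩ : Omega D)) ⟨?_, ?_⟩
    · intro f f' h
      have h := congrArg Subtype.val h
      simp only at h
      rw [← sub_eq_zero, ← act_sub] at h
      exact Subtype.ext (sub_eq_zero.1 (act_eq_zero hω h))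
    · rintro ⟨η, hη⟩
      obtain ⟨f, rfl⟩ := hone D η hη
      exact ⟨⟨f, hmem D f hη⟩, rfl⟩
  rw [hcard, card_L] at h1
  have h2 := Nat.pow_right_injective le_rfl h1
  rw [← h2, Int.toNat_of_nonneg (hge D)]

end Duality

section Genus

variable [IsCFF K]

/-- Riemann's theorem, read off from the definition of a positive genus. -/
theorem riemann_of_genus {g : ℕ} (hg0 : 0 < g) (hg : genus (ZMod 2) K = g) :
    (∀ D : Divisor (ZMod 2) K, 0 ≤ (l D : ℤ) - ddeg D - 1 + g) ∧
      ∃ D : Divisor (ZMod 2) K, (l D : ℤ) - ddeg D - 1 + g = 0 := by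
  set S := {g : ℕ | ∃ D : Divisor (ZMod 2) K, (g : ℤ) = ddeg D + 1 - l D} with hS
  have hg' : sSup S = g := hg
  have hne : S.Nonempty := by
    by_contra h
    rw [Set.not_nonempty_iff_eq_empty] at h
    rw [h, csSup_empty] at hg'
    exact hg0.ne hg'
  have hbdd : BddAbove S := by
    by_contra h
    rw [Nat.sSup_of_not_bddAbove h] at hg'
    omega
  refine ⟨fun D => ?_, ?_⟩
  · by_contra! h
    have h1 : (ddeg D + 1 - l D).toNat ∈ S := ⟨D, Int.toNat_of_nonneg (by omega)⟩
    have := le_csSup hbdd h1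
    omega
  · obtain ⟨D, hD⟩ := Nat.sSup_mem hne hbdd
    rw [hg'] at hD
    exact ⟨D, by omega⟩

/-- If the class number is one, every divisor of degree zero is principal. -/
theorem principal_of_classNumber (hh : classNumber (ZMod 2) K = 1) (D : Divisor (ZMod 2) K)
    (hD : ddeg D = 0) : ∃ f : K, f ≠ 0 ∧ divf f = D := by
  have h1 := (Nat.card_eq_one_iff_unique.1 hh).1
  have h2 : (⟨D, hD⟩ : zeroDivisors (ZMod 2) K) ∈
      (principalDivisors (ZMod 2) K).addSubgroupOf (zeroDivisors (ZMod 2) K) := by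
    rw [← QuotientAddGroup.eq_zero_iff]
    exact h1.elim _ _
  have h3 : D ∈ principalDivisors (ZMod 2) K := h2
  clear h2 hD
  induction h3 using AddSubgroup.closure_induction with
  | mem D h =>
    obtain ⟨f, hf, h⟩ := h
    exact ⟨f, hf, Finsupp.ext fun p => (h p).symm⟩
  | zero => exact ⟨1, one_ne_zero, divf_one⟩
  | add D E _ _ h h' =>
    obtain ⟨f, hf, rfl⟩ := h
    obtain ⟨f', hf', rfl⟩ := h'
    exact ⟨f * f', mul_ne_zero hf hf', divf_mul hf hf'⟩
  | neg D _ h =>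
    obtain ⟨f, hf, rfl⟩ := h
    exact ⟨f⁻¹, inv_ne_zero hf, divf_inv f⟩

/-- All divisors of degree zero of `K` are principal. -/
def AllPrincipal (K : Type) [Field K] [Algebra (ZMod 2) K] [IsCFF K] : Prop :=
  ∀ D : Divisor (ZMod 2) K, ddeg D = 0 → ∃ f : K, f ≠ 0 ∧ divf f = D

lemma AllPrincipal.l_eq (h : AllPrincipal K) {D E : Divisor (ZMod 2) K} (hDE : ddeg D = ddeg E) :
    l D = l E := by
  obtain ⟨f, -, hf⟩ := h (D - E) (by rw [ddeg_sub, hDE, sub_self])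
  rw [← l_add_divf E f, hf, add_sub_cancel]

lemma card_four {y : K} (h0 : y ≠ 0) (h1 : y ≠ 1) : ({0, 1, y, 1 + y} : Finset K).card = 4 := by
  have h2 : 1 + y ≠ 0 := fun h => h1 (by
    rw [← add_right_inj 1, h, two_smul_eq_zero])
  rw [Finset.card_insert_of_notMem, Finset.card_insert_of_notMem, Finset.card_pair]
  · simp
  · simp [h1.symm, h0]
  · simp [h0.symm, h2.symm]

lemma four_subset {D : Divisor (ZMod 2) K} {y : K} (h : (1 : K) ∈ L D) (hy : y ∈ L D) :
    ((({0, 1, y, 1 + y} : Finset K)) : Set K) ⊆ L D := by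
  intro z hz
  simp only [Finset.coe_insert, Finset.coe_singleton, Set.mem_insert_iff,
    Set.mem_singleton_iff] at hz
  rcases hz with rfl | rfl | rfl | rfl
  exacts [(L D).zero_mem, h, hy, (L D).add_mem h hy]

lemma two_le_l {D : Divisor (ZMod 2) K} {y : K} (h : (1 : K) ∈ L D) (hy : y ∈ L D)
    (h0 : y ≠ 0) (h1 : y ≠ 1) : 2 ≤ l D := by
  have h3 := Set.ncard_le_ncard (four_subset h hy) (@Set.toFinite _ _ (finite_L D))
  rw [Set.ncard_coe_finset, card_four h0 h1, ← Nat.card_coe_set_eq] at h3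
  have h4 := card_L D
  by_contra! h5
  have : 2 ^ l D ≤ 2 ^ 1 := Nat.pow_le_pow_right (by norm_num) (by omega)
  have h6 : Nat.card (L D : Set K) = 2 ^ l D := h4
  omega

lemma eq_of_l_eq_two {D : Divisor (ZMod 2) K} {y : K} (h : (1 : K) ∈ L D) (hy : y ∈ L D)
    (h0 : y ≠ 0) (h1 : y ≠ 1) (hl : l D = 2) {f : K} (hf : f ∈ L D) :
    f ∈ IntermediateField.adjoin (ZMod 2) {y} := by
  have h6 : Nat.card (L D : Set K) = 2 ^ l D := card_L D
  have h3 := Set.eq_of_subset_of_ncard_le (four_subset h hy) (by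
    rw [Set.ncard_coe_finset, card_four h0 h1, ← Nat.card_coe_set_eq, h6, hl]; norm_num)
    (@Set.toFinite _ _ (finite_L D))
  have hz : f ∈ ((({0, 1, y, 1 + y} : Finset K)) : Set K) := by rw [h3]; exact hf
  simp only [Finset.coe_insert, Finset.coe_singleton, Set.mem_insert_iff,
    Set.mem_singleton_iff] at hz
  have hy' := IntermediateField.mem_adjoin_simple_self (ZMod 2) y
  rcases hz with rfl | rfl | rfl | rfl
  exacts [zero_mem _, one_mem _, hy', add_mem (one_mem _) hy']

lemma mem_adjoin_of_ddeg_poleDiv_eq (hp : AllPrincipal K) {x y : K}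
    (hy : Transcendental (ZMod 2) y)
    (hxy : ddeg (poleDiv x) = ddeg (poleDiv y)) (hl : l (poleDiv y) = 2) :
    x ∈ IntermediateField.adjoin (ZMod 2) {y} := by
  have hy0 : y ≠ 0 := by rintro rfl; exact hy isAlgebraic_zero
  have hy1 : y ≠ 1 := by rintro rfl; exact hy isAlgebraic_one
  obtain ⟨h, h0, hh⟩ := hp (poleDiv x - poleDiv y) (by rw [ddeg_sub, hxy, sub_self])
  have key : ∀ g ∈ L (poleDiv x), h * g ∈ IntermediateField.adjoin (ZMod 2) {y} := by
    intro g hg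
    refine eq_of_l_eq_two (one_mem_L (poleDiv_nonneg y)) (mem_L_poleDiv y) hy0 hy1 hl ?_
    rw [mul_mem_L_iff h0, hh, add_sub_cancel]
    exact hg
  have h1 := key 1 (one_mem_L (poleDiv_nonneg x))
  have h2 := key x (mem_L_poleDiv x)
  have := div_mem h2 h1
  rwa [mul_one, mul_div_cancel_left₀ _ h0] at this

/-- The conclusion, from the dimensions of the Riemann-Roch spaces of small degree. -/
theorem exists_unique_rational_subfield (hp : AllPrincipal K) {n : ℕ}
    (hlt : ∀ D : Divisor (ZMod 2) K, 0 ≤ ddeg D → ddeg D < n → l D ≤ 1)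
    (heq : ∀ D : Divisor (ZMod 2) K, ddeg D = n → l D = 2)
    (hex : ∃ D : Divisor (ZMod 2) K, ddeg D = n) :
    ∃ T : K, Transcendental (ZMod 2) T ∧ degOver T = n ∧
      (∀ y : K, Transcendental (ZMod 2) y → n ≤ degOver y) ∧
      (∀ y : K, Transcendental (ZMod 2) y → degOver y = n →
        IntermediateField.adjoin (ZMod 2) {y} = IntermediateField.adjoin (ZMod 2) {T}) := by
  have hmin : ∀ y : K, Transcendental (ZMod 2) y → n ≤ degOver y := by
    intro y hy
    by_contra! h
    have hy0 : y ≠ 0 := by rintro rfl; exact hy isAlgebraic_zero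
    have hy1 : y ≠ 1 := by rintro rfl; exact hy isAlgebraic_one
    have h1 := two_le_l (one_mem_L (poleDiv_nonneg y)) (mem_L_poleDiv y) hy0 hy1
    have h2 := hlt _ (ddeg_nonneg (poleDiv_nonneg y)) (by rw [ddeg_poleDiv hy]; exact_mod_cast h)
    omega
  obtain ⟨D, hD⟩ := hex
  have hc : Nat.card (L D) = 4 := by rw [card_L, heq D hD]; norm_num
  obtain ⟨f, hf, hf0⟩ := exists_ne_zero_of_l_pos (D := D) (by rw [heq D hD]; norm_num)
  obtain ⟨g, hg, hgn⟩ : ∃ g ∈ L D, g ∉ ({0, f} : Finset K) := by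
    by_contra! h
    have h1 := Set.ncard_le_ncard (s := (L D : Set K)) (t := (({0, f} : Finset K) : Set K))
      (fun g hg => h g hg) (Finset.finite_toSet _)
    rw [Set.ncard_coe_finset] at h1
    have h2 := Finset.card_le_two (a := (0 : K)) (b := f)
    have h3 : (L D : Set K).ncard = 4 := hc
    omega
  have hg0 : g ≠ 0 := by rintro rfl; simp at hgn
  have hgf : g ≠ f := by rintro rfl; simp at hgn
  have hT : Transcendental (ZMod 2) (f⁻¹ * g) := by
    refine transcendental_of_ne (mul_ne_zero (inv_ne_zero hf0) hg0) fun h => hgf ?_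
    rw [inv_mul_eq_iff_eq_mul₀ hf0, mul_one] at h
    exact h
  have hTL : f⁻¹ * g ∈ L (D + divf f) := by
    rw [← mul_mem_L_iff hf0, mul_inv_cancel_left₀ hf0]
    exact hg
  have hTn : degOver (f⁻¹ * g) = n := by
    refine le_antisymm ?_ (hmin _ hT)
    have h1 := ddeg_mono (poleDiv_le (mul_ne_zero (inv_ne_zero hf0) hg0)
      ((mem_L_of_ne hf0).1 hf) hTL)
    rw [ddeg_poleDiv hT, ddeg_add, ddeg_divf, hD, add_zero] at h1
    exact_mod_cast h1
  refine ⟨f⁻¹ * g, hT, hTn, hmin, fun y hy hyn => ?_⟩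
  have e1 : ddeg (poleDiv y) = n := by rw [ddeg_poleDiv hy, hyn]
  have e2 : ddeg (poleDiv (f⁻¹ * g)) = n := by rw [ddeg_poleDiv hT, hTn]
  refine le_antisymm ?_ ?_ <;> rw [IntermediateField.adjoin_simple_le_iff]
  · exact mem_adjoin_of_ddeg_poleDiv_eq hp hT (e1.trans e2.symm) (heq _ e2)
  · exact mem_adjoin_of_ddeg_poleDiv_eq hp hy (e2.trans e1.symm) (heq _ e1)

end Genus

section Series

open PowerSeries

/-- Absolute convergence of a real power series at `t`. -/
def Conv (t : ℝ) (P : PowerSeries ℝ) : Prop := Summable fun n => ‖coeff n P * t ^ n‖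

/-- The value of a real power series at `t`. -/
def ev (t : ℝ) (P : PowerSeries ℝ) : ℝ := ∑' n, coeff n P * t ^ n

variable {t : ℝ} {P Q : PowerSeries ℝ}

lemma coeff_mul_mul_pow (P Q : PowerSeries ℝ) (t : ℝ) (n : ℕ) : coeff n (P * Q) * t ^ n =
    ∑ ij ∈ Finset.HasAntidiagonal.antidiagonal n, (coeff ij.1 P * t ^ ij.1) * (coeff ij.2 Q * t ^ ij.2) := by
  rw [coeff_mul, Finset.sum_mul]
  refine Finset.sum_congr rfl fun ij h => ?_
  rw [← Finset.HasAntidiagonal.mem_antidiagonal.1 h, pow_add]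
  ring

lemma Conv.mul (hP : Conv t P) (hQ : Conv t Q) : Conv t (P * Q) := by
  unfold Conv
  simp only [coeff_mul_mul_pow]
  exact summable_norm_sum_mul_antidiagonal_of_summable_norm
    (f := fun n => coeff n P * t ^ n) (g := fun n => coeff n Q * t ^ n) hP hQ

lemma ev_mul (hP : Conv t P) (hQ : Conv t Q) : ev t (P * Q) = ev t P * ev t Q := by
  unfold ev
  simp only [coeff_mul_mul_pow]
  exact (tsum_mul_tsum_eq_tsum_sum_antidiagonal_of_summable_norm
    (f := fun n => coeff n P * t ^ n) (g := fun n => coeff n Q * t ^ n) hP hQ).symm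

lemma Conv.add (hP : Conv t P) (hQ : Conv t Q) : Conv t (P + Q) := by
  refine Summable.of_nonneg_of_le (fun n => norm_nonneg _) (fun n => ?_) (Summable.add hP hQ)
  rw [map_add, add_mul]
  exact norm_add_le _ _

lemma ev_add (hP : Conv t P) (hQ : Conv t Q) : ev t (P + Q) = ev t P + ev t Q := by
  unfold ev
  rw [← Summable.tsum_add hP.of_norm hQ.of_norm]
  simp [add_mul]

lemma hasSum_of_polynomial (p : Polynomial ℝ) (t : ℝ) :
    HasSum (fun n => coeff n (p : PowerSeries ℝ) * t ^ n) (p.eval t) := by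
  rw [Polynomial.eval_eq_sum, Polynomial.sum]
  simp only [Polynomial.coeff_coe]
  refine hasSum_sum_of_ne_finset_zero fun n hn => ?_
  rw [Polynomial.notMem_support_iff.1 hn, zero_mul]

lemma conv_polynomial (p : Polynomial ℝ) (t : ℝ) : Conv t (p : PowerSeries ℝ) := by
  refine summable_of_ne_finset_zero (s := p.support) fun n hn => ?_
  rw [Polynomial.coeff_coe, Polynomial.notMem_support_iff.1 hn, zero_mul, norm_zero]

lemma ev_polynomial (p : Polynomial ℝ) (t : ℝ) : ev t (p : PowerSeries ℝ) = p.eval t :=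
  (hasSum_of_polynomial p t).tsum_eq

lemma conv_geom {r : ℝ} (hr : 0 ≤ r) (ht : 0 ≤ t) (h : r * t < 1) :
    Conv t (PowerSeries.mk fun n => r ^ n) := by
  unfold Conv
  simp only [coeff_mk, ← mul_pow, norm_pow, Real.norm_of_nonneg (mul_nonneg hr ht)]
  exact summable_geometric_of_lt_one (mul_nonneg hr ht) h

lemma ev_geom {r : ℝ} (hr : 0 ≤ r) (ht : 0 ≤ t) (h : r * t < 1) :
    ev t (PowerSeries.mk fun n => r ^ n) = (1 - r * t)⁻¹ := by
  unfold ev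
  simp only [coeff_mk, ← mul_pow]
  exact tsum_geometric_of_lt_one (mul_nonneg hr ht) h

lemma geom_mul (r : ℝ) : (PowerSeries.mk fun n => r ^ n) * (1 - C r * X) = 1 := by
  ext n
  rw [mul_sub, mul_one, ← mul_assoc, map_sub, coeff_mk, mul_comm _ (C r), mul_assoc]
  cases n with
  | zero => simp
  | succ n => simp [pow_succ']

lemma deriv_one_sub (r : ℝ) : (d⁄dX ℝ) (1 - C r * X) = -C r := by
  rw [map_sub, Derivation.leibniz, derivative_C, derivative_X, Derivation.map_one_eq_zero]
  simp

lemma X_mul_deriv_geom (r : ℝ) : X * (d⁄dX ℝ) (PowerSeries.mk fun n => r ^ n) =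
    C r * X * (PowerSeries.mk fun n => r ^ n) * (PowerSeries.mk fun n => r ^ n) := by
  have h := geom_mul r
  generalize (PowerSeries.mk fun n => r ^ n) = E at h ⊢
  have h1 := congrArg (d⁄dX ℝ) h
  rw [Derivation.leibniz, deriv_one_sub, Derivation.map_one_eq_zero, smul_eq_mul,
    smul_eq_mul] at h1
  linear_combination E * X * h1 - X * (d⁄dX ℝ) E * h

lemma coeff_X_mul_deriv (P : PowerSeries ℝ) (n : ℕ) :
    coeff n (X * (d⁄dX ℝ) P) = n * coeff n P := by
  cases n with
  | zero => simp
  | succ n => rw [coeff_succ_X_mul, coeff_derivative]; push_cast; ring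

lemma coeff_nonneg_of_log_deriv {G Λ : PowerSeries ℝ} (h : X * (d⁄dX ℝ) G = Λ * G)
    (hΛ0 : coeff 0 Λ = 0) (hΛ : ∀ n, 0 ≤ coeff n Λ) (hG : 0 ≤ coeff 0 G) (n : ℕ) :
    0 ≤ coeff n G := by
  induction n using Nat.strong_induction_on with
  | _ n ih =>
    rcases Nat.eq_zero_or_pos n with rfl | hn
    · exact hG
    have h1 := congrArg (coeff n) h
    rw [coeff_X_mul_deriv, coeff_mul] at h1
    have h2 : 0 ≤ (n : ℝ) * coeff n G := by
      rw [h1]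
      refine Finset.sum_nonneg fun ij hij => ?_
      rcases Nat.eq_zero_or_pos ij.1 with h0 | h0
      · rw [h0, hΛ0, zero_mul]
      · exact mul_nonneg (hΛ _) (ih _ (by have := Finset.HasAntidiagonal.mem_antidiagonal.1 hij; omega))
    exact nonneg_of_mul_nonneg_right h2 (by exact_mod_cast hn)

/-- Nonnegativity of `(1 - 2t) Z(t)` inside the critical circle. -/
theorem ev_nonneg {A 𝒮 : PowerSeries ℝ} (hA : X * (d⁄dX ℝ) A = 𝒮 * A) (hA0 : coeff 0 A = 1)
    (h𝒮0 : coeff 0 𝒮 = 0) {r : ℝ} {c : ℕ} (hr : 0 ≤ r)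
    (h𝒮 : ∀ n, 1 ≤ n → 2 ^ n - c * r ^ n ≤ coeff n 𝒮) (ht : 0 ≤ t) (hrt : r * t < 1)
    (hconv : Conv t ((1 - C 2 * X) * A)) : 0 ≤ ev t ((1 - C 2 * X) * A) := by
  obtain ⟨F, hF⟩ : ∃ F, F = (1 - C 2 * X) * A := ⟨_, rfl⟩
  obtain ⟨E, hE⟩ : ∃ E : PowerSeries ℝ, E = PowerSeries.mk fun n => r ^ n := ⟨_, rfl⟩
  obtain ⟨E₂, hE₂⟩ : ∃ E : PowerSeries ℝ, E = PowerSeries.mk fun n => 2 ^ n := ⟨_, rfl⟩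
  rw [← hF] at hconv ⊢
  have hEconv : Conv t E := hE ▸ conv_geom hr ht hrt
  have hEev : ev t E = (1 - r * t)⁻¹ := hE ▸ ev_geom hr ht hrt
  have hEc : ∀ n, Conv t (F * E ^ n) ∧ ev t (F * E ^ n) = ev t F * (1 - r * t)⁻¹ ^ n := by
    intro n
    induction n with
    | zero => simpa using hconv
    | succ n ih =>
      have e : F * E ^ (n + 1) = F * E ^ n * E := by ring
      have hm := ih.1.mul hEconv
      rw [e]
      refine ⟨hm, ?_⟩
      rw [ev_mul ih.1 hEconv, ih.2, hEev]
      ring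
  have h1 : X * (d⁄dX ℝ) F = (𝒮 - C 2 * X * E₂) * F := by
    have hg := geom_mul 2
    rw [← hE₂] at hg
    rw [hF, Derivation.leibniz, deriv_one_sub, smul_eq_mul, smul_eq_mul]
    linear_combination (1 - C 2 * X) * hA + C 2 * X * A * hg
  have h2 : ∀ n : ℕ, X * (d⁄dX ℝ) (E ^ n) = (n : PowerSeries ℝ) * (C r * X * E) * E ^ n := by
    intro n
    have hE1 := X_mul_deriv_geom r
    rw [← hE] at hE1
    induction n with
    | zero => simp
    | succ n ih =>
      rw [pow_succ, Derivation.leibniz, smul_eq_mul, smul_eq_mul, Nat.cast_succ]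
      linear_combination E ^ n * hE1 + E * ih
  have h3 : X * (d⁄dX ℝ) (F * E ^ c) =
      ((𝒮 - C 2 * X * E₂) + (c : PowerSeries ℝ) * (C r * X * E)) * (F * E ^ c) := by
    rw [Derivation.leibniz, smul_eq_mul, smul_eq_mul]
    linear_combination F * h2 c + E ^ c * h1
  have h4 : ∀ n, coeff n (𝒮 - C 2 * X * E₂ + (c : PowerSeries ℝ) * (C r * X * E)) =
      if n = 0 then 0 else coeff n 𝒮 - 2 ^ n + c * r ^ n := by
    intro n
    rw [← map_natCast (C (R := ℝ)), map_add, map_sub, coeff_C_mul, mul_assoc, mul_assoc,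
      coeff_C_mul, coeff_C_mul]
    cases n with
    | zero => simp [h𝒮0]
    | succ n => simp [pow_succ', hE, hE₂]
  have h5 := coeff_nonneg_of_log_deriv h3 (by rw [h4, if_pos rfl]) (fun n => by
    rw [h4]
    split_ifs with h
    · rfl
    · have := h𝒮 n (Nat.one_le_iff_ne_zero.2 h)
      linarith) (by
    simp only [hF, hE, coeff_zero_eq_constantCoeff_apply, map_mul, map_pow, map_sub] at *
    simp [hA0])
  have h6 : 0 ≤ ev t (F * E ^ c) := tsum_nonneg fun n => mul_nonneg (h5 n) (pow_nonneg ht n)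
  rw [(hEc c).2] at h6
  have h7 : 0 < (1 - r * t)⁻¹ ^ c := pow_pos (inv_pos.2 (by linarith)) _
  exact nonneg_of_mul_nonneg_left h6 h7

end Series

section Series

open PowerSeries

/-- The numerical part of the argument: the dimensions of the Riemann-Roch spaces of degree at
most five are forced. -/
theorem dims_of_counts {ℓ : ℕ → ℕ} {s : ℕ → ℝ} {c N : ℕ} (hℓ0 : ℓ 0 = 1)
    (hrec : ∀ n : ℕ, (n : ℝ) * (2 ^ ℓ n - 1) =
      ∑ ij ∈ Finset.HasAntidiagonal.antidiagonal n, s ij.1 * (2 ^ ℓ ij.2 - 1))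
    (hs0 : s 0 = 0) (hs : ∀ n, 1 ≤ n → 2 ^ n - c * √2 ^ n ≤ s n)
    (hge : ∀ n, n ≤ ℓ n + 3) (hN : ∀ n, N ≤ n → ℓ n + 3 = n) (h6 : ℓ 6 = 4) :
    ℓ 1 = 0 ∧ ℓ 2 = 0 ∧ ℓ 3 = 0 ∧ ℓ 4 = 1 ∧ ℓ 5 = 2 := by
  obtain ⟨A, hA⟩ : ∃ A : PowerSeries ℝ, A = PowerSeries.mk fun n => 2 ^ ℓ n - 1 := ⟨_, rfl⟩
  obtain ⟨B, hB⟩ : ∃ B : PowerSeries ℝ, B = PowerSeries.mk fun n => (2 : ℝ) ^ ℓ n - 2 ^ n / 8 :=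
    ⟨_, rfl⟩
  obtain ⟨E₁, hE₁⟩ : ∃ E : PowerSeries ℝ, E = PowerSeries.mk fun n => (1 : ℝ) ^ n := ⟨_, rfl⟩
  obtain ⟨E₂, hE₂⟩ : ∃ E : PowerSeries ℝ, E = PowerSeries.mk fun n => (2 : ℝ) ^ n := ⟨_, rfl⟩
  have hg := geom_mul 2
  rw [← hE₂] at hg
  have hAB : A = B + C (1 / 8) * E₂ + C (-1) * E₁ := by
    ext n
    rw [map_add, map_add, coeff_C_mul, coeff_C_mul, hA, hB, hE₁, hE₂]
    simp only [coeff_mk]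
    ring
  have hF : (1 - C 2 * X) * A =
      (1 - C 2 * X) * B + (C (1 / 8) + (1 - C 2 * X) * (C (-1) * E₁)) := by
    rw [hAB]
    linear_combination C (1 / 8) * hg
  set t : ℝ := 707 / 1000 with ht
  have ht0 : 0 ≤ t := by norm_num [ht]
  have hpol : ((1 - Polynomial.C 2 * Polynomial.X : Polynomial ℝ) : PowerSeries ℝ) =
      1 - C 2 * X := by
    simp
  have c1 : Conv t (1 - C 2 * X) := hpol ▸ conv_polynomial _ t
  have v1 : ev t (1 - C 2 * X) = 1 - 2 * t := by
    rw [← hpol, ev_polynomial]; simp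
  have hc : ∀ a : ℝ, Conv t (C a) ∧ ev t (C a) = a := fun a => by
    rw [← Polynomial.coe_C]
    exact ⟨conv_polynomial _ t, by rw [ev_polynomial, Polynomial.eval_C]⟩
  have c2 : Conv t E₁ := hE₁ ▸ conv_geom zero_le_one ht0 (by norm_num [ht])
  have v2 : ev t E₁ = (1 - 1 * t)⁻¹ := hE₁ ▸ ev_geom zero_le_one ht0 (by norm_num [ht])
  have hBpos : ∀ n, 0 ≤ coeff n B := by
    intro n
    rw [hB, coeff_mk]
    have : (2 : ℝ) ^ n ≤ 2 ^ (ℓ n + 3) := pow_le_pow_right₀ (by norm_num) (hge n)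
    rw [pow_add] at this
    linarith
  have hB0 : ∀ n, n ∉ Finset.range N → coeff n B = 0 := by
    intro n hn
    rw [hB, coeff_mk]
    have h := hN n (by simpa using hn)
    have : (2 : ℝ) ^ n = 2 ^ (ℓ n + 3) := by rw [h]
    rw [this, pow_add]
    ring
  have c3 : Conv t B := summable_of_ne_finset_zero (s := Finset.range N) fun n hn => by
    rw [hB0 n hn, zero_mul, norm_zero]
  have hS : Conv t ((1 - C 2 * X) * A) := by
    rw [hF]
    exact (c1.mul c3).add ((hc _).1.add (c1.mul ((hc _).1.mul c2)))
  have hev : ev t ((1 - C 2 * X) * A) =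
      (1 - 2 * t) * ev t B + (1 / 8 + (1 - 2 * t) * (-1 * (1 - 1 * t)⁻¹)) := by
    rw [hF, ev_add (c1.mul c3) ((hc _).1.add (c1.mul ((hc _).1.mul c2))), ev_mul c1 c3,
      ev_add (hc _).1 (c1.mul ((hc _).1.mul c2)), ev_mul c1 ((hc _).1.mul c2),
      ev_mul (hc _).1 c2, (hc _).2, (hc _).2, v1, v2]
  have hdiff : X * (d⁄dX ℝ) A = PowerSeries.mk s * A := by
    ext n
    rw [coeff_X_mul_deriv, coeff_mul, hA, coeff_mk, hrec]
    simp only [coeff_mk]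
  have hnonneg := ev_nonneg (r := √2) (c := c) hdiff (by rw [hA, coeff_mk, hℓ0]; norm_num)
    (by rw [coeff_mk, hs0]) (Real.sqrt_nonneg 2) (fun n hn => by rw [coeff_mk]; exact hs n hn)
    ht0 (by
      have : √2 < 1000 / 707 := by
        rw [Real.sqrt_lt' (by norm_num)]; norm_num
      rw [ht]; linarith) hS
  rw [hev] at hnonneg
  have hsum : ∑ n ∈ Finset.range 7, coeff n B * t ^ n ≤ ev t B :=
    Summable.sum_le_tsum _ (fun n _ => mul_nonneg (hBpos n) (pow_nonneg ht0 n)) c3.of_norm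
  have hb : ∀ (n m : ℕ), m ≤ ℓ n → (2 : ℝ) ^ m - 2 ^ n / 8 ≤ coeff n B := by
    intro n m h
    rw [hB, coeff_mk]
    have : (2 : ℝ) ^ m ≤ 2 ^ ℓ n := pow_le_pow_right₀ (by norm_num) h
    linarith
  have hbound : ev t B ≤ 3.7150 := by
    norm_num [ht] at hnonneg ⊢
    linarith
  replace hsum := hsum.trans hbound
  simp only [Finset.sum_range_succ, Finset.sum_range_zero] at hsum
  have b0 := hb 0 1 hℓ0.ge
  have b1 := hb 1 0 (Nat.zero_le _)
  have b2 := hb 2 0 (Nat.zero_le _)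
  have b3 := hBpos 3
  have b4 := hBpos 4
  have b5 := hBpos 5
  have b6 := hb 6 4 h6.ge
  norm_num [ht] at b0 b1 b2 b6 hsum
  have g4 := hge 4
  have g5 := hge 5
  refine ⟨?_, ?_, ?_, ?_, ?_⟩ <;> by_contra hcon
  · have := hb 1 1 (by omega)
    norm_num at this
    linarith
  · have := hb 2 1 (by omega)
    norm_num at this
    linarith
  · have := hb 3 1 (by omega)
    norm_num at this
    linarith
  · have := hb 4 2 (by omega)
    norm_num at this
    linarith
  · have := hb 5 3 (by omega)
    norm_num at this
    linarith

end Series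

section Counting

variable [IsCFF K]

lemma Place.residue_eq_zero_iff (p : Place (ZMod 2) K) (f : p.ring) :
    IsLocalRing.residue p.ring f = 0 ↔ (f : K) ∈ p.pw 1 := by
  rw [IsLocalRing.residue_eq_zero_iff, IsLocalRing.mem_maximalIdeal, mem_nonunits_iff]
  by_cases hf : (f : K) = 0
  · have : f = 0 := Subtype.ext hf
    subst this
    simp
  rw [p.mem_pw_of_ne hf, not_iff_comm]
  constructor
  · intro h
    have h1 : (f : K)⁻¹ ∈ p.ring := by
      rw [p.mem_ring_iff (inv_ne_zero hf), p.ord_inv]; omega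
    exact IsUnit.of_mul_eq_one ⟨_, h1⟩ (Subtype.ext (mul_inv_cancel₀ hf))
  · intro h h1
    obtain ⟨u, rfl⟩ := h
    have h2 : p.ord ((u⁻¹ : p.ringˣ) : p.ring) = -p.ord (u : p.ring) := by
      rw [← p.ord_inv, p.coe_unit_inv]
    have := p.ord_nonneg ((u⁻¹ : p.ringˣ) : p.ring).2
    omega

/-- Elements integral at `p` are fixed modulo `p` by the Frobenius of the residue field. -/
lemma Place.pow_sub_mem_pw (p : Place (ZMod 2) K) {f : K} (hf : f ∈ p.ring) :
    f ^ 2 ^ p.deg - f ∈ p.pw 1 := by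
  let F : p.ring := ⟨f, hf⟩
  have : Fintype (IsLocalRing.ResidueField p.ring) := Fintype.ofFinite _
  have h := FiniteField.pow_card (IsLocalRing.residue p.ring F)
  rw [← Nat.card_eq_fintype_card, p.card_residueField] at h
  rw [← map_pow, ← sub_eq_zero, ← map_sub, p.residue_eq_zero_iff] at h
  exact h

lemma pow_sub_self_ne_zero {x : K} (hx : Transcendental (ZMod 2) x) {q : ℕ} (hq : 1 < q) :
    x ^ q - x ≠ 0 := by
  intro h
  refine hx ⟨Polynomial.X ^ q - Polynomial.X, FiniteField.X_pow_card_sub_X_ne_zero _ hq, ?_⟩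
  simpa using h

lemma finite_places_le (K : Type) [Field K] [Algebra (ZMod 2) K] [IsCFF K] (n : ℕ) :
    {p : Place (ZMod 2) K | p.deg ≤ n}.Finite := by
  obtain ⟨x, hx⟩ := exists_transcendental (K := K)
  refine ((finite_ord_ne_zero x).union ((Finset.range (n + 1)).finite_toSet.biUnion
    fun d _ => finite_ord_ne_zero (x ^ 2 ^ d - x))).subset fun p hp => ?_
  by_cases h : p.ord x = 0
  · refine Or.inr (Set.mem_biUnion (x := p.deg) (by simpa using Nat.lt_succ_of_le hp) ?_)
    have hx0 : x ≠ 0 := by rintro rfl; exact hx isAlgebraic_zero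
    have h1 := p.pow_sub_mem_pw ((p.mem_ring_iff hx0).2 h.ge)
    rw [p.mem_pw_of_ne (pow_sub_self_ne_zero hx (Nat.one_lt_two_pow p.deg_pos.ne'))] at h1
    exact (by omega : p.ord (x ^ 2 ^ p.deg - x) ≠ 0)
  · exact Or.inl h

/-- The places of degree at most `n`. -/
def placesLE (K : Type) [Field K] [Algebra (ZMod 2) K] [IsCFF K] (n : ℕ) :
    Finset (Place (ZMod 2) K) := (finite_places_le K n).toFinset

@[simp] lemma mem_placesLE {n : ℕ} {p : Place (ZMod 2) K} : p ∈ placesLE K n ↔ p.deg ≤ n := by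
  simp [placesLE]

/-- The sum of the degrees of the places whose degree divides `n`. -/
def sdeg (K : Type) [Field K] [Algebra (ZMod 2) K] [IsCFF K] (n : ℕ) : ℕ :=
  ∑ p ∈ placesLE K n, if p.deg ∣ n then p.deg else 0

lemma sdeg_zero : sdeg K 0 = 0 := by
  refine Finset.sum_eq_zero fun p hp => ?_
  have := p.deg_pos
  rw [mem_placesLE] at hp
  omega

lemma sum_le_sdeg {n : ℕ} (hn : 0 < n) (S : Finset (Place (ZMod 2) K))
    (hS : ∀ p ∈ S, p.deg ∣ n) : ∑ p ∈ S, p.deg ≤ sdeg K n := by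
  calc ∑ p ∈ S, p.deg = ∑ p ∈ S, if p.deg ∣ n then p.deg else 0 :=
        Finset.sum_congr rfl fun p hp => by rw [if_pos (hS p hp)]
    _ ≤ sdeg K n := Finset.sum_le_sum_of_subset fun p hp =>
        mem_placesLE.2 (Nat.le_of_dvd hn (hS p hp))

lemma sdeg_eq {n k : ℕ} (hk : k ≤ n) : sdeg K k =
    ∑ p ∈ placesLE K n, ∑ j ∈ Finset.Icc 1 n, if j * p.deg = k then p.deg else 0 := by
  have h : ∀ m ≤ n, ∀ p : Place (ZMod 2) K, p.deg ∣ m → 0 < m →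
      (∑ j ∈ Finset.Icc 1 n, if j * p.deg = m then p.deg else 0) = p.deg := by
    rintro m hm p ⟨c, rfl⟩ h0
    have hp := p.deg_pos
    have hc : 0 < c := Nat.pos_of_mul_pos_left h0
    rw [Finset.sum_eq_single c]
    · rw [if_pos (mul_comm _ _)]
    · intro b _ hb
      rw [if_neg]
      intro h
      rw [mul_comm] at h
      exact hb (Nat.eq_of_mul_eq_mul_left hp h)
    · intro hc'
      refine absurd (Finset.mem_Icc.2 ⟨hc, ?_⟩) hc'
      nlinarith
  have h' : ∀ p : Place (ZMod 2) K, (¬ p.deg ∣ k ∨ k = 0) →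
      (∑ j ∈ Finset.Icc 1 n, if j * p.deg = k then p.deg else 0) = 0 := by
    intro p hp
    refine Finset.sum_eq_zero fun j hj => if_neg ?_
    have := p.deg_pos
    rintro rfl
    rcases hp with hp | hp
    · exact hp (Dvd.intro_left _ rfl)
    · have := (Finset.mem_Icc.1 hj).1
      rcases Nat.mul_eq_zero.1 hp with h | h <;> omega
  rcases Nat.eq_zero_or_pos k with rfl | hk0
  · rw [sdeg_zero, Finset.sum_eq_zero fun p _ => h' p (Or.inr rfl)]
  have e : sdeg K k = ∑ p ∈ placesLE K n, if p.deg ∣ k then p.deg else 0 := by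
    refine Finset.sum_subset (fun p hp => ?_) fun p _ hp => if_neg fun hd => hp ?_
    · rw [mem_placesLE] at *; omega
    · exact mem_placesLE.2 (Nat.le_of_dvd hk0 hd)
  rw [e]
  refine Finset.sum_congr rfl fun p _ => ?_
  split_ifs with hd
  · exact (h k hk p hd hk0).symm
  · exact (h' p (Or.inl hd)).symm

/-- The effective divisors of degree `n`. -/
def effective (K : Type) [Field K] [Algebra (ZMod 2) K] (n : ℕ) : Set (Divisor (ZMod 2) K) :=
  {D | 0 ≤ D ∧ ddeg D = n}

lemma card_effective (hp : AllPrincipal K) {n : ℕ} {D₀ : Divisor (ZMod 2) K} (hD₀ : ddeg D₀ = n) :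
    (effective K n).Finite ∧ (effective K n).ncard = 2 ^ l D₀ - 1 := by
  have himg : effective K n = (fun f => D₀ + divf f) '' ((L D₀ : Set K) \ {0}) := by
    ext D
    constructor
    · rintro ⟨h0, hD⟩
      obtain ⟨f, hf, hfd⟩ := hp (D - D₀) (by rw [ddeg_sub, hD, hD₀, sub_self])
      refine ⟨f, ⟨(mem_L_of_ne hf).2 ?_, hf⟩, ?_⟩
      · rw [hfd, add_sub_cancel]; exact h0
      · simp only [hfd, add_sub_cancel]
    · rintro ⟨f, ⟨hf, hf0⟩, rfl⟩
      exact ⟨(mem_L_of_ne hf0).1 hf, by rw [ddeg_add, ddeg_divf, hD₀, add_zero]⟩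
  have hfin : (L D₀ : Set K).Finite := @Set.toFinite _ _ (finite_L D₀)
  refine ⟨himg ▸ (hfin.sdiff).image _, ?_⟩
  rw [himg, Set.InjOn.ncard_image, Set.ncard_sdiff_singleton_of_mem (L D₀).zero_mem]
  · congr 1
    exact card_L D₀
  · rintro f ⟨-, hf⟩ g ⟨-, hg⟩ h
    have hf : f ≠ 0 := hf
    have hg : g ≠ 0 := hg
    have h1 : divf (f * g⁻¹) = 0 := by
      rw [divf_mul hf (inv_ne_zero hg), divf_inv, add_left_cancel h, add_neg_cancel]
    have h2 : f * g⁻¹ ∈ L (0 : Divisor (ZMod 2) K) := by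
      rw [mem_L_of_ne (mul_ne_zero hf (inv_ne_zero hg)), h1, add_zero]
    rcases mem_L_zero.1 h2 with h3 | h3
    · exact absurd h3 (mul_ne_zero hf (inv_ne_zero hg))
    · rwa [mul_inv_eq_one₀ hg] at h3

lemma ncard_effective_ge (n j : ℕ) (p : Place (ZMod 2) K) :
    {D ∈ effective K n | (j : ℤ) ≤ D p}.ncard =
      if j * p.deg ≤ n then (effective K (n - j * p.deg)).ncard else 0 := by
  split_ifs with h
  · have : {D ∈ effective K n | (j : ℤ) ≤ D p} =
        (fun D => D + Finsupp.single p (j : ℤ)) '' effective K (n - j * p.deg) := by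
      ext D
      constructor
      · rintro ⟨⟨h0, hD⟩, hj⟩
        refine ⟨D - Finsupp.single p (j : ℤ), ⟨?_, ?_⟩, sub_add_cancel _ _⟩
        · intro r
          have := h0 r
          rw [Finsupp.sub_apply, Finsupp.single_apply]
          split_ifs with hr
          · subst hr; simpa using hj
          · simpa using this
        · rw [ddeg_sub, ddeg_single, hD, Nat.cast_sub h, Nat.cast_mul]
      · rintro ⟨D, ⟨h0, hD⟩, rfl⟩
        refine ⟨⟨add_nonneg h0 (Finsupp.single_nonneg.2 (by positivity)), ?_⟩, ?_⟩
        · rw [ddeg_add, ddeg_single, hD, Nat.cast_sub h, Nat.cast_mul]; ring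
        · rw [Finsupp.add_apply, Finsupp.single_eq_same]
          have := h0 p
          simpa using this
    rw [this, Set.ncard_image_of_injective _ (add_left_injective _)]
  · convert Set.ncard_empty (Divisor (ZMod 2) K)
    refine Set.eq_empty_of_forall_notMem ?_
    rintro D ⟨⟨h0, hD⟩, hj⟩
    have h1 : Finsupp.single p (j : ℤ) ≤ D := by
      intro r
      rw [Finsupp.single_apply]
      split_ifs with hr
      · exact hr ▸ hj
      · exact h0 r
    have h2 := ddeg_mono h1
    rw [ddeg_single, hD] at h2
    exact h (by exact_mod_cast h2)

/-- The recurrence for the numbers of effective divisors, which is the logarithmic derivative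
of the Euler product. -/
theorem mul_card_effective (hfin : ∀ n, (effective K n).Finite) (n : ℕ) :
    n * (effective K n).ncard = ∑ ij ∈ Finset.HasAntidiagonal.antidiagonal n,
      sdeg K ij.1 * (effective K ij.2).ncard := by
  have h1 : ∀ D ∈ (hfin n).toFinset, n = ∑ p ∈ placesLE K n, ∑ j ∈ Finset.Icc 1 n,
      if (j : ℤ) ≤ D p then p.deg else 0 := by
    intro D hD
    obtain ⟨h0, hD⟩ := (hfin n).mem_toFinset.1 hD
    have hle : ∀ p, D p * p.deg ≤ n := by
      intro p
      rw [← ddeg_single, ← hD]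
      refine ddeg_mono fun r => ?_
      rw [Finsupp.single_apply]
      split_ifs with hr
      · rw [hr]
      · exact h0 r
    have hDp : ∀ p, 0 ≤ D p := fun p => h0 p
    have hdp : ∀ p : Place (ZMod 2) K, (1 : ℤ) ≤ p.deg := fun p => by exact_mod_cast p.deg_pos
    rw [ddeg_eq_sum_of_subset (S := placesLE K n)] at hD
    · zify
      rw [← hD]
      refine Finset.sum_congr rfl fun p _ => ?_
      have hn : D p ≤ n := by nlinarith [hle p, hDp p, hdp p]
      rw [← Finset.sum_filter, Finset.sum_const, nsmul_eq_mul]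
      congr 1
      have : (Finset.Icc 1 n).filter (fun j : ℕ => (j : ℤ) ≤ D p) = Finset.Icc 1 (D p).toNat := by
        ext j
        simp only [Finset.mem_filter, Finset.mem_Icc]
        have := hDp p
        omega
      rw [this, Nat.card_Icc, Nat.add_sub_cancel, Int.toNat_of_nonneg (hDp p)]
    · intro p hp
      rw [Finsupp.mem_support_iff] at hp
      rw [mem_placesLE]
      have := hDp p
      have : 1 ≤ D p := by omega
      zify
      nlinarith [hle p, hdp p]
  have h2 : ∀ (p : Place (ZMod 2) K) (j : ℕ),
      (∑ D ∈ (hfin n).toFinset, if (j : ℤ) ≤ D p then p.deg else 0) =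
        ∑ ij ∈ Finset.HasAntidiagonal.antidiagonal n,
          (if j * p.deg = ij.1 then p.deg else 0) * (effective K ij.2).ncard := by
    intro p j
    rw [← Finset.sum_filter, Finset.sum_const, smul_eq_mul]
    have h3 : ((hfin n).toFinset.filter fun D => (j : ℤ) ≤ D p).card =
        {D ∈ effective K n | (j : ℤ) ≤ D p}.ncard := by
      rw [← Set.ncard_coe_finset]
      congr 1
      ext D
      simp
    rw [h3, ncard_effective_ge]
    simp only [ite_mul, zero_mul]
    rw [← Finset.sum_filter]
    split_ifs with hj
    · rw [Finset.sum_eq_single (j * p.deg, n - j * p.deg)]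
      · ring
      · rintro ⟨a, b⟩ hab hne
        rw [Finset.mem_filter, Finset.HasAntidiagonal.mem_antidiagonal] at hab
        simp only at hab
        exact absurd (Prod.ext hab.2.symm (by simp only; omega)) hne
      · intro h
        refine absurd ?_ h
        rw [Finset.mem_filter, Finset.HasAntidiagonal.mem_antidiagonal]
        exact ⟨by simp only; omega, rfl⟩
    · rw [eq_comm]
      refine Finset.sum_eq_zero ?_
      rintro ⟨a, b⟩ hab
      rw [Finset.mem_filter, Finset.HasAntidiagonal.mem_antidiagonal] at hab
      simp only at hab
      omega
  rw [Set.ncard_eq_toFinset_card _ (hfin n), mul_comm, ← smul_eq_mul, ← Finset.sum_const,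
    Finset.sum_congr rfl h1, Finset.sum_comm]
  have h4 : ∀ ij ∈ Finset.HasAntidiagonal.antidiagonal n,
      sdeg K ij.1 * (effective K ij.2).ncard = ∑ p ∈ placesLE K n, ∑ j ∈ Finset.Icc 1 n,
        (if j * p.deg = ij.1 then p.deg else 0) * (effective K ij.2).ncard := by
    intro ij hij
    have := Finset.HasAntidiagonal.mem_antidiagonal.1 hij
    rw [sdeg_eq (n := n) (by omega), Finset.sum_mul]
    refine Finset.sum_congr rfl fun p _ => ?_
    rw [Finset.sum_mul]
  rw [Finset.sum_congr rfl h4, Finset.sum_comm (s := Finset.HasAntidiagonal.antidiagonal n)]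
  refine Finset.sum_congr rfl fun p _ => ?_
  rw [Finset.sum_comm, Finset.sum_comm (s := Finset.HasAntidiagonal.antidiagonal n)]
  exact Finset.sum_congr rfl fun j _ => h2 p j

/-- The dimensions of the Riemann-Roch spaces of small degree, given a lower bound for the
number of places. -/
theorem dims_of_sdeg (hp : AllPrincipal K) (hg : genus (ZMod 2) K = 4) {c : ℕ}
    (hs : ∀ n, 1 ≤ n → 2 ^ n - c * √2 ^ n ≤ (sdeg K n : ℝ)) :
    ∃ ℓ : ℕ → ℕ, (∀ (D : Divisor (ZMod 2) K) (n : ℕ), ddeg D = n → l D = ℓ n) ∧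
      (∃ D : Divisor (ZMod 2) K, ddeg D = 1) ∧
      ℓ 0 = 1 ∧ ℓ 1 = 0 ∧ ℓ 2 = 0 ∧ ℓ 3 = 0 ∧ ℓ 4 = 1 ∧ ℓ 5 = 2 := by
  obtain ⟨C₀, hC₀⟩ : ∃ D : Divisor (ZMod 2) K, ddeg D = 1 := by
    have h1 : ∀ n, 1 ≤ n → c * √2 ^ n < 2 ^ n → ∃ p : Place (ZMod 2) K, p.deg ∣ n := by
      intro n hn h
      by_contra! hcon
      have h2 : sdeg K n = 0 := Finset.sum_eq_zero fun p _ => if_neg (hcon p)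
      have h3 := hs n hn
      rw [h2, Nat.cast_zero] at h3
      linarith
    have h2 : (c : ℝ) < 2 ^ (c + 1) := by
      have : c + 1 < 2 ^ (c + 1) := Nat.lt_two_pow_self
      exact_mod_cast (by omega : c < 2 ^ (c + 1))
    have h3 : (0 : ℝ) < 2 ^ (c + 1) := by positivity
    have h4 : √2 ^ (2 * (c + 1)) = 2 ^ (c + 1) := by
      rw [pow_mul, Real.sq_sqrt zero_le_two]
    have h5 : √2 < 2 := by
      rw [Real.sqrt_lt' (by norm_num)]; norm_num
    have h6 : (2 : ℝ) ^ (2 * (c + 1)) = 2 ^ (c + 1) * 2 ^ (c + 1) := by rw [two_mul, pow_add]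
    obtain ⟨p, hp⟩ := h1 (2 * (c + 1)) (by omega) (by
      rw [h4, h6]
      exact mul_lt_mul_of_pos_right h2 h3)
    obtain ⟨p', hp'⟩ := h1 (2 * (c + 1) + 1) (by omega) (by
      rw [pow_succ, h4, pow_succ (2 : ℝ) (2 * (c + 1)), h6, ← mul_assoc]
      refine lt_of_le_of_lt ?_ (mul_lt_mul_of_pos_right
        (mul_lt_mul_of_pos_right h2 h3) zero_lt_two)
      exact mul_le_mul_of_nonneg_left h5.le (by positivity))
    have hcop : Nat.Coprime p.deg p'.deg :=
      Nat.Coprime.of_dvd hp hp' (by simp)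
    obtain ⟨a, b, hab⟩ := Nat.isCoprime_iff_coprime.2 hcop
    refine ⟨Finsupp.single p a + Finsupp.single p' b, ?_⟩
    rw [ddeg_add, ddeg_single, ddeg_single, hab]
  obtain ⟨hge, D₁, hD₁⟩ := riemann_of_genus (g := 4) (by norm_num) hg
  obtain ⟨W, hW⟩ := exists_canonical (g := (4 : ℕ)) (by norm_num) hge hD₁
  have hd : ∀ n : ℕ, ddeg (n • C₀) = n := fun n => by rw [ddeg_nsmul, hC₀, mul_one]
  have hl : ∀ (D : Divisor (ZMod 2) K) (n : ℕ), ddeg D = n → l D = l (n • C₀) := fun D n h =>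
    hp.l_eq (h.trans (hd n).symm)
  refine ⟨fun n => l (n • C₀), hl, ⟨C₀, hC₀⟩, by simp, ?_⟩
  have hfin : ∀ n, (effective K n).Finite := fun n => (card_effective hp (hd n)).1
  have hcard : ∀ n, ((effective K n).ncard : ℝ) = 2 ^ l (n • C₀) - 1 := fun n => by
    rw [(card_effective hp (hd n)).2, Nat.cast_sub Nat.one_le_two_pow]
    push_cast
    rfl
  have hlW : l W = 4 := by
    have := hW 0
    rw [l_zero, sub_zero, ddeg_zero] at this
    push_cast at this
    omega
  have hdW : ddeg W = 6 := by
    have := hW W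
    rw [hlW, sub_self, l_zero] at this
    push_cast at this
    omega
  refine dims_of_counts (ℓ := fun n => l (n • C₀)) (s := fun n => sdeg K n) (c := c) (N := 7) (by simp) ?_
    (by simp [sdeg_zero]) hs ?_ ?_ ?_
  · intro n
    have := mul_card_effective hfin n
    rw [← hcard]
    simp only [← hcard]
    exact_mod_cast this
  · intro n
    have := hge (n • C₀)
    rw [hd] at this
    push_cast at this
    omega
  · intro n hn
    have h1 := hW (n • C₀)
    have h2 : l (W - n • C₀) = 0 := by
      by_contra h
      have := ddeg_nonneg_of_l_pos (Nat.pos_of_ne_zero h)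
      rw [ddeg_sub, hdW, hd] at this
      omega
    rw [h2, hd] at h1
    push_cast at h1
    omega
  · rw [← hl W 6 (by rw [hdW]; rfl), hlW]

end Counting

section Compositum

variable [IsCFF K] (κ : Type) [Field κ] [Algebra (ZMod 2) κ] [FiniteDimensional (ZMod 2) κ]

open Polynomial in
/-- A finite extension of the constant field stays linearly independent over `K` in a suitable
common overfield. -/
lemma exists_compositum : ∃ (b : Module.Basis (Fin (Module.finrank (ZMod 2) κ)) (ZMod 2) κ)
    (σ : κ →ₐ[ZMod 2] AlgebraicClosure K), LinearIndependent K (fun l => σ (b l)) := by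
  obtain ⟨θ, hθ⟩ := Field.exists_primitive_element (ZMod 2) κ
  have hint : IsIntegral (ZMod 2) θ := Algebra.IsIntegral.isIntegral θ
  let pb := Field.powerBasisOfFiniteOfSeparable (ZMod 2) κ
  clear hint hθ θ
  have hint : IsIntegral (ZMod 2) pb.gen := Algebra.IsIntegral.isIntegral pb.gen
  let σ : κ →ₐ[ZMod 2] AlgebraicClosure K := IsAlgClosed.lift
  have hσint : IsIntegral (ZMod 2) (σ pb.gen) := hint.map σ
  have hmin : minpoly (ZMod 2) (σ pb.gen) = minpoly (ZMod 2) pb.gen :=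
    minpoly.algHom_eq σ σ.injective _
  have hKint : IsIntegral K (σ pb.gen) := hσint.tower_top
  have hdvd : minpoly K (σ pb.gen) ∣ (minpoly (ZMod 2) pb.gen).map (algebraMap (ZMod 2) K) := by
    rw [← hmin]
    exact minpoly.dvd_map_of_isScalarTower _ _ _
  have hlift := integralClosure.mem_lifts_of_monic_of_dvd_map K (minpoly.monic hint)
    (minpoly.monic hKint) hdvd
  have hlift2 : minpoly K (σ pb.gen) ∈ lifts (algebraMap (ZMod 2) K) := by
    rw [lifts_iff_coeff_lifts] at hlift ⊢
    intro n
    obtain ⟨z, hz⟩ := hlift n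
    rw [← hz]
    exact IsCFF.exactConstants _ (z.2 : IsIntegral _ _).isAlgebraic
  obtain ⟨r, hr⟩ := hlift2
  have hr' : r.map (algebraMap (ZMod 2) K) = minpoly K (σ pb.gen) := hr
  have hdeg : (minpoly K (σ pb.gen)).natDegree = pb.dim := by
    apply le_antisymm
    · refine (natDegree_le_of_dvd hdvd ?_).trans ?_
      · exact ((minpoly.monic hint).map _).ne_zero
      · rw [natDegree_map, pb.natDegree_minpoly]
    · rw [← pb.natDegree_minpoly, ← hmin, ← hr', natDegree_map]
      refine natDegree_le_of_dvd (minpoly.dvd _ _ ?_) ?_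
      · have := minpoly.aeval K (σ pb.gen)
        rw [← hr', aeval_map_algebraMap] at this
        exact this
      · intro h
        rw [h, Polynomial.map_zero] at hr'
        exact minpoly.ne_zero hKint hr'.symm
  have hli := linearIndependent_pow (K := K) (σ pb.gen)
  have hfr : Module.finrank (ZMod 2) κ = pb.dim := pb.finrank
  refine ⟨pb.basis.reindex (finCongr hfr.symm), σ, ?_⟩
  have := hli.comp (fun l : Fin (Module.finrank (ZMod 2) κ) => finCongr (hfr.trans hdeg.symm) l)
    (Equiv.injective _)
  convert this using 2 with l
  simp

variable {κ}

lemma det_ne_zero_of_linearIndependent {ι : Type*} [Fintype ι] {m : ℕ} {a : ι → K}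
    (ha : LinearIndependent (ZMod 2) a) {γ : ι → κ} (hγ : γ ≠ 0)
    (b : Module.Basis (Fin m) (ZMod 2) κ) (σ : κ →ₐ[ZMod 2] AlgebraicClosure K)
    (hσ : LinearIndependent K (fun l => σ (b l))) :
    (Matrix.of fun k l => ∑ i, a i * algebraMap (ZMod 2) K (b.repr (γ i * b l) k)).det ≠ 0 := by
  intro hdet
  obtain ⟨w, hw, hBw⟩ := Matrix.exists_mulVec_eq_zero_iff.2 hdet
  rw [Fintype.linearIndependent_iff] at hσ ha
  have hexp : ∀ x : κ, ∑ k, algebraMap K (AlgebraicClosure K)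
      (algebraMap (ZMod 2) K (b.repr x k)) * σ (b k) = σ x := by
    intro x
    conv_rhs => rw [← b.sum_repr x]
    rw [map_sum]
    refine Finset.sum_congr rfl fun k _ => ?_
    rw [map_smul, Algebra.smul_def, ← IsScalarTower.algebraMap_apply]
  have hprod : (∑ i, algebraMap K (AlgebraicClosure K) (a i) * σ (γ i)) *
      (∑ l, algebraMap K (AlgebraicClosure K) (w l) * σ (b l)) = 0 := by
    calc _ = ∑ l, ∑ i, algebraMap K (AlgebraicClosure K) (w l) *
          (algebraMap K (AlgebraicClosure K) (a i) * σ (γ i * b l)) := by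
          rw [Finset.sum_mul_sum, Finset.sum_comm]
          refine Finset.sum_congr rfl fun l _ => Finset.sum_congr rfl fun i _ => ?_
          rw [map_mul]; ring
      _ = ∑ k, algebraMap K (AlgebraicClosure K) (Matrix.mulVec
          (Matrix.of fun k l => ∑ i, a i * algebraMap (ZMod 2) K (b.repr (γ i * b l) k)) w k) *
            σ (b k) := by
          simp only [← hexp (_ * _), Matrix.mulVec, dotProduct, Matrix.of_apply, map_sum, map_mul,
            Finset.mul_sum, Finset.sum_mul]
          rw [Finset.sum_comm]
          conv_lhs => enter [2, i]; rw [Finset.sum_comm]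
          rw [Finset.sum_comm]
          refine Finset.sum_congr rfl fun k _ => ?_
          rw [Finset.sum_comm]
          refine Finset.sum_congr rfl fun l _ => Finset.sum_congr rfl fun i _ => ?_
          ring
      _ = 0 := by
          rw [hBw]; simp
  rcases mul_eq_zero.1 hprod with h | h
  · have h2 := hσ (fun k => ∑ i, a i * algebraMap (ZMod 2) K (b.repr (γ i) k)) (by
      rw [← h]
      simp only [← hexp (γ _), Algebra.smul_def, map_sum, map_mul, Finset.mul_sum, Finset.sum_mul]
      rw [Finset.sum_comm]
      refine Finset.sum_congr rfl fun l _ => Finset.sum_congr rfl fun i _ => ?_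
      ring)
    apply hγ
    funext i
    apply b.repr.injective
    ext k
    have h3 := ha (fun i => b.repr (γ i) k) (by
      rw [← h2 k]
      refine Finset.sum_congr rfl fun i _ => ?_
      rw [Algebra.smul_def, mul_comm]) i
    simpa using h3
  · apply hw
    funext l
    exact hσ w (by simpa [Algebra.smul_def] using h) l

end Compositum

lemma sum_pow_two_pow {R ι : Type*} [CommRing R] [Algebra (ZMod 2) R] (k : ℕ) (s : Finset ι)
    (f : ι → R) : (∑ i ∈ s, f i) ^ 2 ^ k = ∑ i ∈ s, f i ^ 2 ^ k := by
  rcases subsingleton_or_nontrivial R with h | h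
  · exact Subsingleton.elim _ _
  have : CharP R 2 := charP_of_injective_algebraMap (algebraMap (ZMod 2) R).injective 2
  have : ExpChar R 2 := inferInstance
  exact sum_pow_char_pow 2 k s f

lemma add_pow_two_pow {R : Type*} [CommRing R] [Algebra (ZMod 2) R] (k : ℕ) (f g : R) :
    (f + g) ^ 2 ^ k = f ^ 2 ^ k + g ^ 2 ^ k := by
  simpa using sum_pow_two_pow k Finset.univ ![f, g]

lemma sub_pow_two_pow {R : Type*} [CommRing R] [Algebra (ZMod 2) R] (k : ℕ) (f g : R) :
    (f - g) ^ 2 ^ k = f ^ 2 ^ k - g ^ 2 ^ k := by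
  rw [eq_sub_iff_add_eq, ← add_pow_two_pow, sub_add_cancel]

lemma algebraMap_pow_two_pow {R : Type*} [CommRing R] [Algebra (ZMod 2) R] (k : ℕ) (c : ZMod 2) :
    (algebraMap (ZMod 2) R c) ^ 2 ^ k = algebraMap (ZMod 2) R c := by
  rw [← map_pow, ZMod.pow_card_pow]

section Independence

variable [IsCFF K]

lemma prod_mem_L {ι : Type*} {M : Divisor (ZMod 2) K} (s : Finset ι) {f : ι → K}
    (hf : ∀ i ∈ s, f i ∈ L M) : ∏ i ∈ s, f i ∈ L (s.card • M) := by
  induction s using Finset.induction_on with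
  | empty => simpa using one_mem_L (K := K) le_rfl
  | insert i s hi ih =>
    rw [Finset.prod_insert hi, Finset.card_insert_of_notMem hi, add_comm, add_smul, one_smul]
    exact mul_mem_L (hf i (Finset.mem_insert_self _ _))
      (ih fun j hj => hf j (Finset.mem_insert_of_mem hj))

lemma det_mem_L {m : ℕ} {M : Divisor (ZMod 2) K} {B : Matrix (Fin m) (Fin m) K}
    (hB : ∀ i j, B i j ∈ L M) : B.det ∈ L (m • M) := by
  rw [Matrix.det_apply]
  refine sum_mem fun σ _ => ?_
  have h := prod_mem_L (M := M) Finset.univ (f := fun i => B (σ i) i) fun i _ => hB _ _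
  rw [Finset.card_univ, Fintype.card_fin] at h
  exact zsmul_mem h _

lemma smul_mem_L {D : Divisor (ZMod 2) K} {f : K} (c : ZMod 2) (hf : f ∈ L D) :
    f * algebraMap (ZMod 2) K c ∈ L D := by
  rcases zmod_two_cases c with rfl | rfl
  · simp
  · simpa using hf

/-- Elements of a Riemann–Roch space of small degree which are independent over the constants
are independent over the field of `2 ^ k`-th powers. -/
theorem eq_zero_of_sum_pow_mul_eq_zero {ι : Type*} [Fintype ι] {M : Divisor (ZMod 2) K} {k : ℕ}
    (hM : ddeg M < 2 ^ k) (p : Place (ZMod 2) K) (hp : M p = 0) {a : ι → K}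
    (haM : ∀ i, a i ∈ L M) (ha : LinearIndependent (ZMod 2) a) {c : ι → K}
    (hc : ∑ i, c i ^ 2 ^ k * a i = 0) : c = 0 := by
  by_contra hne
  obtain ⟨j, hj⟩ := Function.ne_iff.1 hne
  obtain ⟨i₀, hi₀, hmin⟩ := Finset.exists_min_image (Finset.univ.filter fun i => c i ≠ 0)
    (fun i => p.ord (c i)) ⟨j, by simpa using hj⟩
  simp only [Finset.mem_filter, Finset.mem_univ, true_and] at hi₀ hmin
  have hd : ∀ i, c i / c i₀ ∈ p.ring := by
    intro i
    by_cases h : c i = 0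
    · rw [h, zero_div]; exact p.ring.zero_mem
    · rw [p.mem_ring_iff (div_ne_zero h hi₀), p.ord_div h hi₀]
      linarith [hmin i h]
  let d : ι → p.ring := fun i => ⟨c i / c i₀, hd i⟩
  have hdsum : ∑ i, (d i : K) ^ 2 ^ k * a i = 0 := by
    have : ∑ i, (d i : K) ^ 2 ^ k * a i = (∑ i, c i ^ 2 ^ k * a i) / c i₀ ^ 2 ^ k := by
      rw [Finset.sum_div]
      refine Finset.sum_congr rfl fun i _ => ?_
      simp only [d, div_pow]
      ring
    rw [this, hc, zero_div]
  let : Algebra (ZMod 2) (IsLocalRing.ResidueField p.ring) := (residueHom (ZMod 2) p).toAlgebra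
  have : Module.Finite (ZMod 2) (IsLocalRing.ResidueField p.ring) := Module.Finite.of_finite
  obtain ⟨b, σ, hσ⟩ := exists_compositum (K := K) (IsLocalRing.ResidueField p.ring)
  have he : Module.finrank (ZMod 2) (IsLocalRing.ResidueField p.ring) = p.deg := rfl
  choose E hE using fun l => IsLocalRing.residue_surjective (b l)
  let γ : ι → IsLocalRing.ResidueField p.ring := fun i => IsLocalRing.residue p.ring (d i)
  have hγ : γ ≠ 0 := by
    intro h
    have h1 : d i₀ = 1 := Subtype.ext (div_self hi₀)
    have h2 := congrFun h i₀
    simp [γ, h1] at h2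
  have hdet := det_ne_zero_of_linearIndependent ha hγ b σ hσ
  set B : Matrix _ _ K :=
    Matrix.of fun k l => ∑ i, a i * algebraMap (ZMod 2) K (b.repr (γ i * b l) k) with hB
  have ha0 : ∀ i, a i ∈ p.pw 0 := fun i => by simpa [hp] using mem_L.1 (haM i) p
  have hBM : ∀ k l, B k l ∈ L M := fun k l => sum_mem fun i _ => smul_mem_L _ (haM i)
  have hBp : ∀ k l, B k l ∈ p.ring := fun k l => by
    rw [← p.mem_pw_zero]; simpa [hp] using mem_L.1 (hBM k l) p
  have happrox : ∀ i l, (d i : K) * E l -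
      ∑ r, algebraMap (ZMod 2) K (b.repr (γ i * b l) r) * (E r : K) ∈ p.pw 1 := by
    intro i l
    have h := (p.residue_eq_zero_iff (d i * E l -
      ∑ r, p.constants (b.repr (γ i * b l) r) * E r)).1 (by
        rw [map_sub, map_mul, hE, map_sum, sub_eq_zero]
        refine (b.sum_repr (γ i * b l)).symm.trans ?_
        refine Finset.sum_congr rfl fun r _ => ?_
        rw [map_mul (IsLocalRing.residue p.ring), hE, Algebra.smul_def]
        rfl)
    push_cast at h
    simpa only [Place.coe_constants] using h
  have hvec : ∀ l, Matrix.vecMul (fun r => (E r : K) ^ 2 ^ k) B l ∈ p.pw (2 ^ k) := by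
    intro l
    have h : Matrix.vecMul (fun r => (E r : K) ^ 2 ^ k) B l =
        - ∑ i, ((d i : K) * E l -
          ∑ r, algebraMap (ZMod 2) K (b.repr (γ i * b l) r) * (E r : K)) ^ 2 ^ k * a i := by
      simp only [sub_pow_two_pow, sum_pow_two_pow, mul_pow, algebraMap_pow_two_pow, sub_mul,
        Finset.sum_sub_distrib]
      have : ∑ i, (d i : K) ^ 2 ^ k * (E l : K) ^ 2 ^ k * a i = 0 := by
        rw [← mul_zero ((E l : K) ^ 2 ^ k), ← hdsum, Finset.mul_sum]
        refine Finset.sum_congr rfl fun i _ => ?_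
        ring
      rw [this, zero_sub, neg_neg]
      simp only [Matrix.vecMul, dotProduct, hB, Matrix.of_apply, Finset.mul_sum, Finset.sum_mul]
      rw [Finset.sum_comm]
      refine Finset.sum_congr rfl fun i _ => Finset.sum_congr rfl fun r _ => ?_
      ring
    rw [h]
    refine neg_mem (sum_mem fun i _ => ?_)
    have := p.mul_mem_pw (p.pow_mem_pw (happrox i l) (2 ^ k)) (ha0 i)
    simpa using this
  obtain ⟨B₀, hB₀⟩ : ∃ B₀ : Matrix _ _ p.ring, p.ring.subtype.mapMatrix B₀ = B :=
    ⟨Matrix.of fun k l => ⟨B k l, hBp k l⟩, rfl⟩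
  have hadj : ∀ i j, B.adjugate i j ∈ p.pw 0 := by
    intro i j
    rw [p.mem_pw_zero, ← hB₀, ← RingHom.map_adjugate]
    exact (B₀.adjugate i j).2
  have hdetE : ∀ r, B.det * (E r : K) ^ 2 ^ k ∈ p.pw (2 ^ k) := by
    intro r
    have h : B.det * (E r : K) ^ 2 ^ k =
        Matrix.vecMul (Matrix.vecMul (fun r => (E r : K) ^ 2 ^ k) B) B.adjugate r := by
      rw [Matrix.vecMul_vecMul, Matrix.mul_adjugate, Matrix.vecMul_smul, Matrix.vecMul_one]
      rfl
    rw [h]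
    rw [Matrix.vecMul, dotProduct]
    refine sum_mem fun l _ => ?_
    have := p.mul_mem_pw (hvec l) (hadj l r)
    simpa using this
  have hdetp : (2 ^ k : ℤ) ≤ p.ord B.det := by
    have hpos : 0 < Module.finrank (ZMod 2) (IsLocalRing.ResidueField p.ring) :=
      Module.finrank_pos
    let r : Fin (Module.finrank (ZMod 2) (IsLocalRing.ResidueField p.ring)) := ⟨0, hpos⟩
    have hE1 : (E r : K) ∉ p.pw 1 := by
      rw [← p.residue_eq_zero_iff, hE]
      exact b.ne_zero r
    have hE0 : (E r : K) ≠ 0 := fun h => hE1 (h ▸ zero_mem _)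
    rw [p.mem_pw_of_ne hE0] at hE1
    have hE2 := p.ord_nonneg (E r).2
    have := (p.mem_pw_of_ne (mul_ne_zero hdet (pow_ne_zero _ hE0))).1 (hdetE r)
    rw [p.ord_mul hdet (pow_ne_zero _ hE0), p.ord_pow, show p.ord (E r : K) = 0 by omega] at this
    simpa using this
  have hdetL : B.det ∈ L (p.deg • M - Finsupp.single p (2 ^ k)) := by
    have h := det_mem_L hBM
    rw [mem_L_of_ne hdet] at h ⊢
    intro P
    have h1 := h P
    by_cases hP : P = p
    · subst hP
      simp [hp, divf_apply] at h1 ⊢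
      exact hdetp
    · simpa [Finsupp.single_apply, Ne.symm hP, he] using h1
  have hdeg := ddeg_nonneg_of_mem_L hdet hdetL
  rw [ddeg_sub, ddeg_nsmul, ddeg_single] at hdeg
  have := p.deg_pos
  have h3 : (p.deg : ℤ) * (ddeg M - 2 ^ k) < 0 :=
    mul_neg_of_pos_of_neg (by exact_mod_cast this) (by linarith)
  nlinarith

end Independence

open Polynomial

/-- Evaluation of bivariate polynomials over the constants. -/
def evalXY {R : Type*} [CommRing R] [Algebra (ZMod 2) R] (x y : R) : (ZMod 2)[X][X] →+* R :=
  eval₂RingHom (aeval x : (ZMod 2)[X] →ₐ[ZMod 2] R).toRingHom y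

lemma evalXY_apply {R : Type*} [CommRing R] [Algebra (ZMod 2) R] (x y : R) (h : (ZMod 2)[X][X]) :
    evalXY x y h = eval₂ (aeval x : (ZMod 2)[X] →ₐ[ZMod 2] R).toRingHom y h := rfl

@[simp] lemma evalXY_C {R : Type*} [CommRing R] [Algebra (ZMod 2) R] (x y : R) (h : (ZMod 2)[X]) :
    evalXY x y (C h) = aeval x h := by
  simp [evalXY_apply]

@[simp] lemma evalXY_X {R : Type*} [CommRing R] [Algebra (ZMod 2) R] (x y : R) :
    evalXY x y X = y := by
  simp [evalXY_apply]

variable (K) in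
/-- A separable plane affine model of the function field. -/
structure PlaneModel where
  /-- the first coordinate -/
  x : K
  /-- the second coordinate -/
  y : K
  /-- the equation -/
  f : (ZMod 2)[X][X]
  transcendental_x : Transcendental (ZMod 2) x
  eval_f : evalXY x y f = 0
  natDegree_f : f.natDegree = degOver x
  eval_derivative_ne : evalXY x y (derivative f) ≠ 0
  exists_eq_div : ∀ z : K, ∃ a b, evalXY x y b ≠ 0 ∧ z = evalXY x y a / evalXY x y b
  linearIndependent : LinearIndependent (ZMod 2)
    (fun i : ℕ × Fin (degOver x) => x ^ i.1 * y ^ (i.2 : ℕ))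

section

variable [IsCFF K]

open IntermediateField

lemma exists_separating_transcendental : ∃ x : K, Transcendental (ZMod 2) x ∧
    Algebra.IsSeparable (adjoin (ZMod 2) ({x} : Set K)) K := by
  obtain ⟨s, hs, hsep⟩ := exists_isTranscendenceBasis_and_isSeparable_of_perfectField (ZMod 2) K
  obtain ⟨z, hz⟩ := exists_transcendental (K := K)
  have hcard := hs.cardinalMk_eq (isTranscendenceBasis_of_transcendental hz)
  rw [Cardinal.mk_coe_finset, Cardinal.mk_fintype, Fintype.card_unit, Nat.cast_inj,
    Finset.card_eq_one] at hcard
  obtain ⟨x, rfl⟩ := hcard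
  rw [Finset.coe_singleton] at hsep
  exact ⟨x, hs.1.transcendental ⟨x, Finset.mem_singleton_self x⟩, hsep⟩

lemma exists_clear_denominators {x : K} (P : (adjoin (ZMod 2) ({x} : Set K))[X]) :
    ∃ (D : (ZMod 2)[X]) (h : (ZMod 2)[X][X]), aeval x D ≠ 0 ∧
      h.map (aeval (AdjoinSimple.gen (ZMod 2) x) :
        (ZMod 2)[X] →ₐ[ZMod 2] adjoin (ZMod 2) ({x} : Set K)).toRingHom =
      C (aeval (AdjoinSimple.gen (ZMod 2) x) D) * P := by
  have hco : ∀ D : (ZMod 2)[X], ((aeval (AdjoinSimple.gen (ZMod 2) x) D :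
      adjoin (ZMod 2) ({x} : Set K)) : K) = aeval x D := by
    intro D
    have := aeval_algebraMap_apply K (AdjoinSimple.gen (ZMod 2) x) D
    exact this.symm
  induction P using Polynomial.induction_on' with
  | add P Q hP hQ =>
    obtain ⟨D, h, hD, hh⟩ := hP
    obtain ⟨D', h', hD', hh'⟩ := hQ
    refine ⟨D * D', C D' * h + C D * h', by rw [map_mul]; exact mul_ne_zero hD hD', ?_⟩
    rw [Polynomial.map_add, Polynomial.map_mul, Polynomial.map_mul, hh, hh']
    simp
    ring
  | monomial n c =>
    obtain ⟨r, s, hrs⟩ := (mem_adjoin_simple_iff (ZMod 2) (c : K)).1 c.2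
    by_cases hs : aeval x s = 0
    · refine ⟨1, 0, by simp, ?_⟩
      have : c = 0 := Subtype.ext (by rw [hrs, hs, div_zero]; rfl)
      simp [this]
    · refine ⟨s, monomial n r, hs, ?_⟩
      rw [map_monomial, C_mul_monomial]
      congr 1
      apply Subtype.ext
      rw [MulMemClass.coe_mul, hco, hrs]
      change ((aeval (AdjoinSimple.gen (ZMod 2) x) r : adjoin (ZMod 2) ({x} : Set K)) : K) = _
      rw [hco]
      field_simp

variable (K) in
lemma nonempty_planeModel : Nonempty (PlaneModel K) := by
  obtain ⟨x, hx, hsep⟩ := exists_separating_transcendental (K := K)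
  have := finiteDimensional_of_transcendental hx
  obtain ⟨y, hy⟩ := Field.exists_primitive_element (adjoin (ZMod 2) ({x} : Set K)) K
  let τ : (ZMod 2)[X] →+* adjoin (ZMod 2) ({x} : Set K) :=
    (aeval (AdjoinSimple.gen (ZMod 2) x) :
        (ZMod 2)[X] →ₐ[ZMod 2] adjoin (ZMod 2) ({x} : Set K)).toRingHom
  have hco : ∀ D : (ZMod 2)[X], ((τ D : adjoin (ZMod 2) ({x} : Set K)) : K) = aeval x D := by
    intro D
    have := aeval_algebraMap_apply K (AdjoinSimple.gen (ZMod 2) x) D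
    exact this.symm
  have hφ : ∀ h, evalXY x y h = aeval y (h.map τ) := by
    intro h
    rw [aeval_def, eval₂_map, evalXY_apply]
    congr 1
    ext D
    · exact (hco _).symm
    · exact (hco _).symm
  have hτinj : Function.Injective τ := by
    rw [injective_iff_map_eq_zero]
    intro D hD
    by_contra h0
    refine hx ⟨D, h0, ?_⟩
    rw [← hco, hD]; rfl
  have hint : IsIntegral (adjoin (ZMod 2) ({x} : Set K)) y := Algebra.IsIntegral.isIntegral y
  have hdeg : (minpoly (adjoin (ZMod 2) ({x} : Set K)) y).natDegree = degOver x :=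
    (Field.primitive_element_iff_minpoly_natDegree_eq _ y).1 hy
  obtain ⟨D, f, hD, hf⟩ := exists_clear_denominators (minpoly (adjoin (ZMod 2) ({x} : Set K)) y)
  have hD' : τ D ≠ 0 := fun h => hD (by rw [← hco, h]; rfl)
  change f.map τ = C (τ D) * _ at hf
  refine ⟨⟨x, y, f, hx, ?_, ?_, ?_, ?_, ?_⟩⟩
  · rw [hφ, hf, map_mul, minpoly.aeval, mul_zero]
  · rw [← hdeg, ← natDegree_map_eq_of_injective hτinj, hf, natDegree_C_mul hD']
  · rw [hφ, ← derivative_map, hf, derivative_C_mul, map_mul, aeval_C]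
    refine mul_ne_zero ?_ ?_
    · intro h
      exact hD' (Subtype.ext h)
    · exact (Algebra.IsSeparable.isSeparable _ y).aeval_derivative_ne_zero (minpoly.aeval _ _)
  · intro z
    obtain ⟨R, hR⟩ : ∃ R : (adjoin (ZMod 2) ({x} : Set K))[X], aeval y R = z := by
      have hz : z ∈ (adjoin (adjoin (ZMod 2) ({x} : Set K)) {y}).toSubalgebra := by
        rw [hy]; trivial
      rw [adjoin_simple_toSubalgebra_of_isAlgebraic hint.isAlgebraic,
        Algebra.adjoin_singleton_eq_range_aeval] at hz
      exact hz
    obtain ⟨E, h, hE, hh⟩ := exists_clear_denominators R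
    change h.map τ = C (τ E) * _ at hh
    refine ⟨h, C E, by simpa using hE, ?_⟩
    rw [evalXY_C, eq_div_iff hE, hφ, hh, map_mul, aeval_C, hR, mul_comm, ← hco]
    rfl
  · have h1 : LinearIndependent (ZMod 2)
        (fun n : ℕ => (AdjoinSimple.gen (ZMod 2) x) ^ n) := by
      have : LinearIndependent (ZMod 2) (fun n : ℕ => x ^ n) := by
        rw [linearIndependent_iff']
        intro s c hc i hi
        by_contra h0
        refine hx ⟨∑ j ∈ s, monomial j (c j), fun h => h0 ?_, ?_⟩
        · have := congrArg (fun P => coeff P i) h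
          simpa [finsetSum_coeff, coeff_monomial, hi] using this
        · rw [← hc, map_sum]
          refine Finset.sum_congr rfl fun j _ => ?_
          rw [aeval_monomial, Algebra.smul_def]
      exact LinearIndependent.of_comp (adjoin (ZMod 2) ({x} : Set K)).val.toLinearMap (by
        exact this)
    have h2 := linearIndependent_pow (K := adjoin (ZMod 2) ({x} : Set K)) y
    rw [hdeg] at h2
    have h3 := linearIndependent_smul h1 h2
    exact h3

end

lemma map_evalXY {R S : Type*} [CommRing R] [CommRing S] [Algebra (ZMod 2) R] [Algebra (ZMod 2) S]
    (θ : R →+* S) (x y : R) (h : (ZMod 2)[X][X]) :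
    θ (evalXY x y h) = evalXY (θ x) (θ y) h := by
  have : θ.comp (evalXY x y) = evalXY (θ x) (θ y) := by
    apply Polynomial.ringHom_ext
    · intro D
      simp only [RingHom.comp_apply, evalXY_C]
      have : (θ.comp (aeval x : (ZMod 2)[X] →ₐ[ZMod 2] R).toRingHom) =
          (aeval (θ x) : (ZMod 2)[X] →ₐ[ZMod 2] S).toRingHom := by
        apply Polynomial.ringHom_ext
        · intro c
          rcases zmod_two_cases c with rfl | rfl <;> simp
        · simp
      exact RingHom.congr_fun this D
    · simp
  exact RingHom.congr_fun this h

open IntermediateField in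
/-- A point of a plane curve at which the curve is étale over the line is cut out, locally, by
the equation of the curve and a separable polynomial in the first coordinate. -/
lemma exists_mul_eq_of_evalXY_eq_zero {κ : Type*} [Field κ] [Finite κ] [Algebra (ZMod 2) κ]
    {ξ η : κ} {f h : (ZMod 2)[X][X]} {P : (ZMod 2)[X]} (hf : evalXY ξ η f = 0)
    (hf' : evalXY ξ η (derivative f) ≠ 0) (hP : aeval ξ P = 0) (hP' : aeval ξ (derivative P) ≠ 0)
    (hh : evalXY ξ η h = 0) :
    ∃ w m c, evalXY ξ η w ≠ 0 ∧ h * w = C P * m + f * c := by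
  have : Module.Finite (ZMod 2) κ := Module.Finite.of_finite
  have hξ : IsIntegral (ZMod 2) ξ := Algebra.IsIntegral.isIntegral ξ
  let τ : (ZMod 2)[X] →+* adjoin (ZMod 2) ({ξ} : Set κ) :=
    (aeval (AdjoinSimple.gen (ZMod 2) ξ) :
      (ZMod 2)[X] →ₐ[ZMod 2] adjoin (ZMod 2) ({ξ} : Set κ)).toRingHom
  have hco : ∀ D : (ZMod 2)[X], ((τ D : adjoin (ZMod 2) ({ξ} : Set κ)) : κ) = aeval ξ D := by
    intro D
    have := aeval_algebraMap_apply κ (AdjoinSimple.gen (ZMod 2) ξ) D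
    exact this.symm
  have hψ : ∀ h, evalXY ξ η h = aeval η (h.map τ) := by
    intro h
    rw [aeval_def, eval₂_map, evalXY_apply]
    congr 1
    ext D
    · exact (hco _).symm
    · exact (hco _).symm
  have hτsurj : Function.Surjective τ := by
    rintro ⟨z, hz⟩
    have hz' : z ∈ (adjoin (ZMod 2) ({ξ} : Set κ)).toSubalgebra := hz
    rw [adjoin_simple_toSubalgebra_of_isAlgebraic hξ.isAlgebraic,
      Algebra.adjoin_singleton_eq_range_aeval] at hz'
    obtain ⟨D, hD⟩ := hz'
    exact ⟨D, Subtype.ext ((hco D).trans hD)⟩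
  rw [hψ] at hf hh
  obtain ⟨k₁, hk₁⟩ := minpoly.dvd (adjoin (ZMod 2) ({ξ} : Set κ)) η hh
  obtain ⟨k₂, hk₂⟩ := minpoly.dvd (adjoin (ZMod 2) ({ξ} : Set κ)) η hf
  obtain ⟨K₁, rfl⟩ := Polynomial.map_surjective τ hτsurj k₁
  obtain ⟨K₂, rfl⟩ := Polynomial.map_surjective τ hτsurj k₂
  have hK₂ : evalXY ξ η K₂ ≠ 0 := by
    intro h0
    rw [hψ] at h0
    apply hf'
    rw [hψ, ← derivative_map, hk₂, derivative_mul, map_add, map_mul, map_mul, minpoly.aeval, h0]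
    simp
  have hmap : (h * K₂ - f * K₁).map τ = 0 := by
    rw [Polynomial.map_sub, Polynomial.map_mul, Polynomial.map_mul, hk₁, hk₂]
    ring
  have hdvd : C (minpoly (ZMod 2) ξ) ∣ h * K₂ - f * K₁ := by
    rw [C_dvd_iff_dvd_coeff]
    intro i
    apply minpoly.dvd
    rw [← hco, ← coeff_map, hmap]
    simp
  obtain ⟨m, hm⟩ := hdvd
  obtain ⟨s, hs⟩ := minpoly.dvd (ZMod 2) ξ hP
  have hsξ : aeval ξ s ≠ 0 := by
    intro h0
    apply hP'
    rw [hs, derivative_mul, map_add, map_mul, map_mul, minpoly.aeval, h0]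
    simp
  refine ⟨K₂ * C s, m, K₁ * C s, ?_, ?_⟩
  · rw [map_mul, evalXY_C]
    exact mul_ne_zero hK₂ hsξ
  · rw [hs, C_mul]
    linear_combination C s * hm

section Place

variable (p : Place (ZMod 2) K)

instance Place.algebraRing : Algebra (ZMod 2) p.ring := p.constants.toAlgebra

lemma Place.evalXY_mem {x y : K} (hx : x ∈ p.ring) (hy : y ∈ p.ring) (h : (ZMod 2)[X][X]) :
    evalXY x y h = ((evalXY (⟨x, hx⟩ : p.ring) ⟨y, hy⟩ h : p.ring) : K) :=
  (map_evalXY p.ring.subtype ⟨x, hx⟩ ⟨y, hy⟩ h).symm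

variable [IsCFF K]

lemma Place.evalXY_residue {x y : K} (hx : x ∈ p.ring) (hy : y ∈ p.ring) (h : (ZMod 2)[X][X]) :
    evalXY (IsLocalRing.residue p.ring ⟨x, hx⟩) (IsLocalRing.residue p.ring ⟨y, hy⟩) h = 0 ↔
      evalXY x y h ∈ p.pw 1 := by
  rw [← map_evalXY, p.residue_eq_zero_iff, ← p.evalXY_mem]

lemma Place.ord_eq_zero {z : K} (hz : z ∈ p.ring) (h1 : z ∉ p.pw 1) : p.ord z = 0 := by
  have h0 : z ≠ 0 := fun h => h1 (h ▸ zero_mem _)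
  have := p.ord_nonneg hz
  rw [p.mem_pw_of_ne h0] at h1
  omega

end Place

section Model

variable [IsCFF K] (M : PlaneModel K)

/-- Evaluation at the generic point. -/
def PlaneModel.φ : (ZMod 2)[X][X] →+* K := evalXY M.x M.y

/-- Places centred at points at which the model is étale over the line. -/
def PlaneModel.Good (p : Place (ZMod 2) K) : Prop :=
  M.x ∈ p.ring ∧ M.y ∈ p.ring ∧ M.φ (derivative M.f) ∉ p.pw 1

variable {M} {p : Place (ZMod 2) K} {n : ℕ}

lemma PlaneModel.Good.φ_mem (hp : M.Good p) (h : (ZMod 2)[X][X]) : M.φ h ∈ p.ring := by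
  rw [PlaneModel.φ, p.evalXY_mem hp.1 hp.2.1]
  exact Subtype.prop _

lemma PlaneModel.Good.exists_mul_eq (hp : M.Good p) (hn : 1 ≤ n) (hx : M.x ^ 2 ^ n - M.x ∈ p.pw 1)
    {h : (ZMod 2)[X][X]} (hh : M.φ h ∈ p.pw 1) :
    ∃ w m, M.φ w ∉ p.pw 1 ∧ M.φ h * M.φ w = (M.x ^ 2 ^ n - M.x) * M.φ m := by
  obtain ⟨w, m, c, hw, he⟩ := exists_mul_eq_of_evalXY_eq_zero
    (ξ := IsLocalRing.residue p.ring ⟨M.x, hp.1⟩) (η := IsLocalRing.residue p.ring ⟨M.y, hp.2.1⟩)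
    (f := M.f) (h := h) (P := X ^ 2 ^ n - X)
    ((p.evalXY_residue hp.1 hp.2.1 _).2 (by rw [M.eval_f]; exact zero_mem _))
    (fun h => hp.2.2 ((p.evalXY_residue hp.1 hp.2.1 _).1 h))
    (by
      have := (p.evalXY_residue hp.1 hp.2.1 (C (X ^ 2 ^ n - X))).2 (by simpa using hx)
      rwa [evalXY_C] at this)
    (by
      have : ((2 ^ n : ℕ) : (ZMod 2)[X]) = 0 := by
        rw [Nat.cast_pow, show ((2 : ℕ) : (ZMod 2)[X]) = 0 from CharP.cast_eq_zero _ 2,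
          zero_pow (by omega)]
      rw [derivative_sub, derivative_X_pow, derivative_X]
      simp only [C_eq_natCast, this]
      simp)
    ((p.evalXY_residue hp.1 hp.2.1 _).2 hh)
  refine ⟨w, m, fun h => hw ((p.evalXY_residue hp.1 hp.2.1 _).2 h), ?_⟩
  have := congrArg M.φ he
  rw [map_mul, map_add, map_mul, map_mul, PlaneModel.φ, M.eval_f, zero_mul, add_zero,
    evalXY_C] at this
  simpa [PlaneModel.φ] using this

lemma PlaneModel.Good.exists_eq_pow_mul (hp : M.Good p) (hn : 1 ≤ n) (hx : M.x ^ 2 ^ n - M.x ∈ p.pw 1)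
    (N : ℕ) : ∀ h : (ZMod 2)[X][X], M.φ h ≠ 0 →
    p.ord (M.φ h) ≤ N → ∃ (s : ℕ) (h₁ h₂ : (ZMod 2)[X][X]), M.φ h₁ ∉ p.pw 1 ∧ M.φ h₂ ∉ p.pw 1 ∧
      M.φ h * M.φ h₂ = (M.x ^ 2 ^ n - M.x) ^ s * M.φ h₁ := by
  have h1 : M.φ 1 ∉ p.pw 1 := by
    rw [map_one, p.mem_pw_of_ne one_ne_zero, p.ord_one]
    norm_num
  have hτ : M.x ^ 2 ^ n - M.x ≠ 0 :=
    pow_sub_self_ne_zero M.transcendental_x (Nat.one_lt_two_pow (by omega))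
  have hτ1 := (p.mem_pw_of_ne hτ).1 hx
  induction N with
  | zero =>
    intro h h0 hN
    refine ⟨0, h, 1, ?_, h1, by simp⟩
    rw [p.mem_pw_of_ne h0]
    push_cast at hN
    omega
  | succ N ih =>
    intro h h0 hN
    by_cases hh : M.φ h ∈ p.pw 1
    · obtain ⟨w, m, hw, he⟩ := hp.exists_mul_eq hn hx hh
      have hw0 : M.φ w ≠ 0 := fun h => hw (h ▸ zero_mem _)
      have hm0 : M.φ m ≠ 0 := by
        intro hm
        rw [hm, mul_zero] at he
        exact mul_ne_zero h0 hw0 he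
      have hord := congrArg p.ord he
      rw [p.ord_mul h0 hw0, p.ord_mul hτ hm0, p.ord_eq_zero (hp.φ_mem w) hw] at hord
      obtain ⟨s, h₁, h₂, hh₁, hh₂, he2⟩ := ih m hm0 (by push_cast at hN; omega)
      refine ⟨s + 1, h₁, w * h₂, hh₁, ?_, ?_⟩
      · have hh20 : M.φ h₂ ≠ 0 := fun h => hh₂ (h ▸ zero_mem _)
        rw [map_mul, p.mem_pw_of_ne (mul_ne_zero hw0 hh20), p.ord_mul hw0 hh20,
          p.ord_eq_zero (hp.φ_mem w) hw, p.ord_eq_zero (hp.φ_mem h₂) hh₂]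
        norm_num
      · rw [map_mul, ← mul_assoc, he, mul_assoc, he2]
        ring
    · exact ⟨0, h, 1, hh, h1, by simp⟩

lemma PlaneModel.Good.exists_zpow (hp : M.Good p) (hn : 1 ≤ n) (hx : M.x ^ 2 ^ n - M.x ∈ p.pw 1)
    {z : K} (hz : z ≠ 0) : ∃ (s : ℤ) (a b : (ZMod 2)[X][X]),
    M.φ a ∉ p.pw 1 ∧ M.φ b ∉ p.pw 1 ∧ z * M.φ b = (M.x ^ 2 ^ n - M.x) ^ s * M.φ a := by
  have hτ : M.x ^ 2 ^ n - M.x ≠ 0 :=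
    pow_sub_self_ne_zero M.transcendental_x (Nat.one_lt_two_pow (by omega))
  have hmul : ∀ a b, M.φ a ∉ p.pw 1 → M.φ b ∉ p.pw 1 → M.φ (a * b) ∉ p.pw 1 := by
    intro a b ha hb
    have ha0 : M.φ a ≠ 0 := fun h => ha (h ▸ zero_mem _)
    have hb0 : M.φ b ≠ 0 := fun h => hb (h ▸ zero_mem _)
    rw [map_mul, p.mem_pw_of_ne (mul_ne_zero ha0 hb0), p.ord_mul ha0 hb0,
      p.ord_eq_zero (hp.φ_mem a) ha, p.ord_eq_zero (hp.φ_mem b) hb]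
    norm_num
  obtain ⟨a, b, hb, hab⟩ := M.exists_eq_div z
  change M.φ b ≠ 0 at hb
  change z = M.φ a / M.φ b at hab
  have ha : M.φ a ≠ 0 := by
    intro h
    rw [h, zero_div] at hab
    exact hz hab
  obtain ⟨s, a₁, a₂, ha₁, ha₂, hae⟩ := hp.exists_eq_pow_mul hn hx (p.ord (M.φ a)).toNat a ha
    (Int.self_le_toNat _)
  obtain ⟨t, b₁, b₂, hb₁, hb₂, hbe⟩ := hp.exists_eq_pow_mul hn hx (p.ord (M.φ b)).toNat b hb
    (Int.self_le_toNat _)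
  refine ⟨s - t, a₁ * b₂, b₁ * a₂, hmul _ _ ha₁ hb₂, hmul _ _ hb₁ ha₂, ?_⟩
  rw [zpow_sub₀ hτ, zpow_natCast, zpow_natCast, map_mul, map_mul, hab]
  have := pow_ne_zero t hτ
  field_simp
  linear_combination M.φ b₁ * (M.x ^ 2 ^ n - M.x) ^ t * hae - (M.x ^ 2 ^ n - M.x) ^ s * M.φ a₁ * hbe

lemma PlaneModel.Good.ord_pow_sub (hp : M.Good p) (hn : 1 ≤ n) (hx : M.x ^ 2 ^ n - M.x ∈ p.pw 1) :
    p.ord (M.x ^ 2 ^ n - M.x) = 1 := by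
  have hτ : M.x ^ 2 ^ n - M.x ≠ 0 :=
    pow_sub_self_ne_zero M.transcendental_x (Nat.one_lt_two_pow (by omega))
  have hτ1 := (p.mem_pw_of_ne hτ).1 hx
  obtain ⟨s, a, b, ha, hb, he⟩ := hp.exists_zpow hn hx p.unif_ne_zero
  have ha0 : M.φ a ≠ 0 := fun h => ha (h ▸ zero_mem _)
  have hb0 : M.φ b ≠ 0 := fun h => hb (h ▸ zero_mem _)
  have := congrArg p.ord he
  rw [p.ord_mul p.unif_ne_zero hb0, p.ord_mul (zpow_ne_zero _ hτ) ha0, p.ord_zpow, p.ord_unif,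
    p.ord_eq_zero (hp.φ_mem a) ha, p.ord_eq_zero (hp.φ_mem b) hb, add_zero, add_zero] at this
  have h2 := Int.eq_one_or_neg_one_of_mul_eq_one' this.symm
  omega

lemma PlaneModel.Good.deg_dvd (hp : M.Good p) (hn : 1 ≤ n) (hx : M.x ^ 2 ^ n - M.x ∈ p.pw 1)
    (hy : M.y ^ 2 ^ n - M.y ∈ p.pw 1) : p.deg ∣ n := by
  have hτ : M.x ^ 2 ^ n - M.x ≠ 0 :=
    pow_sub_self_ne_zero M.transcendental_x (Nat.one_lt_two_pow (by omega))
  set ξ := IsLocalRing.residue p.ring ⟨M.x, hp.1⟩ with hξ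
  set η := IsLocalRing.residue p.ring ⟨M.y, hp.2.1⟩ with hη
  have hξn : ξ ^ 2 ^ n = ξ := by
    rw [hξ, ← map_pow, ← sub_eq_zero, ← map_sub, p.residue_eq_zero_iff]
    exact hx
  have hηn : η ^ 2 ^ n = η := by
    rw [hη, ← map_pow, ← sub_eq_zero, ← map_sub, p.residue_eq_zero_iff]
    exact hy
  have : CharP (IsLocalRing.ResidueField p.ring) 2 :=
    charP_of_injective_algebraMap (algebraMap (ZMod 2) _).injective 2
  have hfrob : ∀ h, evalXY ξ η h ^ 2 ^ n = evalXY ξ η h := by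
    intro h
    have := map_evalXY (iterateFrobenius (IsLocalRing.ResidueField p.ring) 2 n) ξ η h
    simpa only [iterateFrobenius_def, hξn, hηn] using this
  have hres : ∀ h, evalXY ξ η h = IsLocalRing.residue p.ring ⟨M.φ h, hp.φ_mem h⟩ := by
    intro h
    rw [← map_evalXY]
    congr 1
    exact Subtype.ext (p.evalXY_mem hp.1 hp.2.1 h).symm
  have hall : ∀ u : (IsLocalRing.ResidueField p.ring)ˣ, u ^ (2 ^ n - 1) = 1 := by
    intro u
    obtain ⟨z, hz⟩ := IsLocalRing.residue_surjective (u : IsLocalRing.ResidueField p.ring)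
    have hz1 : (z : K) ∉ p.pw 1 := by
      rw [← p.residue_eq_zero_iff, hz]
      exact u.ne_zero
    have hz0 : (z : K) ≠ 0 := fun h => hz1 (h ▸ zero_mem _)
    obtain ⟨s, a, b, ha, hb, he⟩ := hp.exists_zpow hn hx hz0
    have ha0 : M.φ a ≠ 0 := fun h => ha (h ▸ zero_mem _)
    have hb0 : M.φ b ≠ 0 := fun h => hb (h ▸ zero_mem _)
    have hord := congrArg p.ord he
    rw [p.ord_mul hz0 hb0, p.ord_mul (zpow_ne_zero _ hτ) ha0, p.ord_zpow,
      p.ord_eq_zero (hp.φ_mem a) ha, p.ord_eq_zero (hp.φ_mem b) hb, p.ord_eq_zero z.2 hz1,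
      hp.ord_pow_sub hn hx] at hord
    obtain rfl : s = 0 := by omega
    rw [zpow_zero, one_mul] at he
    have he2 : (u : IsLocalRing.ResidueField p.ring) * evalXY ξ η b = evalXY ξ η a := by
      rw [hres, hres, ← hz, ← map_mul]
      congr 1
      exact Subtype.ext he
    have hb2 : evalXY ξ η b ≠ 0 := fun h => hb ((p.evalXY_residue hp.1 hp.2.1 b).1 h)
    have hu : (u : IsLocalRing.ResidueField p.ring) ^ 2 ^ n = u := by
      apply mul_right_cancel₀ hb2
      conv_lhs => rw [← hfrob b, ← mul_pow, he2, hfrob]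
      exact he2.symm
    apply Units.ext
    apply mul_right_cancel₀ u.ne_zero
    rw [Units.val_pow_eq_pow_val, ← pow_succ, Nat.sub_add_cancel Nat.one_le_two_pow, hu]
    simp
  have := Fintype.ofFinite (IsLocalRing.ResidueField p.ring)
  have hdvd := (FiniteField.forall_pow_eq_one_iff _ _).1 hall
  rw [← Nat.card_eq_fintype_card, p.card_residueField] at hdvd
  have hg := Nat.pow_sub_one_gcd_pow_sub_one 2 p.deg n
  rw [Nat.gcd_eq_left hdvd] at hg
  have h1 : 2 ^ p.deg = 2 ^ Nat.gcd p.deg n := by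
    have := Nat.one_le_two_pow (n := p.deg)
    have := Nat.one_le_two_pow (n := Nat.gcd p.deg n)
    omega
  exact Nat.gcd_eq_left_iff_dvd.1 (Nat.pow_right_injective le_rfl h1).symm

end Model

section Zeros

variable [IsCFF K]

lemma Place.ord_pow_sub_le_of_neg (p : Place (ZMod 2) K) {x : K} (hx : p.ord x < 0) {q : ℕ}
    (hq : 1 < q) (hτ : x ^ q - x ≠ 0) : p.ord (x ^ q - x) ≤ q * p.ord x := by
  have hx0 : x ≠ 0 := by rintro rfl; simp at hx
  have h := p.le_ord_add (f := x ^ q - x) (g := x) (by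
    rw [sub_add_cancel]; exact pow_ne_zero _ hx0)
  rw [sub_add_cancel, p.ord_pow] at h
  rcases min_le_iff.1 h with h | h
  · exact h
  · have : (2 : ℤ) ≤ q := by exact_mod_cast hq
    nlinarith

lemma Place.mem_ring_of_pow_sub_mem (p : Place (ZMod 2) K) {x : K} {q : ℕ} (hq : 1 < q)
    (h : x ^ q - x ∈ p.pw 1) : x ∈ p.ring := by
  by_cases hx0 : x = 0
  · rw [hx0]; exact p.ring.zero_mem
  rw [p.mem_ring_iff hx0]
  by_contra! hneg
  by_cases hτ : x ^ q - x = 0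
  · have := congrArg p.ord (sub_eq_zero.1 hτ)
    rw [p.ord_pow] at this
    have : (2 : ℤ) ≤ q := by exact_mod_cast hq
    nlinarith
  · have h1 := p.ord_pow_sub_le_of_neg hneg hq hτ
    rw [p.mem_pw_of_ne hτ] at h
    have : (2 : ℤ) ≤ q := by exact_mod_cast hq
    nlinarith

lemma aeval_X_pow_sub_derivative {R : Type*} [CommRing R] [Algebra (ZMod 2) R] (ξ : R) {n : ℕ}
    (hn : 1 ≤ n) : aeval ξ (derivative (X ^ 2 ^ n - X : (ZMod 2)[X])) = -1 := by
  have : ((2 ^ n : ℕ) : (ZMod 2)[X]) = 0 := by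
    rw [Nat.cast_pow, show ((2 : ℕ) : (ZMod 2)[X]) = 0 from CharP.cast_eq_zero _ 2,
      zero_pow (by omega)]
  rw [derivative_sub, derivative_X_pow, derivative_X]
  simp only [C_eq_natCast, this]
  simp

lemma Place.exists_ord_pow_sub_le (p : Place (ZMod 2) K) {x : K}
    (hx : Transcendental (ZMod 2) x) :
    ∃ b : ℕ, ∀ n, 1 ≤ n → x ^ 2 ^ n - x ∈ p.pw 1 → p.ord (x ^ 2 ^ n - x) ≤ b := by
  by_cases hxr : x ∈ p.ring
  · have : Module.Finite (ZMod 2) (IsLocalRing.ResidueField p.ring) := Module.Finite.of_finite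
    set ξ := IsLocalRing.residue p.ring ⟨x, hxr⟩ with hξ
    have hev : ∀ D : (ZMod 2)[X], aeval ξ D = 0 ↔ aeval x D ∈ p.pw 1 := by
      intro D
      have := p.evalXY_residue hxr hxr (C D)
      rwa [evalXY_C, evalXY_C] at this
    have hmem : ∀ D : (ZMod 2)[X], aeval x D ∈ p.ring := by
      intro D
      have := p.evalXY_mem hxr hxr (C D)
      rw [evalXY_C] at this
      rw [this]
      exact Subtype.prop _
    refine ⟨(p.ord (aeval x (minpoly (ZMod 2) ξ))).toNat, fun n hn h => ?_⟩
    have hτ : x ^ 2 ^ n - x ≠ 0 := pow_sub_self_ne_zero hx (Nat.one_lt_two_pow (by omega))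
    have hτe : aeval x (X ^ 2 ^ n - X : (ZMod 2)[X]) = x ^ 2 ^ n - x := by simp
    obtain ⟨s, hs⟩ := minpoly.dvd (ZMod 2) ξ (p := X ^ 2 ^ n - X) (by rw [hev, hτe]; exact h)
    have hsξ : aeval ξ s ≠ 0 := by
      intro h0
      have := aeval_X_pow_sub_derivative ξ hn
      rw [hs, derivative_mul, map_add, map_mul, map_mul, minpoly.aeval, h0] at this
      simp at this
    have he : x ^ 2 ^ n - x = aeval x (minpoly (ZMod 2) ξ) * aeval x s := by
      rw [← hτe, hs, map_mul]
    rw [Ne, hev] at hsξ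
    have hs0 : aeval x s ≠ 0 := fun h => hsξ (h ▸ zero_mem _)
    have hm0 : aeval x (minpoly (ZMod 2) ξ) ≠ 0 := by
      intro h0
      rw [h0, zero_mul] at he
      exact hτ he
    rw [he, p.ord_mul hm0 hs0, p.ord_eq_zero (hmem s) hsξ, add_zero]
    exact Int.self_le_toNat _
  · refine ⟨0, fun n hn h => ?_⟩
    exact absurd (p.mem_ring_of_pow_sub_mem (Nat.one_lt_two_pow (by omega)) h) hxr

lemma transcendental_pow_sub {x : K} (hx : Transcendental (ZMod 2) x) {q : ℕ} (hq : 1 < q) :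
    Transcendental (ZMod 2) (x ^ q - x) := by
  have hd : (X ^ q - X : (ZMod 2)[X]).natDegree = q :=
    FiniteField.X_pow_card_sub_X_natDegree_eq _ hq
  have h := hx.aeval (X ^ q - X : (ZMod 2)[X]) (by omega) (mem_nonZeroDivisors_of_ne_zero
    (leadingCoeff_ne_zero.2 (FiniteField.X_pow_card_sub_X_ne_zero _ hq)))
  simpa using h

lemma mul_degOver_le_sum_zeros {x : K} (hx : Transcendental (ZMod 2) x) {q : ℕ} (hq : 1 < q)
    {Z : Finset (Place (ZMod 2) K)} (hZ : ∀ p, x ^ q - x ∈ p.pw 1 → p ∈ Z) :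
    (q * degOver x : ℤ) ≤ ∑ p ∈ Z, max (p.ord (x ^ q - x)) 0 * p.deg := by
  have hτ := pow_sub_self_ne_zero hx hq
  have htr := transcendental_pow_sub hx hq
  have h1 : (q * degOver x : ℤ) ≤ degOver (x ^ q - x) := by
    rw [← ddeg_poleDiv hx, ← ddeg_poleDiv htr, ← ddeg_nsmul]
    refine ddeg_mono fun p => ?_
    rw [Finsupp.smul_apply, poleDiv_apply, poleDiv_apply, nsmul_eq_mul]
    rcases lt_or_ge (p.ord x) 0 with h | h
    · have := p.ord_pow_sub_le_of_neg h hq hτ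
      rw [max_eq_left (by omega)]
      exact le_max_of_le_left (by linarith)
    · rw [max_eq_right (by omega), mul_zero]
      exact le_max_right _ _
  refine h1.trans (le_of_eq ?_)
  rw [← degOver_inv, ← ddeg_poleDiv (transcendental_inv htr), ddeg_eq_sum_of_subset (S := Z)]
  · refine Finset.sum_congr rfl fun p _ => ?_
    rw [poleDiv_apply, p.ord_inv, neg_neg]
  · intro p hp
    rw [Finsupp.mem_support_iff, poleDiv_apply, p.ord_inv, neg_neg] at hp
    apply hZ
    rw [p.mem_pw_of_ne hτ]
    by_contra! h
    exact hp (max_eq_right (by omega))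

lemma PlaneModel.finite_not_good (M : PlaneModel K) : {p | ¬ M.Good p}.Finite := by
  have hd : M.φ (derivative M.f) ≠ 0 := M.eval_derivative_ne
  refine (((finite_ord_ne_zero M.x).union (finite_ord_ne_zero M.y)).union
    (finite_ord_ne_zero (M.φ (derivative M.f)))).subset fun p hp => ?_
  by_contra! h
  simp only [Set.mem_union, Set.mem_ofPred_eq, not_or, not_not] at h
  have hr : ∀ z : K, p.ord z = 0 → z ∈ p.ring := by
    intro z hz
    by_cases h0 : z = 0
    · rw [h0]; exact p.ring.zero_mem
    · rw [p.mem_ring_iff h0, hz]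
  refine hp ⟨hr _ h.1.1, hr _ h.1.2, ?_⟩
  rw [p.mem_pw_of_ne hd, h.2]
  norm_num

lemma PlaneModel.finite_zeros (M : PlaneModel K) {n : ℕ} (hn : 1 ≤ n) :
    {p : Place (ZMod 2) K | M.x ^ 2 ^ n - M.x ∈ p.pw 1}.Finite := by
  refine (finite_ord_ne_zero (M.x ^ 2 ^ n - M.x)).subset fun p hp => ?_
  have hτ := pow_sub_self_ne_zero M.transcendental_x (Nat.one_lt_two_pow (n := n) (by omega))
  have := (p.mem_pw_of_ne hτ).1 hp
  simp only [Set.mem_ofPred_eq]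
  omega

/-- The good places at which the first coordinate is rational over the field of `2 ^ n`
elements. -/
def PlaneModel.zeros (M : PlaneModel K) (n : ℕ) : Finset (Place (ZMod 2) K) :=
  if h : 1 ≤ n then (M.finite_zeros h).toFinset.filter M.Good else ∅

lemma PlaneModel.mem_zeros (M : PlaneModel K) {n : ℕ} (hn : 1 ≤ n) {p : Place (ZMod 2) K} :
    p ∈ M.zeros n ↔ M.x ^ 2 ^ n - M.x ∈ p.pw 1 ∧ M.Good p := by
  simp [PlaneModel.zeros, hn]

lemma PlaneModel.exists_le_sum_zeros (M : PlaneModel K) : ∃ c : ℕ, ∀ n, 1 ≤ n →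
    2 ^ n * degOver M.x ≤ ∑ p ∈ M.zeros n, p.deg + c := by
  choose b hb using fun p : Place (ZMod 2) K => p.exists_ord_pow_sub_le M.transcendental_x
  refine ⟨∑ p ∈ M.finite_not_good.toFinset, b p * p.deg, fun n hn => ?_⟩
  have hq : 1 < 2 ^ n := Nat.one_lt_two_pow (by omega)
  have hτ := pow_sub_self_ne_zero M.transcendental_x hq
  have h := mul_degOver_le_sum_zeros M.transcendental_x hq
    (Z := M.zeros n ∪ M.finite_not_good.toFinset) (fun p hp => by
      rw [Finset.mem_union, M.mem_zeros hn, Set.Finite.mem_toFinset]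
      by_cases hg : M.Good p
      · exact Or.inl ⟨hp, hg⟩
      · exact Or.inr hg)
  have hdisj : Disjoint (M.zeros n) M.finite_not_good.toFinset := by
    rw [Finset.disjoint_left]
    intro p hp hp'
    rw [Set.Finite.mem_toFinset] at hp'
    exact hp' ((M.mem_zeros hn).1 hp).2
  rw [Finset.sum_union hdisj] at h
  zify
  push_cast at h ⊢
  refine h.trans (add_le_add ?_ ?_)
  · refine Finset.sum_le_sum fun p hp => ?_
    obtain ⟨h1, h2⟩ := (M.mem_zeros hn).1 hp
    rw [h2.ord_pow_sub hn h1]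
    simp
  · refine Finset.sum_le_sum fun p _ => ?_
    refine mul_le_mul_of_nonneg_right ?_ (by positivity)
    by_cases h1 : M.x ^ 2 ^ n - M.x ∈ p.pw 1
    · exact max_le (hb p n hn h1) (by positivity)
    · rw [p.mem_pw_of_ne hτ] at h1
      rw [max_eq_right (by omega)]
      positivity

end Zeros

section Stepanov

variable [IsCFF K]

/-- The conjugates of the second coordinate of a plane model other than the coordinate itself are
the roots of a polynomial over the function field. -/
lemma PlaneModel.exists_cofactor (M : PlaneModel K) {e : ℕ} (he : degOver M.x = e + 1) :
    ∃ (v : K) (r : Fin e → K), v ≠ 0 ∧ ∀ z : K, evalXY M.x z M.f =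
      v * (z - M.y) * (∑ j : Fin e, r j * z ^ (j : ℕ) + z ^ e) := by
  let τ : (ZMod 2)[X] →+* K := (aeval M.x : (ZMod 2)[X] →ₐ[ZMod 2] K).toRingHom
  have hτ : Function.Injective τ := transcendental_iff_injective.1 M.transcendental_x
  have hev : ∀ z : K, (M.f.map τ).eval z = evalXY M.x z M.f := by
    intro z
    rw [eval_map, evalXY_apply]
  have hdeg : (M.f.map τ).natDegree = e + 1 := by
    rw [natDegree_map_eq_of_injective hτ, M.natDegree_f, he]
  have hroot : (M.f.map τ).IsRoot M.y := by
    rw [IsRoot, hev, M.eval_f]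
  set G := M.f.map τ /ₘ (X - C M.y) with hG
  have hmul : (X - C M.y) * G = M.f.map τ := mul_divByMonic_eq_iff_isRoot.2 hroot
  have hGdeg : G.natDegree = e := by
    rw [hG, natDegree_divByMonic _ (monic_X_sub_C _), hdeg, natDegree_X_sub_C]
    rfl
  have hG0 : G ≠ 0 := by
    intro h0
    rw [h0, mul_zero] at hmul
    rw [← hmul] at hdeg
    simp at hdeg
  have hv : G.coeff e ≠ 0 := by
    rw [← hGdeg]
    exact leadingCoeff_ne_zero.2 hG0
  refine ⟨G.coeff e, fun j => G.coeff j / G.coeff e, hv, fun z => ?_⟩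
  rw [← hev, ← hmul, eval_mul, eval_sub, eval_X, eval_C, eval_eq_sum_range, hGdeg,
    Finset.sum_range_succ, Finset.sum_range]
  have hs : G.coeff e * ∑ j : Fin e, G.coeff j / G.coeff e * z ^ (j : ℕ) =
      ∑ j : Fin e, G.coeff j * z ^ (j : ℕ) := by
    rw [Finset.mul_sum]
    refine Finset.sum_congr rfl fun j _ => ?_
    field_simp
  rw [← hs]
  ring

lemma exists_auxiliary {x : K} {e ν k : ℕ} {r : Fin e → K} {A B E : Divisor (ZMod 2) K}
    (hx : ∀ s ≤ ν, x ^ s ∈ L B) (hE : 0 ≤ E) (hr : ∀ j, r j ∈ L E)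
    (hcard : e * l (2 ^ k • A + B + E) < (e + 1) * ((ν + 1) * l A)) :
    ∃ a : Fin (e + 1) → Fin (ν + 1) → K, a ≠ 0 ∧ (∀ j s, a j s ∈ L A) ∧ ∀ j : Fin e,
      ∑ s, a j.castSucc s ^ 2 ^ k * x ^ (s : ℕ) =
        r j * ∑ s, a (Fin.last e) s ^ 2 ^ k * x ^ (s : ℕ) := by
  let β : (Fin (e + 1) → Fin (ν + 1) → L A) → Fin (e + 1) → K := fun a j =>
    ∑ s, (a j s : K) ^ 2 ^ k * x ^ (s : ℕ)
  have hβ : ∀ a j, β a j ∈ L (2 ^ k • A + B) := fun a j =>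
    sum_mem fun s _ => mul_mem_L (pow_mem_L (a j s).2 _) (hx s (by omega))
  have hΦ : ∀ a (j : Fin e), β a j.castSucc - r j * β a (Fin.last e) ∈ L (2 ^ k • A + B + E) := by
    intro a j
    refine sub_mem (L_mono ?_ (hβ a _)) ?_
    · exact le_add_of_nonneg_right hE
    · rw [mul_comm]
      exact mul_mem_L (hβ a _) (hr j)
  let Φ : (Fin (e + 1) → Fin (ν + 1) → L A) → Fin e → L (2 ^ k • A + B + E) := fun a j =>
    ⟨_, hΦ a j⟩
  have hninj : ¬ Function.Injective Φ := by
    intro hinj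
    have := Nat.card_le_card_of_injective Φ hinj
    simp only [Nat.card_pi, Finset.prod_const, Finset.card_univ, Fintype.card_fin, card_L,
      ← pow_mul] at this
    have := (Nat.pow_le_pow_iff_right (le_refl 2)).1 this
    nlinarith
  simp only [Function.Injective, not_forall] at hninj
  obtain ⟨a, b, hab, hne⟩ := hninj
  have hsub : ∀ j, β (a - b) j = β a j - β b j := by
    intro j
    simp only [β, ← Finset.sum_sub_distrib, ← sub_mul]
    refine Finset.sum_congr rfl fun s _ => ?_
    rw [← sub_pow_two_pow]
    rfl
  refine ⟨fun j s => ((a - b) j s : K), ?_, fun j s => ((a - b) j s).2, fun j => ?_⟩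
  · intro h0
    apply hne
    rw [← sub_eq_zero]
    ext j s
    exact congrFun (congrFun h0 j) s
  · have h1 := congrArg Subtype.val (congrFun hab j)
    have h2 := hsub j.castSucc
    have h3 := hsub (Fin.last e)
    simp only [Φ] at h1
    change β (a - b) j.castSucc = r j * β (a - b) (Fin.last e)
    rw [h2, h3]
    linear_combination h1

lemma PlaneModel.sum_mul_pow_ne_zero (M : PlaneModel K) {e ν k : ℕ} (he : degOver M.x = e + 1)
    {A : Divisor (ZMod 2) K} (hA : ddeg A < 2 ^ k) {p : Place (ZMod 2) K} (hp : A p = 0)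
    {a : Fin (e + 1) → Fin (ν + 1) → K} (haA : ∀ j s, a j s ∈ L A) (ha : a ≠ 0) :
    ∑ j, ∑ s, a j s * ((M.x ^ (s : ℕ)) ^ 2 ^ k * (M.y ^ (j : ℕ)) ^ 2 ^ k) ≠ 0 := by
  intro hH
  let V : Submodule (ZMod 2) K := AddSubgroup.toZModSubmodule 2 (L A)
  have hV : ∀ z, z ∈ V ↔ z ∈ L A := fun z => Iff.rfl
  have : Finite V := finite_L A
  have : Module.Finite (ZMod 2) V := Module.Finite.of_finite
  let b := Module.finBasis (ZMod 2) V
  let ε : Fin (e + 1) → Fin (ν + 1) → Fin (Module.finrank (ZMod 2) V) → ZMod 2 := fun j s i =>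
    b.repr ⟨a j s, haA j s⟩ i
  have hε : ∀ j s, a j s = ∑ i, algebraMap (ZMod 2) K (ε j s i) * b i := by
    intro j s
    have := congrArg Subtype.val (b.sum_repr ⟨a j s, haA j s⟩)
    simp only [Submodule.coe_sum, Submodule.coe_smul, Algebra.smul_def] at this
    exact this.symm
  have hc := eq_zero_of_sum_pow_mul_eq_zero (a := fun i => (b i : K))
    (c := fun i => ∑ j, ∑ s, algebraMap (ZMod 2) K (ε j s i) * (M.x ^ (s : ℕ) * M.y ^ (j : ℕ)))
    hA p hp (fun i => (b i).2) (b.linearIndependent.map' V.subtype V.ker_subtype) (by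
      rw [← hH]
      simp only [sum_pow_two_pow, hε, mul_pow, algebraMap_pow_two_pow, Finset.sum_mul]
      rw [Finset.sum_comm]
      refine Finset.sum_congr rfl fun j _ => ?_
      rw [Finset.sum_comm]
      refine Finset.sum_congr rfl fun s _ => Finset.sum_congr rfl fun i _ => ?_
      ring)
  apply ha
  have hli : LinearIndependent (ZMod 2) (fun i : Fin (e + 1) × Fin (ν + 1) =>
      M.x ^ (i.2 : ℕ) * M.y ^ (i.1 : ℕ)) := by
    refine M.linearIndependent.comp (fun i : Fin (e + 1) × Fin (ν + 1) =>
      ((i.2 : ℕ), Fin.cast he.symm i.1)) ?_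
    rintro ⟨j, s⟩ ⟨j', s'⟩ h
    simp only [Prod.mk.injEq, Fin.ext_iff, Fin.val_cast] at h ⊢
    exact ⟨h.2, h.1⟩
  rw [Fintype.linearIndependent_iff] at hli
  funext j s
  rw [hε]
  refine Finset.sum_eq_zero fun i _ => ?_
  have h0 := hli (fun t => ε t.1 t.2 i) (by
    rw [Fintype.sum_prod_type]
    simp only [Algebra.smul_def]
    exact congrFun hc i) (j, s)
  simp only at h0
  rw [h0, map_zero, zero_mul]

lemma Place.mem_pw_one_of_mul (p : Place (ZMod 2) K) {u z : K} (hu : u ∈ p.ring)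
    (hu1 : u ∉ p.pw 1) (h : u * z ∈ p.pw 1) : z ∈ p.pw 1 := by
  have hu0 : u ≠ 0 := fun h => hu1 (h ▸ zero_mem _)
  by_cases hz : z = 0
  · rw [hz]; exact zero_mem _
  · rwa [p.mem_pw_of_ne (mul_ne_zero hu0 hz), p.ord_mul hu0 hz, p.ord_eq_zero hu hu1, zero_add,
      ← p.mem_pw_of_ne hz] at h

lemma Place.mem_pw_one_of_pow (p : Place (ZMod 2) K) {z : K} {k : ℕ}
    (h : z ^ k ∈ p.pw 1) : z ∈ p.pw 1 := by
  by_cases hz : z = 0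
  · rw [hz]; exact zero_mem _
  · rw [p.mem_pw_of_ne (pow_ne_zero _ hz), p.ord_pow] at h
    rw [p.mem_pw_of_ne hz]
    by_contra! h1
    nlinarith

lemma Place.mul_mem_pw_one (p : Place (ZMod 2) K) {u z : K} (hu : u ∈ p.ring) (hz : z ∈ p.pw 1) :
    u * z ∈ p.pw 1 := by
  have := p.mul_mem_pw (p.mem_pw_zero.2 hu) hz
  rwa [zero_add] at this

lemma Place.pow_sub_pow_mem_pw_one (p : Place (ZMod 2) K) {x z : K} (hx : x ∈ p.ring)
    (hz : z ∈ p.ring) (h : x - z ∈ p.pw 1) (s : ℕ) : x ^ s - z ^ s ∈ p.pw 1 := by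
  rw [← (Commute.all x z).geom_sum₂_mul s]
  refine p.mul_mem_pw_one (sum_mem fun i _ => mul_mem (pow_mem hx _) (pow_mem hz _)) h

lemma Place.evalXY_pow_mem (p : Place (ZMod 2) K) {x y : K} (hx : x ∈ p.ring) (hy : y ∈ p.ring)
    {n : ℕ} (hxn : x ^ 2 ^ n - x ∈ p.pw 1) {f : (ZMod 2)[X][X]} (hf : evalXY x y f = 0) :
    evalXY x (y ^ 2 ^ n) f ∈ p.pw 1 := by
  have hyn : y ^ 2 ^ n ∈ p.ring := pow_mem hy _
  rw [← p.evalXY_residue hx hyn]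
  have h1 : IsLocalRing.residue p.ring ⟨x, hx⟩ = IsLocalRing.residue p.ring ⟨x, hx⟩ ^ 2 ^ n := by
    rw [← map_pow]
    symm
    rw [← sub_eq_zero, ← map_sub, p.residue_eq_zero_iff]
    exact hxn
  have h2 : IsLocalRing.residue p.ring ⟨y ^ 2 ^ n, hyn⟩ =
      IsLocalRing.residue p.ring ⟨y, hy⟩ ^ 2 ^ n := by
    rw [← map_pow]
    rfl
  have h0 : evalXY (IsLocalRing.residue p.ring ⟨x, hx⟩) (IsLocalRing.residue p.ring ⟨y, hy⟩) f
      = 0 := by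
    rw [p.evalXY_residue, hf]
    exact zero_mem _
  have : CharP (IsLocalRing.ResidueField p.ring) 2 := by
    rw [← Algebra.charP_iff (ZMod 2)]
    infer_instance
  rw [h2, h1]
  have := map_evalXY (iterateFrobenius (IsLocalRing.ResidueField p.ring) 2 n)
    (IsLocalRing.residue p.ring ⟨x, hx⟩) (IsLocalRing.residue p.ring ⟨y, hy⟩) f
  rw [h0, map_zero] at this
  simp only [iterateFrobenius_def] at this
  exact this.symm

lemma Place.sum_mul_pow_mem_pw_one (p : Place (ZMod 2) K) {x y v : K} {e ν n k k' : ℕ}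
    (hn : k + k' = n) {r : Fin e → K} {f : (ZMod 2)[X][X]} (hx : x ∈ p.ring) (hy : y ∈ p.ring)
    (hxn : x ^ 2 ^ n - x ∈ p.pw 1) (hyn : y ^ 2 ^ n - y ∉ p.pw 1) (hv : v ∈ p.ring)
    (hv1 : v ∉ p.pw 1) (hf : evalXY x y f = 0)
    (hvr : ∀ z : K, evalXY x z f = v * (z - y) * (∑ j : Fin e, r j * z ^ (j : ℕ) + z ^ e))
    {a : Fin (e + 1) → Fin (ν + 1) → K} (ha : ∀ j s, a j s ∈ p.ring)
    (har : ∀ j : Fin e, ∑ s, a j.castSucc s ^ 2 ^ k * x ^ (s : ℕ) =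
        r j * ∑ s, a (Fin.last e) s ^ 2 ^ k * x ^ (s : ℕ)) :
    ∑ j, ∑ s, a j s * ((x ^ (s : ℕ)) ^ 2 ^ k' * (y ^ (j : ℕ)) ^ 2 ^ k') ∈ p.pw 1 := by
  have hyq : y ^ 2 ^ n ∈ p.ring := pow_mem hy _
  have h1 := p.evalXY_pow_mem hx hy hxn hf
  rw [hvr, mul_assoc] at h1
  have h2 := p.mem_pw_one_of_mul (sub_mem hyq hy) hyn (p.mem_pw_one_of_mul hv hv1 h1)
  apply p.mem_pw_one_of_pow (k := 2 ^ k)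
  simp only [sum_pow_two_pow]
  have h3 : ∑ j : Fin (e + 1), (∑ s, a j s ^ 2 ^ k * x ^ (s : ℕ)) * (y ^ 2 ^ n) ^ (j : ℕ)
      ∈ p.pw 1 := by
    rw [Fin.sum_univ_castSucc]
    simp only [har, Fin.val_castSucc, Fin.val_last]
    have : ∑ j : Fin e, (r j * ∑ s, a (Fin.last e) s ^ 2 ^ k * x ^ (s : ℕ)) *
          (y ^ 2 ^ n) ^ (j : ℕ) +
        (∑ s, a (Fin.last e) s ^ 2 ^ k * x ^ (s : ℕ)) * (y ^ 2 ^ n) ^ e =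
        (∑ s, a (Fin.last e) s ^ 2 ^ k * x ^ (s : ℕ)) *
          (∑ j : Fin e, r j * (y ^ 2 ^ n) ^ (j : ℕ) + (y ^ 2 ^ n) ^ e) := by
      rw [mul_add, Finset.mul_sum]
      congr 1
      refine Finset.sum_congr rfl fun j _ => ?_
      ring
    rw [this]
    exact p.mul_mem_pw_one (sum_mem fun s _ => mul_mem (pow_mem (ha _ _) _) (pow_mem hx _)) h2
  have h4 := fun j s => p.mul_mem_pw_one (mul_mem (pow_mem (ha j s) (2 ^ k))
    (pow_mem hyq (j : ℕ))) (p.pow_sub_pow_mem_pw_one (pow_mem hx _) hx hxn (s : ℕ))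
  have h5 := add_mem (sum_mem (S := p.pw 1) (t := Finset.univ) fun j _ =>
    sum_mem (S := p.pw 1) (t := Finset.univ) fun s _ => h4 j s) h3
  refine (congrArg (· ∈ p.pw 1) ?_).mp h5
  rw [← Finset.sum_add_distrib]
  refine Finset.sum_congr rfl fun j _ => ?_
  rw [Finset.sum_mul, ← Finset.sum_add_distrib]
  refine Finset.sum_congr rfl fun s _ => ?_
  rw [← hn, pow_add]
  ring

lemma sum_deg_le_of_mem_L {H : K} (hH : H ≠ 0) {W : Divisor (ZMod 2) K} (hW : H ∈ L W)
    {U : Finset (Place (ZMod 2) K)} (hU : ∀ p ∈ U, W p = 0 ∧ H ∈ p.pw 1) :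
    (∑ p ∈ U, p.deg : ℤ) ≤ ddeg W := by
  have h : H ∈ L (W - ∑ p ∈ U, Finsupp.single p 1) := by
    rw [mem_L]
    intro p
    have hs : (∑ p ∈ U, Finsupp.single p (1 : ℤ)) p = if p ∈ U then 1 else 0 := by
      rw [Finsupp.finsetSum_apply]
      simp [Finsupp.single_apply]
    rw [Finsupp.sub_apply, hs]
    split_ifs with hp
    · rw [(hU p hp).1]
      exact (hU p hp).2
    · rw [sub_zero]
      exact mem_L.1 hW p
  have := ddeg_nonneg_of_mem_L hH h
  rw [ddeg_sub, ddeg_sum] at this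
  simp only [ddeg_single, one_mul] at this
  linarith

end Stepanov

section Bound

variable [IsCFF K]

/-- The choice of parameters in Stepanov's method. -/
lemma exists_parameters (e g t : ℕ) : ∃ s₀ C : ℕ, ∀ s, s₀ < s → ∃ m ν : ℕ, (e + 1) * m < s ∧
    (e + 1) * ν ≤ e * s + C ∧ ∀ a b : ℕ, ((e + 1) * m + 1 - g : ℤ) ≤ a →
      b ≤ s * ((e + 1) * m) + (e + 1) * ν + t + 1 → e * b < (e + 1) * ((ν + 1) * a) := by
  refine ⟨(e * (g + e) + 1) * (e + 1 + g + e) + e * (t + 1) + g + 2 * e + 2, e * (g + e) + 1,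
    fun s hs => ?_⟩
  refine ⟨(s - 1) / (e + 1), (e * s + (e * (g + e) + 1)) / (e + 1), ?_, Nat.mul_div_le _ _, ?_⟩
  · have := Nat.mul_div_le (s - 1) (e + 1)
    omega
  intro a b ha hb
  have h1 := Nat.lt_mul_div_succ (s - 1) (Nat.succ_pos e)
  have h2 := Nat.lt_mul_div_succ (e * s + (e * (g + e) + 1)) (Nat.succ_pos e)
  have h3 := Nat.mul_div_le (s - 1) (e + 1)
  simp only [Nat.succ_eq_add_one] at h1 h2
  generalize (s - 1) / (e + 1) = m at *
  generalize (e * s + (e * (g + e) + 1)) / (e + 1) = ν at *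
  have h1' : (s : ℤ) - (e + 1) ≤ (e + 1) * m := by
    have : s ≤ (e + 1) * (m + 1) := by omega
    zify at this
    linarith
  have hs' : ((e * (g + e) + 1) * (e + 1 + g + e) + e * (t + 1) + g + 2 * e + 2 : ℤ) < s := by
    exact_mod_cast hs
  zify at h2 hb ⊢
  generalize hM : ((e : ℤ) + 1) * m = M at *
  have hN : ((e : ℤ) + 1) * ν = (e + 1) * (ν + 1) - (e + 1) := by ring
  rw [hN] at hb
  rw [← mul_assoc]
  generalize ((e : ℤ) + 1) * (ν + 1) = N at *
  have he0 : (0 : ℤ) ≤ e := by positivity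
  have hg0 : (0 : ℤ) ≤ g := by positivity
  have ht0 : (0 : ℤ) ≤ t := by positivity
  have hC0 : (0 : ℤ) ≤ (e * (g + e) + 1) * (e + 1 + g + e) + e * (t + 1) := by positivity
  have hN0 : 0 ≤ N := by
    have : (0 : ℤ) ≤ e * s + (e * (g + e) + 1) := by positivity
    linarith
  have hMg : 0 ≤ M + 1 - g - e := by linarith
  have i1 : (e : ℤ) * b ≤ e * (s * M + (N - (e + 1)) + t + 1) :=
    mul_le_mul_of_nonneg_left hb he0
  have i2 : N * (M + 1 - g) ≤ N * a := mul_le_mul_of_nonneg_left ha hN0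
  have i3 : (e * s + (e * (g + e) + 1)) * (M + 1 - g - e) ≤ N * (M + 1 - g - e) :=
    mul_le_mul_of_nonneg_right h2.le hMg
  have i4 : ((e : ℤ) * (g + e) + 1) * (s - (e + 1) + 1 - g - e) ≤
      (e * (g + e) + 1) * (M + 1 - g - e) :=
    mul_le_mul_of_nonneg_left (by linarith) (by positivity)
  nlinarith [mul_nonneg he0 he0]

lemma PlaneModel.exists_sum_le (M : PlaneModel K) {e g : ℕ} (he : degOver M.x = e + 1)
    (hge : ∀ D : Divisor (ZMod 2) K, 0 ≤ (l D : ℤ) - ddeg D - 1 + g) {v : K} {r : Fin e → K}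
    (hvr : ∀ z : K, evalXY M.x z M.f =
      v * (z - M.y) * (∑ j : Fin e, r j * z ^ (j : ℕ) + z ^ e)) :
    ∃ s₀ C : ℕ, ∀ n, s₀ < 2 ^ (n / 2) → ∀ U : Finset (Place (ZMod 2) K),
      (∀ p ∈ U, M.x ∈ p.ring ∧ M.y ∈ p.ring ∧ M.x ^ 2 ^ n - M.x ∈ p.pw 1 ∧
        M.y ^ 2 ^ n - M.y ∉ p.pw 1 ∧ v ∈ p.ring ∧ v ∉ p.pw 1) →
      ∑ p ∈ U, p.deg ≤ e * 2 ^ n + C * 2 ^ (n - n / 2) := by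
  set E : Divisor (ZMod 2) K := ∑ j, poleDiv (r j) with hE
  have hE0 : 0 ≤ E := Finset.sum_nonneg fun j _ => poleDiv_nonneg _
  have hr : ∀ j, r j ∈ L E := fun j =>
    L_mono (Finset.single_le_sum (f := fun j => poleDiv (r j)) (fun j _ => poleDiv_nonneg _)
      (Finset.mem_univ j)) (mem_L_poleDiv (r j))
  set X := poleDiv M.x with hX
  set Y := poleDiv M.y with hY
  have hX0 : 0 ≤ X := poleDiv_nonneg _
  have hY0 : 0 ≤ Y := poleDiv_nonneg _
  have hXd : ddeg X = e + 1 := by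
    rw [hX, ddeg_poleDiv M.transcendental_x, he]
    push_cast
    ring
  obtain ⟨s₀, C, h⟩ := exists_parameters e g (ddeg E).toNat
  have hEt : ((ddeg E).toNat : ℤ) = ddeg E := Int.toNat_of_nonneg (ddeg_nonneg hE0)
  have hYt : (((ddeg Y).toNat : ℕ) : ℤ) = ddeg Y := Int.toNat_of_nonneg (ddeg_nonneg hY0)
  refine ⟨s₀, C + e * (ddeg Y).toNat + 1, fun n hn U hU => ?_⟩
  obtain ⟨m, ν, hm, hν, hcard⟩ := h _ hn
  have hpow : ∀ (i j : ℕ) (z : K), i ≤ j → z ^ i ∈ L (j • poleDiv z) := fun i j z hij =>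
    L_mono (nsmul_le_nsmul_left (poleDiv_nonneg z) hij) (pow_mem_L (mem_L_poleDiv z) i)
  set k := n / 2 with hk
  set k' := n - n / 2 with hk'
  have hkk : k + k' = n := by omega
  have hle : 2 ^ k ≤ 2 ^ k' := Nat.pow_le_pow_right (by norm_num) (by omega)
  set A := m • X with hA
  have hAd : ddeg A = (e + 1) * m := by
    rw [hA, ddeg_nsmul, hXd]; ring
  have hA0 : 0 ≤ A := nsmul_nonneg hX0 m
  obtain ⟨a, ha0, haA, har⟩ := exists_auxiliary (x := M.x) (ν := ν) (k := k) (r := r) (A := A)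
    (B := ν • X) (fun s hs => hpow s ν M.x hs) hE0 hr (by
      apply hcard
      · have := hge A
        rw [hAd] at this
        linarith
      · have := l_le (D := 2 ^ k • A + ν • X + E)
          (add_nonneg (add_nonneg (nsmul_nonneg hA0 _) (nsmul_nonneg hX0 _)) hE0)
        rw [ddeg_add, ddeg_add, ddeg_nsmul _ A, hAd, ddeg_nsmul, hXd, ← hEt] at this
        zify
        push_cast at this
        linarith)
  obtain ⟨p₀, hp₀⟩ : ∃ p : Place (ZMod 2) K, 0 < p.ord M.x :=
    exists_ord_pos M.transcendental_x
  have hXp : ∀ p : Place (ZMod 2) K, 0 ≤ p.ord M.x → X p = 0 := by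
    intro p hp
    rw [hX, poleDiv_apply, max_eq_right (by omega)]
  have hAp : ∀ p : Place (ZMod 2) K, 0 ≤ p.ord M.x → A p = 0 := by
    intro p hp
    rw [hA, Finsupp.smul_apply, hXp p hp, smul_zero]
  have hH := M.sum_mul_pow_ne_zero (k := k') he (by
    rw [hAd]
    exact_mod_cast hm.trans_le hle) (hAp p₀ hp₀.le) haA ha0
  have hHL : ∑ j, ∑ s, a j s * ((M.x ^ (s : ℕ)) ^ 2 ^ k' * (M.y ^ (j : ℕ)) ^ 2 ^ k') ∈
      L (A + (2 ^ k' • (ν • X) + 2 ^ k' • (e • Y))) :=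
    sum_mem fun j _ => sum_mem fun s _ => mul_mem_L (haA j s) (mul_mem_L
      (pow_mem_L (hpow _ _ _ (by omega)) _) (pow_mem_L (hpow _ _ _ (by omega)) _))
  have hfin := sum_deg_le_of_mem_L hH hHL (U := U) (fun p hp => by
    obtain ⟨h1, h2, h3, h4, h5, h6⟩ := hU p hp
    have hAp' := hAp p (p.ord_nonneg h1)
    refine ⟨?_, p.sum_mul_pow_mem_pw_one hkk h1 h2 h3 h4 h5 h6 M.eval_f hvr (fun j s => ?_) har⟩
    · have hYp : Y p = 0 := by
        rw [hY, poleDiv_apply, max_eq_right (by have := p.ord_nonneg h2; omega)]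
      simp only [Finsupp.add_apply, Finsupp.smul_apply, hAp', hXp p (p.ord_nonneg h1), hYp,
        smul_zero, add_zero]
    · have := mem_L.1 (haA j s) p
      rw [hAp', neg_zero] at this
      exact p.mem_pw_zero.1 this)
  simp only [ddeg_add, ddeg_nsmul _ (ν • X), ddeg_nsmul _ (e • Y), ddeg_nsmul ν X,
    ddeg_nsmul e Y, hAd, hXd] at hfin
  rw [← hYt] at hfin
  have hq : 2 ^ n = 2 ^ k * 2 ^ k' := by rw [← pow_add, hkk]
  rw [hq]
  zify at hm hν hle ⊢
  push_cast at hfin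
  have hQ : (0 : ℤ) < 2 ^ k' := by positivity
  generalize (2 : ℤ) ^ k = s at *
  generalize (2 : ℤ) ^ k' = Q at *
  have := mul_le_mul_of_nonneg_left hν hQ.le
  linarith

/-- The number of rational points of a curve over the finite extensions of `𝔽₂`, estimated from
below. -/
theorem exists_sdeg_bound {g : ℕ}
    (hge : ∀ D : Divisor (ZMod 2) K, 0 ≤ (l D : ℤ) - ddeg D - 1 + g) :
    ∃ c : ℕ, ∀ n, 1 ≤ n → 2 ^ n ≤ sdeg K n + c * 2 ^ (n - n / 2) := by
  obtain ⟨M⟩ := nonempty_planeModel K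
  obtain ⟨e, he⟩ : ∃ e, degOver M.x = e + 1 := by
    have := finiteDimensional_of_transcendental M.transcendental_x
    exact Nat.exists_eq_succ_of_ne_zero Module.finrank_pos.ne'
  obtain ⟨v, r, hv, hvr⟩ := M.exists_cofactor he
  obtain ⟨s₀, C, hU⟩ := M.exists_sum_le he hge hvr
  obtain ⟨c₀, hc₀⟩ := M.exists_le_sum_zeros
  set B := (finite_ord_ne_zero v).toFinset with hB
  refine ⟨C + c₀ + ∑ p ∈ B, p.deg + s₀, fun n hn => ?_⟩
  have hq : 2 ^ n = 2 ^ (n / 2) * 2 ^ (n - n / 2) := by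
    rw [← pow_add]
    congr 1
    omega
  have hQ : 0 < 2 ^ (n - n / 2) := by positivity
  by_cases hs : s₀ < 2 ^ (n / 2)
  · have h1 := hc₀ n hn
    rw [he] at h1
    set Z := M.zeros n with hZ
    set R := Z.filter (fun p => M.y ^ 2 ^ n - M.y ∈ p.pw 1) with hR
    set U := (Z.filter (fun p => M.y ^ 2 ^ n - M.y ∉ p.pw 1)).filter (· ∉ B) with hUdef
    have hsub : Z ⊆ (R ∪ U) ∪ B := by
      intro p hp
      simp only [hR, hUdef, Finset.mem_union, Finset.mem_filter]
      tauto
    have h2 : ∑ p ∈ Z, p.deg ≤ ∑ p ∈ R, p.deg + ∑ p ∈ U, p.deg + ∑ p ∈ B, p.deg := by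
      refine (Finset.sum_le_sum_of_subset hsub).trans ?_
      have h5 := Finset.sum_union_inter (s₁ := R ∪ U) (s₂ := B) (f := Place.deg)
      have h6 := Finset.sum_union_inter (s₁ := R) (s₂ := U) (f := Place.deg)
      omega
    have h3 : ∑ p ∈ R, p.deg ≤ sdeg K n := by
      refine sum_le_sdeg hn R fun p hp => ?_
      rw [hR, Finset.mem_filter, hZ, M.mem_zeros hn] at hp
      exact hp.1.2.deg_dvd hn hp.1.1 hp.2
    have h4 : ∑ p ∈ U, p.deg ≤ e * 2 ^ n + C * 2 ^ (n - n / 2) := by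
      refine hU n hs U fun p hp => ?_
      rw [hUdef, Finset.mem_filter, Finset.mem_filter, hZ, M.mem_zeros hn, hB,
        Set.Finite.mem_toFinset] at hp
      obtain ⟨⟨⟨hx, hx', hy', -⟩, hy⟩, hv'⟩ := hp
      simp only [Set.mem_ofPred_eq, not_not] at hv'
      refine ⟨hx', hy', hx, hy, ?_, ?_⟩
      · rw [p.mem_ring_iff hv, hv']
      · rw [p.mem_pw_of_ne hv, hv']
        norm_num
    generalize 2 ^ (n - n / 2) = Q at *
    generalize ∑ p ∈ B, p.deg = b at *
    have : c₀ + b ≤ (c₀ + b) * Q := Nat.le_mul_of_pos_right _ hQ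
    have : 0 ≤ s₀ * Q := Nat.zero_le _
    nlinarith
  · rw [hq]
    push Not at hs
    have := Nat.mul_le_mul_right (2 ^ (n - n / 2)) hs
    have h0 := Nat.zero_le ((C + c₀ + ∑ p ∈ B, p.deg) * 2 ^ (n - n / 2))
    nlinarith

end Bound

section Dimensions

variable [IsCFF K]

theorem exists_sdeg_bound_sqrt {g : ℕ}
    (hge : ∀ D : Divisor (ZMod 2) K, 0 ≤ (l D : ℤ) - ddeg D - 1 + g) :
    ∃ c : ℕ, ∀ n, 1 ≤ n → 2 ^ n - c * √2 ^ n ≤ (sdeg K n : ℝ) := by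
  obtain ⟨c, hc⟩ := exists_sdeg_bound hge
  refine ⟨2 * c, fun n hn => ?_⟩
  have h1 : (2 : ℝ) ^ n ≤ sdeg K n + c * 2 ^ (n - n / 2) := by exact_mod_cast hc n hn
  have h2 : (2 : ℝ) ^ (n - n / 2) ≤ 2 * √2 ^ n := by
    have h3 : (2 : ℝ) ^ (n - n / 2) = √2 ^ (2 * (n - n / 2)) := by
      rw [pow_mul, Real.sq_sqrt (by norm_num)]
    have h4 : (2 : ℝ) * √2 ^ n = √2 ^ (n + 2) := by
      rw [pow_add, Real.sq_sqrt (by norm_num), mul_comm]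
    rw [h3, h4]
    exact pow_le_pow_right₀ (Real.one_le_sqrt.2 (by norm_num)) (by omega)
  have h5 : (0 : ℝ) ≤ c := by positivity
  push_cast
  nlinarith

end Dimensions

end CFF

open CFF in
/-- A congruence function field over `𝔽₂` of genus `4` and class number `1`
has an element `T` with `[K : 𝔽₂(T)] = 5`; moreover `5` is the minimal degree
of `K` over a rational subfield, and the rational subfield of degree `5` is
unique. -/
theorem unique_rational_subfield_of_degree_five
    (K : Type) [Field K] [Algebra (ZMod 2) K]
    (hFF : IsFunctionField (ZMod 2) K)
    (hconst : HasExactConstants (ZMod 2) K)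
    (hg : genus (ZMod 2) K = 4)
    (hh : classNumber (ZMod 2) K = 1) :
    ∃ T : K, Transcendental (ZMod 2) T ∧
      Module.finrank (IntermediateField.adjoin (ZMod 2) {T}) K = 5 ∧
      (∀ y : K, Transcendental (ZMod 2) y →
        5 ≤ Module.finrank (IntermediateField.adjoin (ZMod 2) {y}) K) ∧
      (∀ y : K, Transcendental (ZMod 2) y →
        Module.finrank (IntermediateField.adjoin (ZMod 2) {y}) K = 5 →
        IntermediateField.adjoin (ZMod 2) {y} = IntermediateField.adjoin (ZMod 2) {T}) := by
  have : IsCFF K := ⟨hFF, hconst⟩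
  have hp : AllPrincipal K := principal_of_classNumber hh
  obtain ⟨c, hc⟩ := exists_sdeg_bound_sqrt (riemann_of_genus (K := K) (g := 4) (by norm_num) hg).1
  obtain ⟨ℓ, hℓ, ⟨D, hD⟩, h0, h1, h2, h3, h4, h5⟩ := dims_of_sdeg hp hg hc
  refine exists_unique_rational_subfield hp (n := 5) (fun D hD hD' => ?_)
    (fun D hD => (hℓ D 5 hD).trans h5) ⟨5 • D, by rw [ddeg_nsmul, hD]; rfl⟩
  obtain ⟨m, hm⟩ := Int.eq_ofNat_of_zero_le hD
  rw [hℓ D m hm]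
  have : m < 5 := by omega
  interval_cases m <;> omega
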